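/- Let d ∈ ℕ, d ≥ 1. There exists a constant A > 0, depending only on d, such that the following holds for all sufficiently small θ > 0: if ρ₀ ∈ L¹(ℝ^d) with ρ₀ ≥ 0 and T > 0 satisfy Assumption (𝒜) for ρ₀, T, θ, and ρ is the mild solution of the mPKS equations on [0,T] with initial datum ρ₀, then for every 1 ≤ q ≤ ∞ and every 0 < t ≤ T, ρ(t) ∈ L^q(ℝ^d) and ‖ρ(t)‖_{L^q(ℝ^d)} ≤ A θ t^{−(d/2)(1−1/q)}. -/

import Mathlib

open MeasureTheory Real Filter
open scoped ENNReal BigOperators Topology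

noncomputable section

abbrev Euc (d : ℕ) : Type := EuclideanSpace ℝ (Fin d)

/-- The heat kernel on `ℝ^d`. -/
noncomputable def heatKernel (d : ℕ) (t : ℝ) (x : Euc d) : ℝ :=
  (4 * Real.pi * t) ^ (-(d : ℝ) / 2) * Real.exp (-‖x‖ ^ 2 / (4 * t))

/-- Partial derivative in the `i`-th coordinate direction. -/
noncomputable def pd {d : ℕ} {F : Type*} [NormedAddCommGroup F] [NormedSpace ℝ F]
    (i : Fin d) (f : Euc d → F) : Euc d → F :=
  fun x => fderiv ℝ f x (EuclideanSpace.single i 1)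

/-- Multi-index spatial derivative `D_x^β`. -/
noncomputable def mderiv {d : ℕ} {F : Type*} [NormedAddCommGroup F] [NormedSpace ℝ F]
    (β : Fin d → ℕ) (f : Euc d → F) : Euc d → F :=
  (List.finRange d).foldr (fun i g => (pd i)^[β i] g) f

/-- `k`-th time derivative (pointwise in space). -/
noncomputable def tderiv {d : ℕ} {F : Type*} [NormedAddCommGroup F] [NormedSpace ℝ F]
    (k : ℕ) (ρ : ℝ → Euc d → F) (t : ℝ) : Euc d → F :=
  fun x => iteratedDeriv k (fun s => ρ s x) t

/-- Convolution of two scalar functions on `ℝ^d`. -/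
noncomputable def conv {d : ℕ} (f g : Euc d → ℝ) : Euc d → ℝ :=
  fun x => ∫ y, f (x - y) * g y

/-- Convolution of a vector field with a scalar function on `ℝ^d`. -/
noncomputable def convV {d : ℕ} (f : Euc d → Euc d) (g : Euc d → ℝ) : Euc d → Euc d :=
  fun x => ∫ y, g y • f (x - y)

/-- Gradient of the heat kernel. -/
noncomputable def gradHeat (d : ℕ) (t : ℝ) : Euc d → Euc d :=
  gradient (fun x => heatKernel d t x)

/-- Gradient of the logarithmic potential `c` generated by `ρ`. -/
noncomputable def gradc (d : ℕ) (ρ : Euc d → ℝ) (x : Euc d) : Euc d :=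
  (-(1 / (d * Real.pi))) • ∫ y, (ρ y / ‖x - y‖ ^ 2) • (x - y)

/-- `|β|` for a multi-index. -/
def msize {d : ℕ} (β : Fin d → ℕ) : ℕ := ∑ i, β i

/-- The exponent `2d/(2d-1)` as an element of `ℝ≥0∞`. -/
noncomputable def qd (d : ℕ) : ℝ≥0∞ := (2 * d : ℝ≥0∞) / (2 * d - 1 : ℝ≥0∞)

/-- Right-hand side of the Duhamel formula for the mPKS equations. -/
noncomputable def mildRHS (d : ℕ) (ρ₀ : Euc d → ℝ) (ρ : ℝ → Euc d → ℝ) (t : ℝ) (x : Euc d) : ℝ :=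
  conv (heatKernel d t) ρ₀ x -
    ∫ s in Set.Ioc (0:ℝ) t,
      ∫ y, (inner ℝ (gradHeat d (t - s) (x - y)) (ρ s y • gradc d (ρ s) y) : ℝ)

/-- Mild solution of the mPKS equations on `[0,T]`. -/
def IsMildSolution (d : ℕ) (ρ₀ : Euc d → ℝ) (T : ℝ) (ρ : ℝ → Euc d → ℝ) : Prop :=
  ∀ t ∈ Set.Ioc (0:ℝ) T, ∀ x, ρ t x = mildRHS d ρ₀ ρ t x

/-- Membership in the space `X_T`. -/
def MemXT (d : ℕ) (T : ℝ) (ρ : ℝ → Euc d → ℝ) : Prop :=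
  (∀ t ∈ Set.Ioc (0:ℝ) T, MemLp (ρ t) 1 volume) ∧
  (∀ t ∈ Set.Ioc (0:ℝ) T,
    Filter.Tendsto (fun s => eLpNorm (fun x => ρ s x - ρ t x) 1 volume)
      (nhdsWithin t (Set.Ioc (0:ℝ) T)) (nhds 0)) ∧
  (∃ C : ℝ≥0∞, C ≠ ⊤ ∧ ∀ t ∈ Set.Ioc (0:ℝ) T, eLpNorm (ρ t) 1 volume ≤ C) ∧
  (∃ C : ℝ≥0∞, C ≠ ⊤ ∧ ∀ t ∈ Set.Ioc (0:ℝ) T,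
    ENNReal.ofReal (t ^ (1/4 : ℝ)) * eLpNorm (ρ t) (qd d) volume ≤ C)

/-- Assumption (𝒜): decay of the heat semigroup applied to `ρ₀`. -/
def AssumptionA (d : ℕ) (ρ₀ : Euc d → ℝ) (T θ : ℝ) : Prop :=
  ∀ q : ℝ≥0∞, 1 ≤ q → ∀ t ∈ Set.Ioc (0:ℝ) T,
    ENNReal.ofReal (t ^ (((d : ℝ) / 2) * (1 - q⁻¹.toReal))) *
      eLpNorm (conv (heatKernel d t) ρ₀) q volume ≤ ENNReal.ofReal θ

section Main
open ENNReal (ofReal ofReal_add ofReal_add_le ofReal_div_of_pos ofReal_eq_ofReal_iff ofReal_eq_zero ofReal_le_ofReal ofReal_le_ofReal_iff ofReal_le_one ofReal_lt_one ofReal_lt_top ofReal_mul ofReal_ne_top ofReal_one ofReal_rpow_of_nonneg ofReal_rpow_of_pos ofReal_sub ofReal_toReal ofReal_zero)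
open Function (uncurry)
open Set (Ioo Ioc Icc Ioi)

section Part1
variable {d : ℕ}

def Ge (d : ℕ) (t : ℝ) (x : Euc d) : ℝ≥0∞ := ofReal (heatKernel d t x)

def gk (d : ℕ) (t : ℝ) (x : Euc d) : Euc d := (-(1 / (2 * t)) * heatKernel d t x) • x

lemma hk_nonneg (t : ℝ) (ht : 0 ≤ t) (x : Euc d) : 0 ≤ heatKernel d t x := by
  unfold heatKernel; positivity

lemma hk_pos (t : ℝ) (ht : 0 < t) (x : Euc d) : 0 < heatKernel d t x := by
  unfold heatKernel; positivity

lemma hk_neg (t : ℝ) (x : Euc d) : heatKernel d t (-x) = heatKernel d t x := by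
  unfold heatKernel; simp

lemma gk_neg (t : ℝ) (x : Euc d) : gk d t (-x) = - gk d t x := by
  unfold gk; simp [hk_neg]

lemma Ge_neg (t : ℝ) (x : Euc d) : Ge d t (-x) = Ge d t x := by
  unfold Ge; simp [hk_neg]

lemma Ge_sub_comm (t : ℝ) (x y : Euc d) : Ge d t (x - y) = Ge d t (y - x) := by
  rw [← Ge_neg]; simp

lemma hk_cont (t : ℝ) : Continuous (heatKernel d t) := by
  unfold heatKernel; fun_prop

lemma gk_cont (t : ℝ) : Continuous (gk d t) := by
  have := hk_cont (d := d) t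
  unfold gk; fun_prop

@[fun_prop]
lemma hk_meas : Measurable (fun p : ℝ × Euc d => heatKernel d p.1 p.2) := by
  unfold heatKernel
  apply Measurable.mul
  · exact (measurable_const.mul measurable_fst).pow_const _
  · exact Real.measurable_exp.comp (((measurable_snd.norm.pow_const 2).neg).div (measurable_const.mul measurable_fst))

@[fun_prop]
lemma hk_meas_comp {α : Type*} [MeasurableSpace α] {f : α → ℝ} {g : α → Euc d}
    (hf : Measurable f) (hg : Measurable g) : Measurable (fun a => heatKernel d (f a) (g a)) :=
  hk_meas.comp (hf.prodMk hg)

@[fun_prop]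
lemma Ge_meas_comp {α : Type*} [MeasurableSpace α] {f : α → ℝ} {g : α → Euc d}
    (hf : Measurable f) (hg : Measurable g) : Measurable (fun a => Ge d (f a) (g a)) :=
  (hk_meas_comp hf hg).ennreal_ofReal

@[fun_prop]
lemma gk_meas_comp {α : Type*} [MeasurableSpace α] {f : α → ℝ} {g : α → Euc d}
    (hf : Measurable f) (hg : Measurable g) : Measurable (fun a => gk d (f a) (g a)) := by
  unfold gk
  exact Measurable.smul (Measurable.mul (by fun_prop) (hk_meas_comp hf hg)) hg

lemma hk_hasGrad (t : ℝ) (x : Euc d) : HasGradientAt (heatKernel d t) (gk d t x) x := by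
  rw [hasGradientAt_iff_hasFDerivAt]
  have h1 : HasFDerivAt (fun x : Euc d => ‖x‖ ^ 2) (2 • (innerSL ℝ x)) x :=
    (hasStrictFDerivAt_norm_sq x).hasFDerivAt
  have h2 : HasFDerivAt (fun x : Euc d => -‖x‖ ^ 2 / (4 * t)) ((-(1 / (4 * t))) • (2 • (innerSL ℝ x))) x := by
    have := h1.const_mul (-(1 / (4 * t)))
    have e : (fun x : Euc d => -‖x‖ ^ 2 / (4 * t)) = fun x : Euc d => -(1 / (4 * t)) * ‖x‖ ^ 2 := by
      ext y; ring
    rw [e]; exact this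
  have h3 := (h2.exp).const_mul ((4 * Real.pi * t) ^ (-(d : ℝ) / 2))
  have e : (InnerProductSpace.toDual ℝ (Euc d)) (gk d t x) = (4 * Real.pi * t) ^ (-(d : ℝ) / 2) •
      Real.exp (-‖x‖ ^ 2 / (4 * t)) • (-(1 / (4 * t))) • (2 • (innerSL ℝ x)) := by
    ext y
    simp only [InnerProductSpace.toDual_apply_apply, gk, heatKernel, inner_smul_left, smul_apply,
      innerSL_apply_apply, smul_eq_mul, nsmul_eq_mul]
    simp
    by_cases h : t = 0
    · simp [h]
    · field_simp; ring
  rw [e]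
  exact h3

lemma gradHeat_eq (t : ℝ) : gradHeat d t = gk d t := by
  ext1 x
  exact (hk_hasGrad t x).gradient

lemma integral_hk (t : ℝ) (ht : 0 < t) : ∫ x : Euc d, heatKernel d t x = 1 := by
  unfold heatKernel
  rw [integral_const_mul]
  have := GaussianFourier.integral_rexp_neg_mul_sq_norm (V := Euc d) (b := 1 / (4 * t)) (by positivity)
  have h2 : (fun x : Euc d => Real.exp (-‖x‖ ^ 2 / (4 * t))) = fun x : Euc d => Real.exp (-(1 / (4 * t)) * ‖x‖ ^ 2) := by
    ext x; congr 1; ring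
  rw [h2, this, finrank_euclideanSpace_fin]
  have : (π / (1 / (4 * t))) = 4 * π * t := by field_simp
  rw [this, ← Real.rpow_add (by positivity)]
  have : -(d : ℝ) / 2 + d / 2 = 0 := by ring
  rw [this, Real.rpow_zero]

lemma integrable_hk (t : ℝ) (ht : 0 < t) : Integrable (heatKernel d t) := by
  by_contra h
  have := integral_undef h
  rw [integral_hk t ht] at this
  norm_num at this

lemma lint_Ge (t : ℝ) (ht : 0 < t) : ∫⁻ x : Euc d, Ge d t x = 1 := by
  unfold Ge
  rw [← ofReal_integral_eq_lintegral_ofReal (integrable_hk t ht) (ae_of_all _ (hk_nonneg t ht.le)),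
    integral_hk t ht]
  simp

lemma lint_Ge_sub (t : ℝ) (ht : 0 < t) (x : Euc d) : ∫⁻ y : Euc d, Ge d t (x - y) = 1 := by
  rw [lintegral_sub_left_eq_self (fun y => Ge d t y) x, lint_Ge t ht]

lemma hk_le (t : ℝ) (ht : 0 < t) (x : Euc d) : heatKernel d t x ≤ (4 * π * t) ^ (-(d : ℝ) / 2) := by
  unfold heatKernel
  apply mul_le_of_le_one_right (by positivity)
  rw [Real.exp_le_one_iff, neg_div]
  have : 0 ≤ ‖x‖ ^ 2 / (4 * t) := by positivity
  linarith

lemma hk_two (t : ℝ) (ht : 0 < t) (x : Euc d) :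
    heatKernel d t x = 2 ^ ((d : ℝ) / 2) * Real.exp (-‖x‖ ^ 2 / (8 * t)) * heatKernel d (2 * t) x := by
  unfold heatKernel
  have h1 : (4 * π * (2 * t)) = 2 * (4 * π * t) := by ring
  rw [h1, Real.mul_rpow (x := 2) (y := 4 * π * t) (by positivity) (by positivity)]
  have h2 : (2 : ℝ) ^ ((d : ℝ) / 2) * 2 ^ (-(d : ℝ) / 2) = 1 := by
    rw [← Real.rpow_add (by positivity)]
    have : (d : ℝ) / 2 + -(d : ℝ) / 2 = 0 := by ring
    rw [this, Real.rpow_zero]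
  have h3 : Real.exp (-‖x‖ ^ 2 / (4 * t)) = Real.exp (-‖x‖ ^ 2 / (8 * t)) * Real.exp (-‖x‖ ^ 2 / (4 * (2 * t))) := by
    rw [← Real.exp_add]; congr 1; field_simp; ring
  rw [h3]
  generalize (2 : ℝ) ^ ((d : ℝ) / 2) = A at *
  generalize (2 : ℝ) ^ (-(d : ℝ) / 2) = B at *
  generalize (4 * π * t) ^ (-(d : ℝ) / 2) = D
  linear_combination (-(D * Real.exp (-‖x‖ ^ 2 / (8 * t)) * Real.exp (-‖x‖ ^ 2 / (4 * (2 * t))))) * h2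

lemma hk_le_two (t : ℝ) (ht : 0 < t) (x : Euc d) :
    heatKernel d t x ≤ 2 ^ ((d : ℝ) / 2) * heatKernel d (2 * t) x := by
  rw [hk_two t ht x]
  have h1 : Real.exp (-‖x‖ ^ 2 / (8 * t)) ≤ 1 := by
    rw [Real.exp_le_one_iff, neg_div]
    have : 0 ≤ ‖x‖ ^ 2 / (8 * t) := by positivity
    linarith
  have h2 := hk_nonneg (2 * t) (by positivity) x
  have h3 : (0:ℝ) ≤ 2 ^ ((d : ℝ) / 2) := by positivity
  gcongr
  exact mul_le_of_le_one_right h3 h1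

lemma gk_norm_le (t : ℝ) (ht : 0 < t) (x : Euc d) :
    ‖gk d t x‖ ≤ 2 ^ ((d : ℝ) / 2) * t ^ (-(1 / 2) : ℝ) * heatKernel d (2 * t) x := by
  have h0 := hk_nonneg t ht.le x
  have h2 := hk_nonneg (2 * t) (by positivity) x
  have e1 : ‖gk d t x‖ = (‖x‖ / (2 * t)) * heatKernel d t x := by
    unfold gk
    rw [norm_smul, norm_mul, norm_neg, Real.norm_of_nonneg h0, Real.norm_of_nonneg (by positivity)]
    ring
  rw [e1, hk_two t ht x]
  have hs : t ^ (-(1 / 2) : ℝ) = (√t)⁻¹ := by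
    rw [Real.rpow_neg ht.le, Real.sqrt_eq_rpow]
  have key : (‖x‖ / (2 * t)) * Real.exp (-‖x‖ ^ 2 / (8 * t)) ≤ (√t)⁻¹ := by
    have hst : 0 < √t := Real.sqrt_pos.mpr ht
    have htt : t = √t * √t := (Real.mul_self_sqrt ht.le).symm
    set z := ‖x‖ / √t with hz
    have hx : ‖x‖ = z * √t := by rw [hz]; field_simp
    have e2 : -‖x‖ ^ 2 / (8 * t) = -(z ^ 2 / 8) := by
      rw [hx]; nth_rewrite 2 [htt]; field_simp
    have e3 : ‖x‖ / (2 * t) = (z / 2) * (√t)⁻¹ := by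
      rw [hx]; nth_rewrite 2 [htt]; field_simp
    rw [e2, e3, Real.exp_neg]
    have h5 : z / 2 ≤ Real.exp (z ^ 2 / 8) := by
      have := Real.add_one_le_exp (z ^ 2 / 8)
      nlinarith [sq_nonneg (z - 2)]
    have hE := Real.exp_pos (z ^ 2 / 8)
    calc z / 2 * (√t)⁻¹ * (Real.exp (z ^ 2 / 8))⁻¹ = (z / 2 / Real.exp (z ^ 2 / 8)) * (√t)⁻¹ := by ring
      _ ≤ 1 * (√t)⁻¹ := by
        gcongr
        rw [div_le_one hE]; exact h5
      _ = _ := one_mul _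
  rw [hs]
  calc ‖x‖ / (2 * t) * (2 ^ ((d : ℝ) / 2) * Real.exp (-‖x‖ ^ 2 / (8 * t)) * heatKernel d (2 * t) x)
      = 2 ^ ((d : ℝ) / 2) * (‖x‖ / (2 * t) * Real.exp (-‖x‖ ^ 2 / (8 * t))) * heatKernel d (2 * t) x := by ring
    _ ≤ _ := by gcongr

lemma integrable_gk (t : ℝ) (ht : 0 < t) : Integrable (gk d t) := by
  refine Integrable.mono' ((integrable_hk (d := d) (2 * t) (by positivity)).const_mul (2 ^ ((d : ℝ) / 2) * t ^ (-(1 / 2) : ℝ)))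
    (gk_cont t).aestronglyMeasurable (ae_of_all _ (gk_norm_le t ht))

def Cd (d : ℕ) : ℝ := 2 ^ ((d : ℝ) / 2)

lemma Cd_pos : 0 < Cd d := by unfold Cd; positivity
lemma one_le_Cd : 1 ≤ Cd d := by unfold Cd; apply Real.one_le_rpow <;> [norm_num; positivity]

lemma gk_enorm_le (t : ℝ) (ht : 0 < t) (x : Euc d) :
    ‖gk d t x‖ₑ ≤ ofReal (Cd d * t ^ (-(1 / 2) : ℝ)) * Ge d (2 * t) x := by
  unfold Ge Cd
  rw [← ofReal_mul (by positivity), ← ofReal_norm]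
  exact ofReal_le_ofReal (gk_norm_le t ht x)

lemma lint_gk (t : ℝ) (ht : 0 < t) :
    ∫⁻ x : Euc d, ‖gk d t x‖ₑ ≤ ofReal (Cd d * t ^ (-(1 / 2) : ℝ)) := by
  calc _ ≤ ∫⁻ x : Euc d, ofReal (Cd d * t ^ (-(1 / 2) : ℝ)) * Ge d (2 * t) x :=
        lintegral_mono (gk_enorm_le t ht)
    _ = _ := by
      rw [lintegral_const_mul _ (by fun_prop), lint_Ge _ (by positivity), mul_one]

lemma hk_prod (r s : ℝ) (hr : 0 < r) (hs : 0 < s) (x y : Euc d) :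
    heatKernel d r (x - y) * heatKernel d s y =
      heatKernel d (r + s) x * heatKernel d (r * s / (r + s)) (y - (s / (r + s)) • x) := by
  unfold heatKernel
  have e1 : (4 * π * r) ^ (-(d : ℝ) / 2) * (4 * π * s) ^ (-(d : ℝ) / 2) =
      (4 * π * (r + s)) ^ (-(d : ℝ) / 2) * (4 * π * (r * s / (r + s))) ^ (-(d : ℝ) / 2) := by
    rw [← Real.mul_rpow (by positivity) (by positivity), ← Real.mul_rpow (by positivity) (by positivity)]
    congr 1; field_simp
  have e2 : Real.exp (-‖x - y‖ ^ 2 / (4 * r)) * Real.exp (-‖y‖ ^ 2 / (4 * s)) =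
      Real.exp (-‖x‖ ^ 2 / (4 * (r + s))) * Real.exp (-‖y - (s / (r + s)) • x‖ ^ 2 / (4 * (r * s / (r + s)))) := by
    rw [← Real.exp_add, ← Real.exp_add]
    congr 1
    rw [norm_sub_sq_real, norm_sub_sq_real, norm_smul, inner_smul_right, real_inner_comm x y,
      Real.norm_of_nonneg (by positivity)]
    field_simp
    ring
  calc _ = ((4 * π * r) ^ (-(d : ℝ) / 2) * (4 * π * s) ^ (-(d : ℝ) / 2)) * (Real.exp (-‖x - y‖ ^ 2 / (4 * r)) * Real.exp (-‖y‖ ^ 2 / (4 * s))) := by ring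
    _ = _ := by rw [e1, e2]; ring

lemma hk_semi (r s : ℝ) (hr : 0 < r) (hs : 0 < s) (x : Euc d) :
    ∫ y, heatKernel d r (x - y) * heatKernel d s y = heatKernel d (r + s) x := by
  simp_rw [hk_prod r s hr hs x]
  rw [integral_const_mul, integral_sub_right_eq_self (fun y => heatKernel d (r * s / (r + s)) y),
    integral_hk _ (by positivity), mul_one]

lemma Ge_semi (r s : ℝ) (hr : 0 < r) (hs : 0 < s) (x : Euc d) :
    ∫⁻ y, Ge d r (x - y) * Ge d s y = Ge d (r + s) x := by
  have : ∀ y, Ge d r (x - y) * Ge d s y = Ge d (r + s) x * Ge d (r * s / (r + s)) (y - (s / (r + s)) • x) := by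
    intro y
    unfold Ge
    rw [← ofReal_mul (hk_nonneg _ hr.le _), ← ofReal_mul (hk_nonneg _ (by positivity) _),
      hk_prod r s hr hs]
  simp_rw [this]
  rw [lintegral_const_mul _ (by fun_prop), lintegral_sub_right_eq_self (fun y => Ge d (r * s / (r + s)) y),
    lint_Ge _ (by positivity), mul_one]

lemma integral_hk_smul (t : ℝ) (ht : 0 < t) : Integrable (fun y : Euc d => heatKernel d t y • y) ∧
    ∫ y : Euc d, heatKernel d t y • y = 0 := by
  constructor
  · have := (integrable_gk (d := d) t ht).smul (-(2 * t))
    refine this.congr (ae_of_all _ fun y => ?_)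
    simp only [Pi.smul_apply, gk, smul_smul]
    congr 1; field_simp
  · have h := integral_neg_eq_self (fun y : Euc d => heatKernel d t y • y) volume
    simp only [hk_neg, smul_neg, integral_neg] at h
    set v := ∫ y : Euc d, heatKernel d t y • y
    have h2 : (2 : ℝ) • v = 0 := by rw [two_smul]; nth_rewrite 1 [← h]; simp
    simpa using h2

lemma gk_semi (r s : ℝ) (hr : 0 < r) (hs : 0 < s) (x : Euc d) :
    ∫ y, heatKernel d r (x - y) • gk d s y = gk d (r + s) x := by
  set σ := r * s / (r + s) with hσ
  have hσp : 0 < σ := by positivity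
  set m : Euc d := (s / (r + s)) • x with hm
  have : ∀ y, heatKernel d r (x - y) • gk d s y =
      (-(1 / (2 * s)) * heatKernel d (r + s) x) • (heatKernel d σ (y - m) • (y - m) + heatKernel d σ (y - m) • m) := by
    intro y
    rw [← smul_add, sub_add_cancel]
    unfold gk
    rw [smul_smul, smul_smul]
    congr 1
    have := hk_prod r s hr hs x y
    calc _ = -(1 / (2 * s)) * (heatKernel d r (x - y) * heatKernel d s y) := by ring
      _ = _ := by rw [this]; ring
  simp_rw [this]
  rw [integral_smul, integral_sub_right_eq_self (fun y => heatKernel d σ y • y + heatKernel d σ y • m),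
    integral_add (integral_hk_smul σ hσp).1 ((integrable_hk σ hσp).smul_const m),
    (integral_hk_smul σ hσp).2, integral_smul_const, integral_hk σ hσp]
  unfold gk
  rw [zero_add, one_smul, hm, smul_smul]
  congr 1; field_simp
end Part1

section Part2
variable {d : ℕ}

lemma hk_ftc (t : ℝ) (z w : Euc d) :
    heatKernel d t (z + w) - heatKernel d t z = ∫ θ in (0:ℝ)..1, inner ℝ (gk d t (z + θ • w)) w := by
  have hc : Continuous (fun θ : ℝ => inner ℝ (gk d t (z + θ • w)) w) := by
    have := gk_cont (d := d) t
    fun_prop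
  have h : ∀ θ ∈ Set.uIcc (0:ℝ) 1, HasDerivAt (fun θ : ℝ => heatKernel d t (z + θ • w)) (inner ℝ (gk d t (z + θ • w)) w) θ := by
    intro θ _
    have h1 : HasDerivAt (fun θ : ℝ => z + θ • w) w θ := by
      have := ((hasDerivAt_id θ).smul_const w).const_add z
      simpa using this
    have h2 := (hk_hasGrad (d := d) t (z + θ • w)).hasFDerivAt
    have h3 := h2.comp_hasDerivAt θ h1
    have e3 : ((InnerProductSpace.toDual ℝ (Euc d)) (gk d t (z + θ • w))) w = inner ℝ (gk d t (z + θ • w)) w := by simp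
    rw [e3] at h3
    exact h3
  rw [intervalIntegral.integral_eq_sub_of_hasDerivAt h (hc.intervalIntegrable _ _)]
  simp

lemma lint_shift_le (K : Euc d → ℝ≥0∞) (hK : Measurable K) (w : Euc d) :
    ∫⁻ z, ∫⁻ θ in Ioc (0:ℝ) 1, K (z + θ • w) = ∫⁻ z, K z := by
  rw [lintegral_lintegral_swap (by fun_prop)]
  have : ∀ θ : ℝ, ∫⁻ z, K (z + θ • w) = ∫⁻ z, K z := fun θ => lintegral_add_right_eq_self K _
  simp [this]

lemma diff1 (t : ℝ) (ht : 0 < t) (w : Euc d) :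
    ∫⁻ z, ‖heatKernel d t (z + w) - heatKernel d t z‖ₑ ≤ ofReal (Cd d * t ^ (-(1 / 2) : ℝ)) * ‖w‖ₑ := by
  have h : ∀ z, ‖heatKernel d t (z + w) - heatKernel d t z‖ₑ ≤ ∫⁻ θ in Ioc (0:ℝ) 1, ‖gk d t (z + θ • w)‖ₑ * ‖w‖ₑ := by
    intro z
    rw [hk_ftc, intervalIntegral.integral_of_le zero_le_one]
    refine (enorm_integral_le_lintegral_enorm _).trans (lintegral_mono fun θ => ?_)
    rw [← ofReal_norm, ← ofReal_norm (gk d t _), ← ofReal_norm w, ← ofReal_mul (by positivity)]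
    exact ofReal_le_ofReal (norm_inner_le_norm _ _)
  calc _ ≤ ∫⁻ z, ∫⁻ θ in Ioc (0:ℝ) 1, ‖gk d t (z + θ • w)‖ₑ * ‖w‖ₑ := lintegral_mono h
    _ = ∫⁻ z, ‖gk d t z‖ₑ * ‖w‖ₑ := lint_shift_le (fun z => ‖gk d t z‖ₑ * ‖w‖ₑ) (by
        have := (gk_cont (d := d) t).measurable
        fun_prop) w
    _ = (∫⁻ z, ‖gk d t z‖ₑ) * ‖w‖ₑ := lintegral_mul_const _ (by
        have := (gk_cont (d := d) t).measurable
        fun_prop)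
    _ ≤ _ := by gcongr; exact lint_gk t ht

lemma integrable_hk_gk (r s : ℝ) (hr : 0 < r) (hs : 0 < s) (x : Euc d) :
    Integrable (fun y => heatKernel d r (x - y) • gk d s y) := by
  refine Integrable.bdd_smul (φ := fun y => heatKernel d r (x - y)) (f := gk d s) (integrable_gk s hs) ((4 * π * r) ^ (-(d : ℝ) / 2)) ?_ ?_
  · exact ((hk_cont r).comp (by fun_prop)).aestronglyMeasurable
  · refine ae_of_all _ fun y => ?_
    rw [Real.norm_of_nonneg (hk_nonneg r hr.le _)]
    exact hk_le r hr _

lemma half_rpow (t : ℝ) (ht : 0 < t) : (t / 2) ^ (-(1 / 2) : ℝ) * (t / 2) ^ (-(1 / 2) : ℝ) = 2 * t ^ (-1 : ℝ) := by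
  rw [← Real.rpow_add (by positivity)]
  norm_num
  rw [Real.rpow_neg_one, Real.rpow_neg_one]; field_simp

lemma diff2 (t : ℝ) (ht : 0 < t) (w : Euc d) :
    ∫⁻ z, ‖gk d t (z + w) - gk d t z‖ₑ ≤ ofReal (2 * Cd d ^ 2 * t ^ (-1 : ℝ)) * ‖w‖ₑ := by
  have ht2 : 0 < t / 2 := by positivity
  have key : ∀ x, gk d t x = ∫ y, heatKernel d (t / 2) (x - y) • gk d (t / 2) y := by
    intro x; rw [gk_semi _ _ ht2 ht2]; congr 1; ring
  have h : ∀ z, ‖gk d t (z + w) - gk d t z‖ₑ ≤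
      ∫⁻ y, ‖heatKernel d (t / 2) ((z - y) + w) - heatKernel d (t / 2) (z - y)‖ₑ * ‖gk d (t / 2) y‖ₑ := by
    intro z
    rw [key, key, ← integral_sub (integrable_hk_gk _ _ ht2 ht2 _) (integrable_hk_gk _ _ ht2 ht2 _)]
    refine (enorm_integral_le_lintegral_enorm _).trans (lintegral_mono fun y => ?_)
    rw [← sub_smul, enorm_smul, sub_add_eq_add_sub]
  have m1 := (gk_cont (d := d) (t / 2)).measurable
  have m2 := (hk_cont (d := d) (t / 2)).measurable
  calc _ ≤ _ := lintegral_mono h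
    _ = ∫⁻ y, ∫⁻ z, ‖heatKernel d (t / 2) ((z - y) + w) - heatKernel d (t / 2) (z - y)‖ₑ * ‖gk d (t / 2) y‖ₑ :=
      lintegral_lintegral_swap (by fun_prop)
    _ = ∫⁻ y, (∫⁻ z, ‖heatKernel d (t / 2) (z + w) - heatKernel d (t / 2) z‖ₑ) * ‖gk d (t / 2) y‖ₑ := by
      congr 1; ext y
      rw [lintegral_mul_const _ (by fun_prop),
        lintegral_sub_right_eq_self (fun z => ‖heatKernel d (t / 2) (z + w) - heatKernel d (t / 2) z‖ₑ)]
    _ ≤ ∫⁻ y, (ofReal (Cd d * (t / 2) ^ (-(1 / 2) : ℝ)) * ‖w‖ₑ) * ‖gk d (t / 2) y‖ₑ := by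
      gcongr; exact diff1 _ ht2 w
    _ = (ofReal (Cd d * (t / 2) ^ (-(1 / 2) : ℝ)) * ‖w‖ₑ) * ∫⁻ y, ‖gk d (t / 2) y‖ₑ :=
      lintegral_const_mul _ (by fun_prop)
    _ ≤ (ofReal (Cd d * (t / 2) ^ (-(1 / 2) : ℝ)) * ‖w‖ₑ) * ofReal (Cd d * (t / 2) ^ (-(1 / 2) : ℝ)) := by
      gcongr; exact lint_gk _ ht2
    _ = _ := by
      have := Cd_pos (d := d)
      rw [mul_right_comm, ← ofReal_mul (by positivity)]
      congr 2
      calc _ = Cd d ^ 2 * ((t / 2) ^ (-(1 / 2) : ℝ) * (t / 2) ^ (-(1 / 2) : ℝ)) := by ring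
        _ = _ := by rw [half_rpow t ht]; ring

lemma rem_sq (t : ℝ) (ht : 0 < t) (w : Euc d) :
    ∫⁻ z, ‖heatKernel d t (z + w) - heatKernel d t z - inner ℝ (gk d t z) w‖ₑ ≤
      ofReal (2 * Cd d ^ 2 * t ^ (-1 : ℝ)) * ‖w‖ₑ * ‖w‖ₑ := by
  have hc := gk_cont (d := d) t
  have m1 := hc.measurable
  have h : ∀ z, ‖heatKernel d t (z + w) - heatKernel d t z - inner ℝ (gk d t z) w‖ₑ ≤
      ∫⁻ θ in Ioc (0:ℝ) 1, ‖gk d t (z + θ • w) - gk d t z‖ₑ * ‖w‖ₑ := by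
    intro z
    have e : inner ℝ (gk d t z) w = ∫ θ in (0:ℝ)..1, inner ℝ (gk d t z) w := by simp
    rw [hk_ftc, e, ← intervalIntegral.integral_sub ((by fun_prop : Continuous fun θ : ℝ => inner ℝ (gk d t (z + θ • w)) w).intervalIntegrable _ _) (by simp),
      intervalIntegral.integral_of_le zero_le_one]
    refine (enorm_integral_le_lintegral_enorm _).trans (lintegral_mono fun θ => ?_)
    rw [← inner_sub_left, ← ofReal_norm, ← ofReal_norm (gk d t _ - _), ← ofReal_norm w, ← ofReal_mul (by positivity)]
    exact ofReal_le_ofReal (norm_inner_le_norm _ _)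
  calc _ ≤ ∫⁻ z, ∫⁻ θ in Ioc (0:ℝ) 1, ‖gk d t (z + θ • w) - gk d t z‖ₑ * ‖w‖ₑ := lintegral_mono h
    _ = ∫⁻ θ in Ioc (0:ℝ) 1, ∫⁻ z, ‖gk d t (z + θ • w) - gk d t z‖ₑ * ‖w‖ₑ :=
      lintegral_lintegral_swap (by fun_prop)
    _ ≤ ∫⁻ θ in Ioc (0:ℝ) 1, ofReal (2 * Cd d ^ 2 * t ^ (-1 : ℝ)) * ‖w‖ₑ * ‖w‖ₑ := by
      refine setLIntegral_mono measurable_const fun θ hθ => ?_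
      rw [lintegral_mul_const _ (by fun_prop)]
      gcongr
      refine (diff2 t ht (θ • w)).trans ?_
      gcongr
      rw [enorm_smul]
      have : ‖θ‖ₑ ≤ 1 := by
        rw [← ofReal_norm, Real.norm_of_nonneg hθ.1.le]
        exact ofReal_le_one.mpr hθ.2
      exact mul_le_of_le_one_left (by positivity) this
    _ = _ := by simp

lemma rem_lin (t : ℝ) (ht : 0 < t) (w : Euc d) :
    ∫⁻ z, ‖heatKernel d t (z + w) - heatKernel d t z - inner ℝ (gk d t z) w‖ₑ ≤
      ofReal (2 * Cd d * t ^ (-(1 / 2) : ℝ)) * ‖w‖ₑ := by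
  have m1 := (gk_cont (d := d) t).measurable
  have m2 := (hk_cont (d := d) t).measurable
  have hC := Cd_pos (d := d)
  calc _ ≤ ∫⁻ z, (‖heatKernel d t (z + w) - heatKernel d t z‖ₑ + ‖gk d t z‖ₑ * ‖w‖ₑ) := by
        refine lintegral_mono fun z => ?_
        refine (enorm_sub_le).trans ?_
        gcongr
        rw [← ofReal_norm, ← ofReal_norm (gk d t _), ← ofReal_norm w, ← ofReal_mul (by positivity)]
        exact ofReal_le_ofReal (norm_inner_le_norm _ _)
    _ = (∫⁻ z, ‖heatKernel d t (z + w) - heatKernel d t z‖ₑ) + (∫⁻ z, ‖gk d t z‖ₑ) * ‖w‖ₑ := by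
        rw [lintegral_add_left (by fun_prop), lintegral_mul_const _ (by fun_prop)]
    _ ≤ ofReal (Cd d * t ^ (-(1 / 2) : ℝ)) * ‖w‖ₑ + ofReal (Cd d * t ^ (-(1 / 2) : ℝ)) * ‖w‖ₑ := by
        gcongr
        · exact diff1 t ht w
        · exact lint_gk t ht
    _ = _ := by
      rw [← add_mul, ← ofReal_add (by positivity) (by positivity)]
      congr 2; ring

lemma rem_est (t : ℝ) (ht : 0 < t) (w : Euc d) :
    ∫⁻ z, ‖heatKernel d t (z + w) - heatKernel d t z - inner ℝ (gk d t z) w‖ₑ ≤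
      ofReal (2 * Cd d ^ 2 * ‖w‖ ^ (3 / 2 : ℝ) * t ^ (-(3 / 4) : ℝ)) := by
  have hC := one_le_Cd (d := d)
  have hC0 := Cd_pos (d := d)
  set z := ‖w‖ * t ^ (-(1 / 2) : ℝ) with hz
  have hz0 : 0 ≤ z := by positivity
  have e : ‖w‖ ^ (3 / 2 : ℝ) * t ^ (-(3 / 4) : ℝ) = z ^ (3 / 2 : ℝ) := by
    rw [hz, Real.mul_rpow (by positivity) (by positivity), ← Real.rpow_mul ht.le]; norm_num
  rw [mul_assoc, e]
  by_cases h : z ≤ 1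
  · refine (rem_sq t ht w).trans ?_
    rw [← ofReal_norm w, ← ofReal_mul (by positivity), ← ofReal_mul (by positivity)]
    apply ofReal_le_ofReal
    have : t ^ (-1 : ℝ) = t ^ (-(1 / 2) : ℝ) * t ^ (-(1 / 2) : ℝ) := by
      rw [← Real.rpow_add ht]; norm_num
    calc _ = 2 * Cd d ^ 2 * z ^ (2 : ℝ) := by rw [this, hz, Real.rpow_two]; ring
      _ ≤ _ := by
        gcongr 2 * Cd d ^ 2 * ?_
        by_cases hz1 : z = 0
        · simp [hz1]
        exact Real.rpow_le_rpow_of_exponent_ge (lt_of_le_of_ne hz0 (Ne.symm hz1)) h (by norm_num)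
  · push Not at h
    refine (rem_lin t ht w).trans ?_
    rw [← ofReal_norm w, ← ofReal_mul (by positivity)]
    apply ofReal_le_ofReal
    calc _ = 2 * Cd d * z ^ (1 : ℝ) := by rw [hz, Real.rpow_one]; ring
      _ ≤ 2 * Cd d ^ 2 * z ^ (1 : ℝ) := by gcongr; nlinarith
      _ ≤ _ := by
        gcongr 2 * Cd d ^ 2 * ?_
        exact Real.rpow_le_rpow_of_exponent_le h.le (by norm_num)

def Hr (d : ℕ) (t : ℝ) (f : Euc d → ℝ) (x : Euc d) : ℝ := ∫ y, heatKernel d t (x - y) * f y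
def DH (d : ℕ) (t : ℝ) (f : Euc d → ℝ) (x : Euc d) : Euc d := ∫ y, f y • gk d t (x - y)

lemma kern_bound {F : Type*} [NormedAddCommGroup F] [NormedSpace ℝ F] (k : Euc d → F) (f : Euc d → ℝ) (c B : ℝ)
    (hf : ∀ y, |f y| ≤ c) (hc : 0 ≤ c) (hB : 0 ≤ B) (hk : ∫⁻ z, ‖k z‖ₑ ≤ ofReal B) (x : Euc d) :
    ‖∫ y, f y • k (x - y)‖ ≤ c * B := by
  rw [← ofReal_le_ofReal_iff (by positivity), ofReal_norm]
  calc _ ≤ ∫⁻ y, ‖f y • k (x - y)‖ₑ := enorm_integral_le_lintegral_enorm _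
    _ ≤ ∫⁻ y, ofReal c * ‖k (x - y)‖ₑ := by
      refine lintegral_mono fun y => ?_
      rw [enorm_smul]; gcongr
      rw [← ofReal_norm]; exact ofReal_le_ofReal (hf y)
    _ = ofReal c * ∫⁻ y, ‖k (x - y)‖ₑ := lintegral_const_mul' _ _ (by simp)
    _ = ofReal c * ∫⁻ y, ‖k y‖ₑ := by rw [lintegral_sub_left_eq_self (fun y => ‖k y‖ₑ) x]
    _ ≤ _ := by rw [ofReal_mul hc]; gcongr

lemma Hr_eq (t : ℝ) (f : Euc d → ℝ) (x : Euc d) : Hr d t f x = ∫ y, f y • heatKernel d t (x - y) := by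
  unfold Hr; congr 1; ext y; simp [mul_comm]

lemma integrable_kern {F : Type*} [NormedAddCommGroup F] [NormedSpace ℝ F] {k : Euc d → F} (hk : Integrable k)
    {f : Euc d → ℝ} (hfm : Measurable f) {c : ℝ} (hf : ∀ y, |f y| ≤ c) (x : Euc d) :
    Integrable (fun y => f y • k (x - y)) :=
  (hk.comp_sub_left x).bdd_smul c hfm.aestronglyMeasurable (ae_of_all _ hf)

lemma Hr_abs_le (t : ℝ) (ht : 0 < t) (f : Euc d → ℝ) (c : ℝ) (hc : 0 ≤ c) (hf : ∀ y, |f y| ≤ c) (x : Euc d) :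
    |Hr d t f x| ≤ c := by
  rw [Hr_eq, ← Real.norm_eq_abs]
  have := kern_bound (heatKernel d t) f c 1 hf hc zero_le_one (by
    have := lint_Ge (d := d) t ht
    unfold Ge at this
    rw [ofReal_one, ← this]
    refine lintegral_mono fun z => ?_
    rw [← ofReal_norm, Real.norm_of_nonneg (hk_nonneg t ht.le _)]) x
  simpa using this

lemma DH_norm_le (t : ℝ) (ht : 0 < t) (f : Euc d → ℝ) (c : ℝ) (hc : 0 ≤ c) (hf : ∀ y, |f y| ≤ c) (x : Euc d) :
    ‖DH d t f x‖ ≤ c * (Cd d * t ^ (-(1 / 2) : ℝ)) := by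
  have hC0 := Cd_pos (d := d)
  exact kern_bound (gk d t) f c _ hf hc (by positivity) (lint_gk t ht) x

lemma Hr_lip (t : ℝ) (ht : 0 < t) (f : Euc d → ℝ) (hfm : Measurable f) (c : ℝ) (hc : 0 ≤ c) (hf : ∀ y, |f y| ≤ c) (x w : Euc d) :
    |Hr d t f (x + w) - Hr d t f x| ≤ c * (Cd d * t ^ (-(1 / 2) : ℝ) * ‖w‖) := by
  have hC0 := Cd_pos (d := d)
  rw [Hr_eq, Hr_eq, ← integral_sub (integrable_kern (integrable_hk t ht) hfm hf _) (integrable_kern (integrable_hk t ht) hfm hf _),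
    ← Real.norm_eq_abs]
  have := kern_bound (fun z => heatKernel d t (z + w) - heatKernel d t z) f c (Cd d * t ^ (-(1 / 2) : ℝ) * ‖w‖) hf hc (by positivity) (by
    rw [ofReal_mul (by positivity), ofReal_norm]
    exact diff1 t ht w) x
  refine le_of_eq_of_le ?_ this
  congr 2; ext y
  rw [← smul_sub, sub_add_eq_add_sub]

lemma Hr_rem (t : ℝ) (ht : 0 < t) (f : Euc d → ℝ) (hfm : Measurable f) (c : ℝ) (hc : 0 ≤ c) (hf : ∀ y, |f y| ≤ c) (x w : Euc d) :
    |Hr d t f (x + w) - Hr d t f x - inner ℝ (DH d t f x) w| ≤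
      c * (2 * Cd d ^ 2 * ‖w‖ ^ (3 / 2 : ℝ) * t ^ (-(3 / 4) : ℝ)) := by
  have hC0 := Cd_pos (d := d)
  have e : inner ℝ (DH d t f x) w = ∫ y, f y • (inner ℝ (gk d t (x - y)) w) := by
    unfold DH
    rw [real_inner_comm, ← integral_inner (integrable_kern (integrable_gk t ht) hfm hf _)]
    congr 1; ext y
    rw [inner_smul_right, real_inner_comm]; simp
  have i3 : Integrable (fun y => f y • (inner ℝ (gk d t (x - y)) w)) :=
    integrable_kern (k := fun z => inner ℝ (gk d t z) w) ((integrable_gk t ht).inner_const w) hfm hf x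
  rw [e, Hr_eq, Hr_eq, ← integral_sub' (integrable_kern (integrable_hk t ht) hfm hf _) (integrable_kern (integrable_hk t ht) hfm hf _),
    ← integral_sub ((integrable_kern (integrable_hk t ht) hfm hf _).sub (integrable_kern (integrable_hk t ht) hfm hf _)) i3,
    ← Real.norm_eq_abs]
  have := kern_bound (fun z => heatKernel d t (z + w) - heatKernel d t z - inner ℝ (gk d t z) w) f c _ hf hc (by positivity) (rem_est t ht w) x
  refine le_of_eq_of_le ?_ this
  congr 2; ext y
  rw [sub_add_eq_add_sub, smul_sub, smul_sub]; rfl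
end Part2

section Part3
variable {d : ℕ}

lemma lint_pow_left (τ b α : ℝ) (h : τ < b) (hα : α < 1) :
    ∫⁻ σ in Ioo τ b, ofReal ((σ - τ) ^ (-α)) = ofReal ((b - τ) ^ (1 - α) / (1 - α)) := by
  have hi : IntervalIntegrable (fun σ : ℝ => (σ - τ) ^ (-α)) volume τ b := by
    have := (intervalIntegral.intervalIntegrable_rpow' (a := 0) (b := b - τ) (r := -α) (by linarith)).comp_sub_right τ
    simpa using this
  have e : ∫ σ in τ..b, (σ - τ) ^ (-α) = (b - τ) ^ (1 - α) / (1 - α) := by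
    rw [intervalIntegral.integral_comp_sub_right (fun σ => σ ^ (-α)), integral_rpow (Or.inl (by linarith))]
    rw [sub_self, Real.zero_rpow (by linarith)]
    rw [show -α + 1 = 1 - α by ring]; simp
  rw [← setLIntegral_congr (Ioo_ae_eq_Ioc (μ := volume) (a := τ) (b := b)).symm, ← e, intervalIntegral.integral_of_le h.le,
    ofReal_integral_eq_lintegral_ofReal ((intervalIntegrable_iff_integrableOn_Ioc_of_le h.le).mp hi)]
  rw [EventuallyLE, ae_restrict_iff' measurableSet_Ioc]
  refine ae_of_all _ fun σ hσ => ?_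
  have : 0 < σ - τ := by linarith [hσ.1]
  simp only [Pi.zero_apply]; positivity

lemma lint_Ioo_reflect (τ b : ℝ) (g : ℝ → ℝ≥0∞) :
    ∫⁻ σ in Ioo τ b, g (τ + b - σ) = ∫⁻ σ in Ioo τ b, g σ := by
  rw [← lintegral_indicator measurableSet_Ioo, ← lintegral_indicator measurableSet_Ioo,
    ← lintegral_sub_left_eq_self _ (τ + b)]
  congr 1; ext σ
  simp only [Set.indicator_apply, Set.mem_Ioo]
  by_cases h : τ < σ ∧ σ < b
  · rw [if_pos h, if_pos (by constructor <;> linarith [h.1, h.2])]; congr 1; ring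
  · rw [if_neg h, if_neg]; rintro ⟨h1, h2⟩; exact h ⟨by linarith, by linarith⟩

lemma lint_pow_right (τ b α : ℝ) (h : τ < b) (hα : α < 1) :
    ∫⁻ σ in Ioo τ b, ofReal ((b - σ) ^ (-α)) = ofReal ((b - τ) ^ (1 - α) / (1 - α)) := by
  rw [← lint_pow_left τ b α h hα, ← lint_Ioo_reflect]
  congr 1; ext σ; congr 2; ring

def Cb (α β : ℝ) : ℝ := 2 ^ α / (1 - β) + 2 ^ β / (1 - α)

lemma Cb_pos (α β : ℝ) (hα : α < 1) (hβ : β < 1) : 0 < Cb α β := by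
  unfold Cb
  have : 0 < 1 - α := by linarith
  have : 0 < 1 - β := by linarith
  positivity

lemma lint_beta (τ b α β : ℝ) (h : τ < b) (hα0 : 0 ≤ α) (hα : α < 1) (hβ0 : 0 ≤ β) (hβ : β < 1) :
    ∫⁻ σ in Ioo τ b, ofReal ((σ - τ) ^ (-α) * (b - σ) ^ (-β)) ≤
      ofReal (Cb α β * (b - τ) ^ (1 - α - β)) := by
  set l := b - τ with hl
  have hl0 : 0 < l := by linarith
  have h1 : ∀ σ ∈ Ioo τ b, ofReal ((σ - τ) ^ (-α) * (b - σ) ^ (-β)) ≤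
      ofReal ((l / 2) ^ (-α)) * ofReal ((b - σ) ^ (-β)) + ofReal ((l / 2) ^ (-β)) * ofReal ((σ - τ) ^ (-α)) := by
    intro σ ⟨h1, h2⟩
    have p1 : 0 < σ - τ := by linarith
    have p2 : 0 < b - σ := by linarith
    rw [← ofReal_mul (by positivity), ← ofReal_mul (by positivity), ← ofReal_add (by positivity) (by positivity)]
    apply ofReal_le_ofReal
    by_cases hc : l / 2 ≤ σ - τ
    · have := Real.rpow_le_rpow_of_nonpos (z := -α) (by positivity : 0 < l / 2) hc (by linarith)
      have p3 : 0 ≤ (l / 2) ^ (-β) * (σ - τ) ^ (-α) := by positivity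
      have := mul_le_mul_of_nonneg_right this (by positivity : 0 ≤ (b - σ) ^ (-β))
      linarith
    · have hc2 : l / 2 ≤ b - σ := by linarith
      have := Real.rpow_le_rpow_of_nonpos (z := -β) (by positivity : 0 < l / 2) hc2 (by linarith)
      have p3 : 0 ≤ (l / 2) ^ (-α) * (b - σ) ^ (-β) := by positivity
      have := mul_le_mul_of_nonneg_left this (by positivity : 0 ≤ (σ - τ) ^ (-α))
      linarith
  refine (setLIntegral_mono (by fun_prop) h1).trans ?_
  rw [lintegral_add_left (by fun_prop), lintegral_const_mul _ (by fun_prop), lintegral_const_mul _ (by fun_prop),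
    lint_pow_left τ b α h hα, lint_pow_right τ b β h hβ]
  have q1 : 0 < 1 - α := by linarith
  have q2 : 0 < 1 - β := by linarith
  rw [← hl, ← ofReal_mul (by positivity), ← ofReal_mul (by positivity), ← ofReal_add (by positivity) (by positivity)]
  apply ofReal_le_ofReal
  apply le_of_eq
  have key : ∀ γ δ : ℝ, (l / 2) ^ (-γ) * l ^ (1 - δ) = 2 ^ γ * l ^ (1 - γ - δ) := by
    intro γ δ
    rw [Real.div_rpow hl0.le (by norm_num), Real.rpow_neg (by norm_num : (0:ℝ) ≤ 2), div_inv_eq_mul,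
      mul_comm _ ((2:ℝ) ^ γ), mul_assoc, ← Real.rpow_add hl0]
    congr 2; ring
  unfold Cb
  rw [add_mul, mul_div_assoc', mul_div_assoc', key, key, show 1 - β - α = 1 - α - β by ring]
  ring

lemma lint_exp (lam τ b : ℝ) (hlam : 0 < lam) (h : τ ≤ b) :
    ∫⁻ σ in Ioo τ b, ofReal (lam * Real.exp (-(lam * (σ - τ)))) = ofReal (1 - Real.exp (-(lam * (b - τ)))) := by
  have hd : ∀ σ ∈ Set.uIcc τ b, HasDerivAt (fun σ => - Real.exp (-(lam * (σ - τ)))) (lam * Real.exp (-(lam * (σ - τ)))) σ := by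
    intro σ _
    have h1 : HasDerivAt (fun σ : ℝ => -(lam * (σ - τ))) (-(lam * 1)) σ :=
      (((hasDerivAt_id σ).sub_const τ).const_mul lam).neg
    have := h1.exp.neg
    have e : lam * Real.exp (-(lam * (σ - τ))) = -(Real.exp (-(lam * (σ - τ))) * -(lam * 1)) := by ring
    rw [e]; exact this
  have hc : Continuous (fun σ => lam * Real.exp (-(lam * (σ - τ)))) := by fun_prop
  have e := intervalIntegral.integral_eq_sub_of_hasDerivAt hd (hc.intervalIntegrable _ _)
  rw [← setLIntegral_congr (Ioo_ae_eq_Ioc (μ := volume) (a := τ) (b := b)).symm]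
  rw [intervalIntegral.integral_of_le h] at e
  rw [← ofReal_integral_eq_lintegral_ofReal ((intervalIntegrable_iff_integrableOn_Ioc_of_le h).mp (hc.intervalIntegrable _ _))
    (ae_of_all _ fun σ => by positivity), e]
  congr 1; simp; ring

lemma lint_exp' (lam τ b : ℝ) (hlam : 0 < lam) (h : τ ≤ b) :
    ∫⁻ σ in Ioo τ b, ofReal (lam * Real.exp (-(lam * (b - σ)))) = ofReal (1 - Real.exp (-(lam * (b - τ)))) := by
  rw [← lint_exp lam τ b hlam h, ← lint_Ioo_reflect]
  congr 1; ext σ; congr 5; ring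

def He (d : ℕ) (t : ℝ) (f : Euc d → ℝ≥0∞) (x : Euc d) : ℝ≥0∞ := ∫⁻ y, Ge d t (x - y) * f y

lemma He_mono (t : ℝ) {f g : Euc d → ℝ≥0∞} (h : ∀ x, f x ≤ g x) (x : Euc d) : He d t f x ≤ He d t g x :=
  lintegral_mono fun y => by gcongr; exact h y

lemma He_const (t : ℝ) (ht : 0 < t) (c : ℝ≥0∞) (x : Euc d) : He d t (fun _ => c) x = c := by
  unfold He
  rw [lintegral_mul_const _ (by fun_prop), lint_Ge_sub t ht, one_mul]

lemma He_meas {α : Type*} [MeasurableSpace α] {r : α → ℝ} (hr : Measurable r) {f : α → Euc d → ℝ≥0∞}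
    (hf : Measurable (uncurry f)) {x : α → Euc d} (hx : Measurable x) :
    Measurable (fun p => He d (r p) (f p) (x p)) := by
  unfold He
  refine Measurable.lintegral_prod_right' (f := fun q : α × Euc d => Ge d (r q.1) (x q.1 - q.2) * f q.1 q.2) ?_
  exact Measurable.mul (by fun_prop) hf

lemma He_add (t : ℝ) {f g : Euc d → ℝ≥0∞} (hf : Measurable f) (x : Euc d) :
    He d t (fun y => f y + g y) x = He d t f x + He d t g x := by
  unfold He
  simp_rw [mul_add]
  rw [lintegral_add_left (by fun_prop)]

lemma He_smul (t : ℝ) {f : Euc d → ℝ≥0∞} (hf : Measurable f) (c : ℝ≥0∞) (x : Euc d) :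
    He d t (fun y => c * f y) x = c * He d t f x := by
  unfold He
  rw [← lintegral_const_mul _ (by fun_prop)]
  congr 1; ext y; ring

lemma He_semi (r s : ℝ) (hr : 0 < r) (hs : 0 < s) {f : Euc d → ℝ≥0∞} (hf : Measurable f) (x : Euc d) :
    He d r (He d s f) x = He d (r + s) f x := by
  unfold He
  have : ∀ y, Ge d r (x - y) * ∫⁻ z, Ge d s (y - z) * f z = ∫⁻ z, Ge d r (x - y) * (Ge d s (y - z) * f z) := by
    intro y; rw [lintegral_const_mul _ (by fun_prop)]
  simp_rw [this]
  rw [lintegral_lintegral_swap (by fun_prop)]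
  congr 1; ext z
  simp_rw [← mul_assoc]
  rw [lintegral_mul_const _ (by fun_prop)]
  congr 1
  rw [← lintegral_add_right_eq_self _ z]
  have := Ge_semi (d := d) r s hr hs (x - z)
  rw [← this]
  congr 1; ext y; rw [add_sub_cancel_right, sub_sub, add_comm z y]

lemma He_lint {α : Type*} [MeasurableSpace α] (μ : Measure α) [SFinite μ] (t : ℝ) {f : α → Euc d → ℝ≥0∞}
    (hf : Measurable (uncurry f)) (x : Euc d) :
    He d t (fun y => ∫⁻ a, f a y ∂μ) x = ∫⁻ a, He d t (f a) x ∂μ := by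
  unfold He
  have hf' : Measurable (fun p : Euc d × α => f p.2 p.1) := hf.comp measurable_swap
  have : ∀ y, Ge d t (x - y) * ∫⁻ a, f a y ∂μ = ∫⁻ a, Ge d t (x - y) * f a y ∂μ := by
    intro y; exact (lintegral_const_mul _ (hf'.comp (measurable_prodMk_left (x := y)))).symm
  simp_rw [this]
  rw [lintegral_lintegral_swap]
  exact (Measurable.mul (by fun_prop) hf').aemeasurable

lemma He_iSup (t : ℝ) {f : ℕ → Euc d → ℝ≥0∞} (hf : ∀ n, Measurable (f n)) (hm : Monotone f) (x : Euc d) :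
    He d t (fun y => ⨆ n, f n y) x = ⨆ n, He d t (f n) x := by
  unfold He
  simp_rw [ENNReal.mul_iSup]
  rw [lintegral_iSup (fun n => by fun_prop)]
  intro n m hnm y
  dsimp only
  gcongr
  exact hm hnm y

lemma lint_Ge_He (t : ℝ) (ht : 0 < t) {f : Euc d → ℝ≥0∞} (hf : Measurable f) : ∫⁻ x, He d t f x = ∫⁻ x, f x := by
  unfold He
  rw [lintegral_lintegral_swap (by fun_prop)]
  congr 1; ext y
  rw [lintegral_mul_const _ (by fun_prop), lintegral_sub_right_eq_self (fun x => Ge d t x), lint_Ge t ht, one_mul]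
end Part3

section Part4
variable {d : ℕ}

def Shf (u : ℝ → Euc d → Euc d) (lam : ℝ) (φ : ℝ → Euc d → ℝ≥0∞) (σ : ℝ) (y : Euc d) : ℝ≥0∞ :=
  φ σ (y + lam⁻¹ • u σ y)

def Vst (u : ℝ → Euc d → Euc d) (lam b : ℝ) (f : Euc d → ℝ≥0∞) (φ : ℝ → Euc d → ℝ≥0∞) (τ : ℝ) (x : Euc d) : ℝ≥0∞ :=
  ofReal (Real.exp (-(lam * (b - τ)))) * He d (b - τ) f x +
    ∫⁻ σ in Ioo τ b, ofReal (lam * Real.exp (-(lam * (σ - τ)))) * He d (σ - τ) (Shf u lam φ σ) x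

def Vit (u : ℝ → Euc d → Euc d) (lam b : ℝ) (f : Euc d → ℝ≥0∞) : ℕ → ℝ → Euc d → ℝ≥0∞
  | 0 => fun _ _ => 0
  | n + 1 => Vst u lam b f (Vit u lam b f n)

def Vsol (u : ℝ → Euc d → Euc d) (lam b : ℝ) (f : Euc d → ℝ≥0∞) (τ : ℝ) (x : Euc d) : ℝ≥0∞ :=
  ⨆ n, Vit u lam b f n τ x

variable {u : ℝ → Euc d → Euc d} {lam b : ℝ} {f : Euc d → ℝ≥0∞}

lemma Shf_meas (hu : Measurable (uncurry u)) {φ : ℝ → Euc d → ℝ≥0∞}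
    (hφ : Measurable (uncurry φ)) : Measurable (uncurry (Shf u lam φ)) := by
  have h : Measurable (fun p : ℝ × Euc d => (p.1, p.2 + lam⁻¹ • u p.1 p.2)) :=
    measurable_fst.prodMk (measurable_snd.add (hu.const_smul lam⁻¹))
  exact hφ.comp h

lemma meas_slice {α β : Type*} [MeasurableSpace α] [MeasurableSpace β] {γ : Type*} [MeasurableSpace γ] {φ : α → β → γ}
    (hφ : Measurable (uncurry φ)) (a : α) : Measurable (φ a) :=
  hφ.comp (measurable_prodMk_left (x := a))

lemma lint_Ioo_meas {g : (ℝ × Euc d) → ℝ → ℝ≥0∞} (hg : Measurable (uncurry g)) :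
    Measurable (fun p : ℝ × Euc d => ∫⁻ σ in Ioo p.1 b, g p σ) := by
  have : ∀ p : ℝ × Euc d, ∫⁻ σ in Ioo p.1 b, g p σ = ∫⁻ σ, (Set.indicator {q : (ℝ × Euc d) × ℝ | q.1.1 < q.2 ∧ q.2 < b} (uncurry g)) (p, σ) := by
    intro p
    rw [← lintegral_indicator measurableSet_Ioo]
    congr 1
  simp_rw [this]
  refine Measurable.lintegral_prod_right' (hg.indicator ?_)
  have h1 : Measurable (fun q : (ℝ × Euc d) × ℝ => q.1.1) := measurable_fst.comp measurable_fst
  have h2 : Measurable (fun q : (ℝ × Euc d) × ℝ => q.2) := measurable_snd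
  exact (measurableSet_lt h1 h2).inter (measurableSet_lt h2 measurable_const)

lemma ker_meas (hu : Measurable (uncurry u)) {φ : ℝ → Euc d → ℝ≥0∞}
    (hφ : Measurable (uncurry φ)) :
    Measurable (fun q : (ℝ × Euc d) × ℝ => He d (q.2 - q.1.1) (Shf u lam φ q.2) q.1.2) := by
  refine He_meas (by fun_prop) ?_ (by fun_prop)
  exact (Shf_meas hu hφ).comp (((measurable_snd.comp measurable_fst)).prodMk measurable_snd)

lemma ker_meas1 (hu : Measurable (uncurry u)) {φ : ℝ → Euc d → ℝ≥0∞}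
    (hφ : Measurable (uncurry φ)) (τ : ℝ) (x : Euc d) :
    Measurable (fun σ => He d (σ - τ) (Shf u lam φ σ) x) :=
  He_meas (r := fun σ => σ - τ) (f := Shf u lam φ) (x := fun _ => x) (by fun_prop) (Shf_meas hu hφ) measurable_const

lemma ker_meas2 (hu : Measurable (uncurry u)) {φ : ℝ → Euc d → ℝ≥0∞}
    (hφ : Measurable (uncurry φ)) (σ : ℝ) :
    Measurable (fun q : ℝ × Euc d => He d (q.1 - σ) (Shf u lam φ q.1) q.2) := by
  have h1 : Measurable (fun q : (ℝ × Euc d) × Euc d => (q.1.1, q.2)) := by fun_prop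
  have h2 : Measurable (uncurry (fun q : ℝ × Euc d => Shf u lam φ q.1)) := (Shf_meas hu hφ).comp h1
  exact He_meas (r := fun q : ℝ × Euc d => q.1 - σ) (x := fun q : ℝ × Euc d => q.2) (by fun_prop) h2 (by fun_prop)

lemma lint_tri {k : ℝ → ℝ → ℝ≥0∞} (hk : Measurable (uncurry k)) (τ b : ℝ) :
    ∫⁻ σ in Ioo τ b, ∫⁻ s in Ioo σ b, k σ s = ∫⁻ s in Ioo τ b, ∫⁻ σ in Ioo τ s, k σ s := by
  have h1 : Measurable (fun q : ℝ × ℝ => q.1) := measurable_fst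
  have h2 : Measurable (fun q : ℝ × ℝ => q.2) := measurable_snd
  have hS : MeasurableSet {q : ℝ × ℝ | q.1 < q.2} := measurableSet_lt h1 h2
  have hm : Measurable (Set.indicator {q : ℝ × ℝ | q.1 < q.2} (uncurry k)) := hk.indicator hS
  have a1 : ∀ σ ∈ Ioo τ b, ∫⁻ s in Ioo σ b, k σ s = ∫⁻ s in Ioo τ b, (Set.indicator {q : ℝ × ℝ | q.1 < q.2} (uncurry k)) (σ, s) := by
    intro σ hσ
    rw [← lintegral_indicator measurableSet_Ioo, ← lintegral_indicator measurableSet_Ioo]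
    congr 1; ext s
    simp only [Set.indicator_apply, Set.mem_Ioo, Set.mem_ofPred_eq, uncurry]
    by_cases c1 : σ < s
    · have : τ < s := hσ.1.trans c1
      simp [c1, this]
    · simp [c1]
  have a2 : ∀ s ∈ Ioo τ b, ∫⁻ σ in Ioo τ s, k σ s = ∫⁻ σ in Ioo τ b, (Set.indicator {q : ℝ × ℝ | q.1 < q.2} (uncurry k)) (σ, s) := by
    intro s hs
    rw [← lintegral_indicator measurableSet_Ioo, ← lintegral_indicator measurableSet_Ioo]
    congr 1; ext σ
    simp only [Set.indicator_apply, Set.mem_Ioo, Set.mem_ofPred_eq, uncurry]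
    by_cases c1 : σ < s
    · have : σ < b := c1.trans hs.2
      simp [c1, this]
    · simp [c1]
  rw [setLIntegral_congr_fun measurableSet_Ioo a1, setLIntegral_congr_fun measurableSet_Ioo a2]
  exact lintegral_lintegral_swap (f := fun σ s => (Set.indicator {q : ℝ × ℝ | q.1 < q.2} (uncurry k)) (σ, s)) hm.aemeasurable

lemma He_meas1 {α : Type*} [MeasurableSpace α] {r : α → ℝ} (hr : Measurable r) {f : Euc d → ℝ≥0∞}
    (hf : Measurable f) {x : α → Euc d} (hx : Measurable x) :
    Measurable (fun p => He d (r p) f (x p)) := by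
  have hf' : Measurable (uncurry (fun (_ : α) => f)) := hf.comp measurable_snd
  exact He_meas hr hf' hx

lemma Vst_meas (hu : Measurable (uncurry u)) (hf : Measurable f) {φ : ℝ → Euc d → ℝ≥0∞}
    (hφ : Measurable (uncurry φ)) : Measurable (uncurry (Vst u lam b f φ)) := by
  unfold Vst uncurry
  refine Measurable.add (Measurable.mul (by fun_prop) (He_meas1 (by fun_prop) hf (by fun_prop))) ?_
  refine lint_Ioo_meas (g := fun p σ => _ ) ?_
  exact Measurable.mul (by fun_prop) (ker_meas hu hφ)

lemma Vit_meas (hu : Measurable (uncurry u)) (hf : Measurable f) (n : ℕ) :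
    Measurable (uncurry (Vit u lam b f n)) := by
  induction n with
  | zero => exact measurable_const
  | succ n ih => exact Vst_meas hu hf ih

lemma Vsol_meas (hu : Measurable (uncurry u)) (hf : Measurable f) :
    Measurable (uncurry (Vsol u lam b f)) :=
  Measurable.iSup (f := fun n (p : ℝ × Euc d) => Vit u lam b f n p.1 p.2) fun n => Vit_meas hu hf n

lemma Vst_mono {f g : Euc d → ℝ≥0∞} (hfg : ∀ x, f x ≤ g x) {φ ψ : ℝ → Euc d → ℝ≥0∞} {τ : ℝ}
    (h : ∀ σ ∈ Ioo τ b, ∀ x, φ σ x ≤ ψ σ x) (x : Euc d) : Vst u lam b f φ τ x ≤ Vst u lam b g ψ τ x := by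
  unfold Vst
  refine add_le_add ?_ ?_
  · gcongr; exact He_mono _ hfg x
  · refine lintegral_mono_ae ?_
    rw [ae_restrict_iff' measurableSet_Ioo]
    refine ae_of_all _ fun σ hσ => ?_
    gcongr
    exact He_mono _ (fun y => h σ hσ _) x

lemma Vit_mono_f {f g : Euc d → ℝ≥0∞} (hfg : ∀ x, f x ≤ g x) (n : ℕ) (τ : ℝ) (x : Euc d) :
    Vit u lam b f n τ x ≤ Vit u lam b g n τ x := by
  induction n generalizing τ x with
  | zero => simp [Vit]
  | succ n ih => exact Vst_mono hfg (fun σ _ x => ih σ x) x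

lemma Vsol_mono {f g : Euc d → ℝ≥0∞} (hfg : ∀ x, f x ≤ g x) (τ : ℝ) (x : Euc d) :
    Vsol u lam b f τ x ≤ Vsol u lam b g τ x :=
  iSup_mono fun n => Vit_mono_f hfg n τ x

lemma Vit_mono (f : Euc d → ℝ≥0∞) : Monotone (Vit u lam b f) := by
  refine monotone_nat_of_le_succ fun n => ?_
  induction n with
  | zero => intro τ x; simp [Vit]
  | succ n ih => intro τ x; exact Vst_mono (fun _ => le_rfl) (fun σ _ x => ih σ x) x

lemma Vsol_fix (hu : Measurable (uncurry u)) (hf : Measurable f) (τ : ℝ) (x : Euc d) :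
    Vsol u lam b f τ x = Vst u lam b f (Vsol u lam b f) τ x := by
  have e1 : Vsol u lam b f τ x = ⨆ n, Vst u lam b f (Vit u lam b f n) τ x := by
    unfold Vsol
    apply le_antisymm
    · exact iSup_mono fun n => Vit_mono f (Nat.le_succ n) τ x
    · exact iSup_le fun n => le_iSup (fun n => Vit u lam b f n τ x) (n + 1)
  rw [e1]
  unfold Vst
  rw [← ENNReal.add_iSup, ← lintegral_iSup]
  · congr 2; ext σ
    rw [← ENNReal.mul_iSup, ← He_iSup _ (fun n => meas_slice (Shf_meas hu (Vit_meas hu hf n)) σ)]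
    · rfl
    · intro n m hnm y; exact Vit_mono f hnm _ _
  · intro n
    exact Measurable.mul (by fun_prop) (ker_meas1 hu (Vit_meas hu hf n) τ x)
  · intro n m hnm σ
    dsimp only
    gcongr
    exact He_mono _ (fun y => Vit_mono f hnm _ _) x

lemma exp_le_one' (hlam : 0 < lam) {τ : ℝ} (hτ : τ < b) : Real.exp (-(lam * (b - τ))) ≤ 1 := by
  rw [Real.exp_le_one_iff]
  have : 0 < b - τ := by linarith
  have : 0 < lam * (b - τ) := by positivity
  linarith

lemma Vst_one (hlam : 0 < lam) {τ : ℝ} (hτ : τ < b) (x : Euc d) :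
    Vst u lam b (fun _ => 1) (fun _ _ => 1) τ x = 1 := by
  unfold Vst
  rw [He_const _ (by linarith), mul_one]
  have : ∫⁻ σ in Ioo τ b, ofReal (lam * Real.exp (-(lam * (σ - τ)))) * He d (σ - τ) (Shf u lam (fun _ _ => 1) σ) x
      = ∫⁻ σ in Ioo τ b, ofReal (lam * Real.exp (-(lam * (σ - τ)))) := by
    refine setLIntegral_congr_fun measurableSet_Ioo fun σ hσ => ?_
    unfold Shf
    dsimp only
    rw [He_const _ (by linarith [hσ.1]), mul_one]
  rw [this, lint_exp lam τ b hlam hτ.le, ← ofReal_add (by positivity) (by linarith [exp_le_one' hlam hτ])]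
  simp

lemma Vit_le_one (hlam : 0 < lam) (hf : ∀ x, f x ≤ 1) (n : ℕ) {τ : ℝ} (hτ : τ < b) (x : Euc d) :
    Vit u lam b f n τ x ≤ 1 := by
  induction n generalizing τ x with
  | zero => simp [Vit]
  | succ n ih =>
    rw [← Vst_one (u := u) hlam hτ x]
    exact Vst_mono hf (fun σ hσ x => ih hσ.2 x) x

lemma Vsol_le_one (hlam : 0 < lam) (hf : ∀ x, f x ≤ 1) {τ : ℝ} (hτ : τ < b) (x : Euc d) :
    Vsol u lam b f τ x ≤ 1 := iSup_le fun n => Vit_le_one hlam hf n hτ x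

lemma Vst_add (hu : Measurable (uncurry u)) {f g : Euc d → ℝ≥0∞} (hf : Measurable f)
    {φ ψ : ℝ → Euc d → ℝ≥0∞} (hφ : Measurable (uncurry φ)) (τ : ℝ) (x : Euc d) :
    Vst u lam b (fun x => f x + g x) (fun σ x => φ σ x + ψ σ x) τ x = Vst u lam b f φ τ x + Vst u lam b g ψ τ x := by
  unfold Vst
  have : ∀ σ, Shf u lam (fun σ x => φ σ x + ψ σ x) σ = fun y => Shf u lam φ σ y + Shf u lam ψ σ y := fun σ => rfl
  simp_rw [this, He_add _ hf, He_add _ (meas_slice (Shf_meas hu hφ) _), mul_add]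
  have hm : Measurable (fun σ => ofReal (lam * Real.exp (-(lam * (σ - τ)))) * He d (σ - τ) (Shf u lam φ σ) x) :=
    Measurable.mul (by fun_prop) (ker_meas1 hu hφ τ x)
  rw [lintegral_add_left hm]
  ring

lemma Vsol_add (hu : Measurable (uncurry u)) {f g : Euc d → ℝ≥0∞} (hf : Measurable f) (τ : ℝ) (x : Euc d) :
    Vsol u lam b (fun x => f x + g x) τ x = Vsol u lam b f τ x + Vsol u lam b g τ x := by
  have h : ∀ n, Vit u lam b (fun x => f x + g x) n = fun σ x => Vit u lam b f n σ x + Vit u lam b g n σ x := by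
    intro n
    induction n with
    | zero => ext σ x; simp [Vit]
    | succ n ih =>
      ext σ x
      change Vst u lam b _ (Vit u lam b (fun x => f x + g x) n) σ x = _
      rw [ih]
      exact Vst_add hu hf (Vit_meas hu hf n) σ x
  unfold Vsol
  simp_rw [h]
  rw [ENNReal.iSup_add_iSup_of_monotone]
  · intro n m hnm; exact Vit_mono f hnm τ x
  · intro n m hnm; exact Vit_mono g hnm τ x

lemma Vsol_smul (hu : Measurable (uncurry u)) (hf : Measurable f) (c : ℝ≥0∞) (τ : ℝ) (x : Euc d) :
    Vsol u lam b (fun x => c * f x) τ x = c * Vsol u lam b f τ x := by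
  have h : ∀ n, Vit u lam b (fun x => c * f x) n = fun σ x => c * Vit u lam b f n σ x := by
    intro n
    induction n with
    | zero => ext σ x; simp [Vit]
    | succ n ih =>
      ext σ x
      change Vst u lam b _ (Vit u lam b (fun x => c * f x) n) σ x = c * Vst u lam b f (Vit u lam b f n) σ x
      rw [ih]
      unfold Vst
      have : ∀ σ, Shf u lam (fun σ x => c * Vit u lam b f n σ x) σ = fun y => c * Shf u lam (Vit u lam b f n) σ y := fun σ => rfl
      simp_rw [this, He_smul _ hf, He_smul _ (meas_slice (Shf_meas hu (Vit_meas hu hf n)) _)]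
      have hm : Measurable (fun s => ofReal (lam * Real.exp (-(lam * (s - σ)))) * He d (s - σ) (Shf u lam (Vit u lam b f n) s) x) :=
        Measurable.mul (by fun_prop) (ker_meas1 hu (Vit_meas hu hf n) σ x)
      rw [mul_add, ← lintegral_const_mul _ hm]
      congr 1
      · ring
      · congr 1; ext s; ring
  unfold Vsol
  simp_rw [h]
  rw [ENNReal.mul_iSup]

lemma Vsol_one (hu : Measurable (uncurry u)) (hlam : 0 < lam) {τ : ℝ} (hτ : τ < b) (x : Euc d) :
    Vsol u lam b (fun _ => 1) τ x = 1 := by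
  apply le_antisymm (Vsol_le_one hlam (fun _ => le_rfl) hτ x)
  set a := τ with ha
  set θ : ℝ≥0∞ := ofReal (1 - Real.exp (-(lam * (b - a)))) with hθ
  have hθ1 : θ < 1 := by
    rw [hθ, ofReal_lt_one]
    have := Real.exp_pos (-(lam * (b - a))); linarith
  have key : ∀ n : ℕ, ∀ τ, a ≤ τ → τ < b → ∀ x, 1 ≤ Vit u lam b (fun _ => 1) n τ x + θ ^ n := by
    intro n
    induction n with
    | zero => intro τ _ _ x; simp
    | succ n ih =>
      intro τ h1 h2 x
      have hm := Vit_meas (u := u) (lam := lam) (b := b) hu (measurable_const (a := (1:ℝ≥0∞))) n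
      calc (1 : ℝ≥0∞) = Vst u lam b (fun _ => 1) (fun _ _ => 1) τ x := (Vst_one hlam h2 x).symm
        _ ≤ Vst u lam b (fun _ => 1 + 0) (fun σ x => Vit u lam b (fun _ => 1) n σ x + θ ^ n) τ x := by
          apply Vst_mono (by simp)
          intro σ hσ x
          exact ih σ (by linarith [hσ.1]) hσ.2 x
        _ = Vst u lam b (fun _ => 1) (Vit u lam b (fun _ => 1) n) τ x + Vst u lam b (fun _ => 0) (fun _ _ => θ ^ n) τ x :=
          Vst_add hu measurable_const hm τ x
        _ ≤ _ := by
          refine add_le_add le_rfl ?_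
          unfold Vst
          rw [He_const _ (by linarith), mul_zero, zero_add]
          have : ∫⁻ σ in Ioo τ b, ofReal (lam * Real.exp (-(lam * (σ - τ)))) * He d (σ - τ) (Shf u lam (fun _ _ => θ ^ n) σ) x
              = ∫⁻ σ in Ioo τ b, ofReal (lam * Real.exp (-(lam * (σ - τ)))) * θ ^ n := by
            refine setLIntegral_congr_fun measurableSet_Ioo fun σ hσ => ?_
            unfold Shf
            dsimp only
            rw [He_const _ (by linarith [hσ.1])]
          rw [this, lintegral_mul_const _ (by fun_prop), lint_exp lam τ b hlam h2.le, pow_succ, mul_comm]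
          gcongr
          rw [hθ]
          apply ofReal_le_ofReal
          gcongr
  have lim : Tendsto (fun n : ℕ => Vsol u lam b (fun _ => 1) a x + θ ^ n) atTop (𝓝 (Vsol u lam b (fun _ => 1) a x + 0)) :=
    tendsto_const_nhds.add (ENNReal.tendsto_pow_atTop_nhds_zero_of_lt_one hθ1)
  rw [add_zero] at lim
  refine ge_of_tendsto' lim fun n => (key n a le_rfl hτ x).trans ?_
  gcongr
  exact le_iSup (fun n => Vit u lam b (fun _ => 1) n a x) n

lemma Vsol_duhamel (hu : Measurable (uncurry u)) (hf : Measurable f) (hlam : 0 < lam) {τ : ℝ} (hτ : τ < b) (x : Euc d) :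
    Vsol u lam b f τ x + ∫⁻ σ in Ioo τ b, ofReal lam * He d (σ - τ) (Vsol u lam b f σ) x =
      He d (b - τ) f x + ∫⁻ σ in Ioo τ b, ofReal lam * He d (σ - τ) (Shf u lam (Vsol u lam b f) σ) x := by
  set φ := Vsol u lam b f with hφ
  have hφm : Measurable (uncurry φ) := Vsol_meas hu hf
  set e : ℝ → ℝ≥0∞ := fun s => ofReal (Real.exp (-(lam * s))) with he
  set L : ℝ≥0∞ := ofReal lam with hL
  have hle : ∀ s, ofReal (lam * Real.exp (-(lam * s))) = L * e s := by
    intro s; rw [hL, he, ofReal_mul hlam.le]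
  have hem : Measurable e := by rw [he]; fun_prop
  set g : ℝ → ℝ≥0∞ := fun σ => He d (σ - τ) (Shf u lam φ σ) x with hg
  have hgm : Measurable g := ker_meas1 hu hφm τ x
  have h1 : ∀ σ ∈ Ioo τ b, L * He d (σ - τ) (φ σ) x = (L * e (b - σ)) * He d (b - τ) f x +
      ∫⁻ s in Ioo σ b, L * (L * e (s - σ)) * g s := by
    intro σ hσ
    have p1 : 0 < σ - τ := by linarith [hσ.1]
    have p2 : 0 < b - σ := by linarith [hσ.2]
    have e1 : φ σ = fun y => e (b - σ) * He d (b - σ) f y + ∫⁻ s in Ioo σ b, (L * e (s - σ)) * He d (s - σ) (Shf u lam φ s) y := by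
      ext y
      rw [hφ, Vsol_fix hu hf]
      unfold Vst
      simp_rw [hle]
      rfl
    have hHm : Measurable (fun y => He d (b - σ) f y) := He_meas1 measurable_const hf measurable_id
    have hKm : Measurable (fun q : ℝ × Euc d => He d (q.1 - σ) (Shf u lam φ q.1) q.2) :=
      ker_meas2 hu hφm σ
    rw [e1, He_add _ (by fun_prop), He_smul _ hHm, He_semi _ _ p1 p2 hf,
      He_lint (volume.restrict (Ioo σ b)) (f := fun s y => (L * e (s - σ)) * He d (s - σ) (Shf u lam φ s) y)]
    · rw [mul_add, ← mul_assoc, show σ - τ + (b - σ) = b - τ by ring]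
      congr 1
      rw [← lintegral_const_mul']
      · refine setLIntegral_congr_fun measurableSet_Ioo fun s hs => ?_
        have p3 : 0 < s - σ := by linarith [hs.1]
        have hKs : Measurable (fun y => He d (s - σ) (Shf u lam φ s) y) :=
          He_meas1 measurable_const (meas_slice (Shf_meas hu hφm) s) measurable_id
        rw [He_smul _ hKs, He_semi _ _ p1 p3 (meas_slice (Shf_meas hu hφm) s),
          show σ - τ + (s - σ) = s - τ by ring, hg]
        ring
      · simp [hL]
    · unfold uncurry
      exact Measurable.mul (by fun_prop) hKm
  rw [setLIntegral_congr_fun measurableSet_Ioo h1, lintegral_add_left (by fun_prop), lintegral_mul_const _ (by fun_prop)]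
  have i1 : ∫⁻ σ in Ioo τ b, L * e (b - σ) = ofReal (1 - Real.exp (-(lam * (b - τ)))) := by
    simp_rw [← hle]; exact lint_exp' lam τ b hlam hτ.le
  have i2 : ∫⁻ σ in Ioo τ b, ∫⁻ s in Ioo σ b, L * (L * e (s - σ)) * g s =
      ∫⁻ s in Ioo τ b, ofReal (1 - Real.exp (-(lam * (s - τ)))) * (L * g s) := by
    rw [lint_tri (k := fun σ s => L * (L * e (s - σ)) * g s) (by unfold uncurry; fun_prop)]
    refine setLIntegral_congr_fun measurableSet_Ioo fun s hs => ?_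
    have : ∀ σ, L * (L * e (s - σ)) * g s = (L * e (s - σ)) * (L * g s) := fun σ => by ring
    simp_rw [this]
    rw [lintegral_mul_const _ (by fun_prop)]
    congr 1
    simp_rw [← hle]; exact lint_exp' lam τ s hlam hs.1.le
  rw [i1, i2, hφ, Vsol_fix hu hf]
  unfold Vst
  rw [← hφ, add_add_add_comm, ← add_mul, ← ofReal_add (by positivity) (by linarith [exp_le_one' hlam hτ]),
    add_sub_cancel, ofReal_one, one_mul]
  congr 1
  rw [← lintegral_add_left]
  · refine setLIntegral_congr_fun measurableSet_Ioo fun s hs => ?_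
    change _ * g s + _ = L * g s
    rw [ofReal_mul hlam.le, mul_assoc, mul_left_comm, ← add_mul, ← ofReal_add (by positivity),
      add_sub_cancel, ofReal_one, one_mul]
    have := exp_le_one' (b := s) hlam hs.1
    linarith
  · exact Measurable.mul (by fun_prop) hgm
end Part4

section Part5
variable {d : ℕ}

lemma Hr_meas {α : Type*} [MeasurableSpace α] {r : α → ℝ} (hr : Measurable r) {g : α → Euc d → ℝ}
    (hg : Measurable (uncurry g)) {x : α → Euc d} (hx : Measurable x) :
    Measurable (fun p => Hr d (r p) (g p) (x p)) := by
  unfold Hr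
  have h : Measurable (fun q : α × Euc d => heatKernel d (r q.1) (x q.1 - q.2) * g q.1 q.2) :=
    Measurable.mul (by fun_prop) hg
  exact (h.stronglyMeasurable.integral_prod_right').measurable

lemma DH_meas {α : Type*} [MeasurableSpace α] {r : α → ℝ} (hr : Measurable r) {g : α → Euc d → ℝ}
    (hg : Measurable (uncurry g)) {x : α → Euc d} (hx : Measurable x) :
    Measurable (fun p => DH d (r p) (g p) (x p)) := by
  unfold DH
  have h : Measurable (fun q : α × Euc d => g q.1 q.2 • gk d (r q.1) (x q.1 - q.2)) :=
    Measurable.smul hg (by fun_prop)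
  exact (h.stronglyMeasurable.integral_prod_right').measurable

lemma He_ofReal (t : ℝ) (ht : 0 < t) {g : Euc d → ℝ} (hgm : Measurable g) (c : ℝ) (hg0 : ∀ x, 0 ≤ g x) (hg : ∀ x, g x ≤ c) (x : Euc d) :
    He d t (fun y => ofReal (g y)) x = ofReal (Hr d t g x) := by
  unfold He Hr
  rw [ofReal_integral_eq_lintegral_ofReal]
  · congr 1; ext y; unfold Ge; rw [ofReal_mul (hk_nonneg t ht.le _)]
  · have := integrable_kern (integrable_hk t ht) hgm (c := c) (fun y => by rw [abs_of_nonneg (hg0 y)]; exact hg y) x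
    simpa [mul_comm] using this
  · exact ae_of_all _ fun y => mul_nonneg (hk_nonneg t ht.le _) (hg0 y)

lemma Hr_nonneg (t : ℝ) (ht : 0 < t) {g : Euc d → ℝ} (hg0 : ∀ x, 0 ≤ g x) (x : Euc d) : 0 ≤ Hr d t g x :=
  integral_nonneg fun y => mul_nonneg (hk_nonneg t ht.le _) (hg0 y)

lemma Hr_sub (t : ℝ) (ht : 0 < t) {f g : Euc d → ℝ} (hfm : Measurable f) (hgm : Measurable g) (c : ℝ)
    (hf : ∀ x, |f x| ≤ c) (hg : ∀ x, |g x| ≤ c) (x : Euc d) :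
    Hr d t (fun y => f y - g y) x = Hr d t f x - Hr d t g x := by
  simp only [Hr_eq]
  rw [← integral_sub (integrable_kern (integrable_hk t ht) hfm hf x) (integrable_kern (integrable_hk t ht) hgm hg x)]
  congr 1; ext y; simp [sub_mul]

lemma Hr_smul (t : ℝ) (c : ℝ) (f : Euc d → ℝ) (x : Euc d) :
    Hr d t (fun y => c * f y) x = c * Hr d t f x := by
  unfold Hr
  rw [← integral_const_mul]
  congr 1; ext y; ring

lemma abs_int_le {α : Type*} [MeasurableSpace α] {μ : Measure α} {F : Type*} [NormedAddCommGroup F] [NormedSpace ℝ F] {g : α → F} {k : α → ℝ} {B : ℝ} (hB : 0 ≤ B) (h : ∀ᵐ x ∂μ, ‖g x‖ ≤ k x)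
    (hk : ∫⁻ x, ofReal (k x) ∂μ ≤ ofReal B) : ‖∫ x, g x ∂μ‖ ≤ B := by
  rw [← ofReal_le_ofReal_iff hB, ofReal_norm]
  refine (enorm_integral_le_lintegral_enorm _).trans (le_trans (lintegral_mono_ae ?_) hk)
  filter_upwards [h] with x hx
  rw [← ofReal_norm]
  exact ofReal_le_ofReal hx

lemma integrable_of_bd {α : Type*} [MeasurableSpace α] {μ : Measure α} {F : Type*} [NormedAddCommGroup F] {g : α → F} {k : α → ℝ} {B : ℝ} (hg : AEStronglyMeasurable g μ) (h : ∀ᵐ x ∂μ, ‖g x‖ ≤ k x)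
    (hk : ∫⁻ x, ofReal (k x) ∂μ ≤ ofReal B) : Integrable g μ := by
  refine ⟨hg, ?_⟩
  refine lt_of_le_of_lt (le_trans (lintegral_mono_ae ?_) hk) ofReal_lt_top
  filter_upwards [h] with x hx
  rw [← ofReal_norm]
  exact ofReal_le_ofReal hx

def ph (u : ℝ → Euc d → Euc d) (lam b : ℝ) (f : Euc d → ℝ) (τ : ℝ) (x : Euc d) : ℝ :=
  (Vsol u lam b (fun y => ofReal (f y)) τ x).toReal

def Ed (u : ℝ → Euc d → Euc d) (lam b : ℝ) (f : Euc d → ℝ) (σ : ℝ) (y : Euc d) : ℝ :=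
  lam * (ph u lam b f σ (y + lam⁻¹ • u σ y) - ph u lam b f σ y)

variable {u : ℝ → Euc d → Euc d} {lam b : ℝ} {f : Euc d → ℝ}

lemma ph_meas (hu : Measurable (uncurry u)) (hf : Measurable f) :
    Measurable (uncurry (ph u lam b f)) :=
  (Vsol_meas hu (hf.ennreal_ofReal)).ennreal_toReal

lemma phS_meas (hu : Measurable (uncurry u)) (hf : Measurable f) :
    Measurable (uncurry (fun σ y => ph u lam b f σ (y + lam⁻¹ • u σ y))) := by
  have h : Measurable (fun p : ℝ × Euc d => (p.1, p.2 + lam⁻¹ • u p.1 p.2)) :=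
    measurable_fst.prodMk (measurable_snd.add (hu.const_smul lam⁻¹))
  exact (ph_meas (lam := lam) (b := b) hu hf).comp h

lemma Ed_meas (hu : Measurable (uncurry u)) (hf : Measurable f) :
    Measurable (uncurry (Ed u lam b f)) :=
  ((phS_meas hu hf).sub (ph_meas hu hf)).const_mul lam

lemma Vsol_ph (hlam : 0 < lam) (hf1 : ∀ x, f x ≤ 1) {τ : ℝ} (hτ : τ < b) (x : Euc d) :
    Vsol u lam b (fun y => ofReal (f y)) τ x = ofReal (ph u lam b f τ x) := by
  unfold ph
  rw [ofReal_toReal]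
  refine ne_top_of_le_ne_top ENNReal.one_ne_top (Vsol_le_one hlam (fun y => ?_) hτ x)
  simpa using hf1 y

lemma ph_nonneg (τ : ℝ) (x : Euc d) : 0 ≤ ph u lam b f τ x := ENNReal.toReal_nonneg

lemma ph_le_one (hlam : 0 < lam) (hf1 : ∀ x, f x ≤ 1) {τ : ℝ} (hτ : τ < b) (x : Euc d) : ph u lam b f τ x ≤ 1 := by
  unfold ph
  refine ENNReal.toReal_le_of_le_ofReal zero_le_one ?_
  simpa using Vsol_le_one hlam (f := fun y => ofReal (f y)) (fun y => by simpa using hf1 y) hτ x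

lemma ph_mono (hlam : 0 < lam) {f g : Euc d → ℝ} (hfg : ∀ x, f x ≤ g x) (hg1 : ∀ x, g x ≤ 1) {τ : ℝ} (hτ : τ < b) (x : Euc d) :
    ph u lam b f τ x ≤ ph u lam b g τ x := by
  unfold ph
  apply ENNReal.toReal_mono
  · rw [Vsol_ph hlam hg1 hτ]; exact ofReal_ne_top
  · exact Vsol_mono (fun y => ofReal_le_ofReal (hfg y)) τ x

lemma ph_smul (hu : Measurable (uncurry u)) (hf : Measurable f) {c : ℝ} (hc : 0 ≤ c) (τ : ℝ) (x : Euc d) :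
    ph u lam b (fun y => c * f y) τ x = c * ph u lam b f τ x := by
  unfold ph
  simp_rw [ofReal_mul hc]
  rw [Vsol_smul hu hf.ennreal_ofReal, ENNReal.toReal_mul, ENNReal.toReal_ofReal hc]

lemma ph_compl (hu : Measurable (uncurry u)) (hlam : 0 < lam) (hf : Measurable f) (hf0 : ∀ x, 0 ≤ f x) (hf1 : ∀ x, f x ≤ 1) {τ : ℝ} (hτ : τ < b) (x : Euc d) :
    ph u lam b (fun y => 1 - f y) τ x = 1 - ph u lam b f τ x := by
  have h := Vsol_add (u := u) (lam := lam) (b := b) (f := fun y => ofReal (f y)) (g := fun y => ofReal (1 - f y)) hu hf.ennreal_ofReal τ x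
  have e : (fun y => ofReal (f y) + ofReal (1 - f y)) = fun _ => (1 : ℝ≥0∞) := by
    ext y; rw [← ofReal_add (hf0 y) (by linarith [hf1 y])]; simp
  rw [e, Vsol_one hu hlam hτ, Vsol_ph hlam hf1 hτ, Vsol_ph (f := fun y => 1 - f y) hlam (fun y => by linarith [hf0 y]) hτ,
    ← ofReal_add (ph_nonneg _ _) (ph_nonneg _ _)] at h
  have := congrArg ENNReal.toReal h
  rw [ENNReal.toReal_ofReal (add_nonneg (ph_nonneg _ _) (ph_nonneg _ _))] at this
  simp at this
  linarith

lemma Ed_abs_le (hlam : 0 < lam) (hf1 : ∀ x, f x ≤ 1) {σ : ℝ} (hσ : σ < b) (y : Euc d) : |Ed u lam b f σ y| ≤ lam := by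
  unfold Ed
  rw [abs_mul, abs_of_pos hlam]
  have h1 := ph_le_one (u := u) hlam hf1 hσ
  have h0 := ph_nonneg (u := u) (lam := lam) (b := b) (f := f) σ
  have : |ph u lam b f σ (y + lam⁻¹ • u σ y) - ph u lam b f σ y| ≤ 1 := by
    rw [abs_le]; constructor
    · linarith [h1 y, h0 (y + lam⁻¹ • u σ y)]
    · linarith [h1 (y + lam⁻¹ • u σ y), h0 y]
  nlinarith

lemma HrEd_meas (hu : Measurable (uncurry u)) (hf : Measurable f) (τ : ℝ) (x : Euc d) :
    Measurable (fun σ => Hr d (σ - τ) (Ed u lam b f σ) x) :=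
  Hr_meas (r := fun σ => σ - τ) (x := fun _ => x) (by fun_prop) (Ed_meas hu hf) measurable_const

lemma intHrEd (hu : Measurable (uncurry u)) (hf : Measurable f) (hlam : 0 < lam) (hf1 : ∀ x, f x ≤ 1) (τ : ℝ) (x : Euc d) :
    IntegrableOn (fun σ => Hr d (σ - τ) (Ed u lam b f σ) x) (Ioo τ b) := by
  refine Measure.integrableOn_of_bounded (M := lam) (by simp) (HrEd_meas hu hf τ x).aestronglyMeasurable ?_
  rw [ae_restrict_iff' measurableSet_Ioo]
  refine ae_of_all _ fun σ hσ => ?_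
  exact Hr_abs_le _ (by linarith [hσ.1]) _ _ hlam.le (Ed_abs_le hlam hf1 hσ.2) x

lemma ph_duhamel (hu : Measurable (uncurry u)) (hf : Measurable f) (hlam : 0 < lam) (hf0 : ∀ x, 0 ≤ f x) (hf1 : ∀ x, f x ≤ 1)
    {τ : ℝ} (hτ : τ < b) (x : Euc d) :
    ph u lam b f τ x = Hr d (b - τ) f x + ∫ σ in Ioo τ b, Hr d (σ - τ) (Ed u lam b f σ) x := by
  have h := Vsol_duhamel (u := u) hu hf.ennreal_ofReal hlam hτ x
  set φ := ph u lam b f with hφ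
  have hφm : Measurable (uncurry φ) := ph_meas hu hf
  have hSm : Measurable (uncurry (fun σ y => φ σ (y + lam⁻¹ • u σ y))) := phS_meas hu hf
  have gen : ∀ ψ : ℝ → Euc d → ℝ, Measurable (uncurry ψ) → (∀ σ < b, ∀ y, 0 ≤ ψ σ y ∧ ψ σ y ≤ 1) →
      IntegrableOn (fun σ => lam * Hr d (σ - τ) (ψ σ) x) (Ioo τ b) ∧
      ∫⁻ σ in Ioo τ b, ofReal lam * He d (σ - τ) (fun y => ofReal (ψ σ y)) x =
        ofReal (∫ σ in Ioo τ b, lam * Hr d (σ - τ) (ψ σ) x) ∧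
      0 ≤ ∫ σ in Ioo τ b, lam * Hr d (σ - τ) (ψ σ) x := by
    intro ψ hψ hb
    have hm : Measurable (fun σ => lam * Hr d (σ - τ) (ψ σ) x) :=
      (Hr_meas (r := fun σ => σ - τ) (x := fun _ => x) (by fun_prop) hψ measurable_const).const_mul lam
    have hi : IntegrableOn (fun σ => lam * Hr d (σ - τ) (ψ σ) x) (Ioo τ b) := by
      refine Measure.integrableOn_of_bounded (M := lam) (by simp) hm.aestronglyMeasurable ?_
      rw [ae_restrict_iff' measurableSet_Ioo]
      refine ae_of_all _ fun σ hσ => ?_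
      rw [norm_mul, Real.norm_eq_abs, Real.norm_eq_abs, abs_of_pos hlam]
      have := Hr_abs_le (σ - τ) (by linarith [hσ.1]) (ψ σ) 1 zero_le_one (fun y => by
        rw [abs_of_nonneg (hb σ hσ.2 y).1]; exact (hb σ hσ.2 y).2) x
      nlinarith
    have h0 : ∀ σ ∈ Ioo τ b, 0 ≤ lam * Hr d (σ - τ) (ψ σ) x := fun σ hσ =>
      mul_nonneg hlam.le (Hr_nonneg _ (by linarith [hσ.1]) (fun y => (hb σ hσ.2 y).1) x)
    refine ⟨hi, ?_, setIntegral_nonneg measurableSet_Ioo h0⟩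
    rw [ofReal_integral_eq_lintegral_ofReal hi ((ae_restrict_iff' measurableSet_Ioo).2 (ae_of_all _ h0))]
    refine setLIntegral_congr_fun measurableSet_Ioo fun σ hσ => ?_
    rw [ofReal_mul hlam.le, He_ofReal _ (by linarith [hσ.1]) (meas_slice hψ σ) 1 (fun y => (hb σ hσ.2 y).1) (fun y => (hb σ hσ.2 y).2)]
  have b1 : ∀ σ < b, ∀ y, 0 ≤ φ σ y ∧ φ σ y ≤ 1 := fun σ hσ y => ⟨ph_nonneg _ _, ph_le_one hlam hf1 hσ y⟩
  obtain ⟨i1, e1, n1⟩ := gen φ hφm b1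
  obtain ⟨i2, e2, n2⟩ := gen _ hSm (fun σ hσ y => b1 σ hσ _)
  have c1 : ∫⁻ σ in Ioo τ b, ofReal lam * He d (σ - τ) (Vsol u lam b (fun y => ofReal (f y)) σ) x =
      ∫⁻ σ in Ioo τ b, ofReal lam * He d (σ - τ) (fun y => ofReal (φ σ y)) x := by
    refine setLIntegral_congr_fun measurableSet_Ioo fun σ hσ => ?_
    congr 2; ext y; exact Vsol_ph hlam hf1 hσ.2 y
  have c2 : ∫⁻ σ in Ioo τ b, ofReal lam * He d (σ - τ) (Shf u lam (Vsol u lam b (fun y => ofReal (f y))) σ) x =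
      ∫⁻ σ in Ioo τ b, ofReal lam * He d (σ - τ) (fun y => ofReal (φ σ (y + lam⁻¹ • u σ y))) x := by
    refine setLIntegral_congr_fun measurableSet_Ioo fun σ hσ => ?_
    congr 2; ext y; exact Vsol_ph hlam hf1 hσ.2 _
  have p0 : 0 < b - τ := by linarith
  have hH := Hr_nonneg (b - τ) p0 hf0 x
  rw [c1, c2, e1, e2, Vsol_ph hlam hf1 hτ, He_ofReal _ p0 hf 1 hf0 hf1, ← ofReal_add (ph_nonneg _ _) n1,
    ← ofReal_add hH n2, ofReal_eq_ofReal_iff (add_nonneg (ph_nonneg _ _) n1) (add_nonneg hH n2)] at h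
  have : ∫ σ in Ioo τ b, Hr d (σ - τ) (Ed u lam b f σ) x = (∫ σ in Ioo τ b, lam * Hr d (σ - τ) (fun y => φ σ (y + lam⁻¹ • u σ y)) x)
      - ∫ σ in Ioo τ b, lam * Hr d (σ - τ) (φ σ) x := by
    rw [← integral_sub i2 i1]
    refine setIntegral_congr_fun measurableSet_Ioo fun σ hσ => ?_
    have hb' : ∀ y, |φ σ y| ≤ 1 := fun y => by rw [abs_of_nonneg (b1 σ hσ.2 y).1]; exact (b1 σ hσ.2 y).2
    rw [← mul_sub, ← Hr_sub _ (by linarith [hσ.1]) (meas_slice hSm σ) (meas_slice hφm σ) 1 (fun y => hb' _) hb', ← Hr_smul]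
    rfl
  rw [this]
  linarith
end Part5

section Part6
variable {d : ℕ}
variable {u : ℝ → Euc d → Euc d} {lam b : ℝ} {f : Euc d → ℝ}

lemma rpow_half_mul (x : ℝ) (hx : 0 < x) : x ^ (-(1/2) : ℝ) * x ^ (1/2 : ℝ) = 1 := by
  rw [← Real.rpow_add hx]; norm_num

lemma ph_lip_step (hu : Measurable (uncurry u)) (hf : Measurable f) (hlam : 0 < lam) (hf0 : ∀ x, 0 ≤ f x) (hf1 : ∀ x, f x ≤ 1)
    {B τ : ℝ} (hB : 0 ≤ B) (hτ : τ < b) (hE : ∀ σ ∈ Ioo τ b, ∀ y, |Ed u lam b f σ y| ≤ B * (b - σ) ^ (-(1/2) : ℝ)) (x w : Euc d) :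
    |ph u lam b f τ (x + w) - ph u lam b f τ x| ≤ (Cd d + B * (Cd d * Cb (1/2) (1/2)) * (b - τ) ^ (1/2 : ℝ)) * (b - τ) ^ (-(1/2) : ℝ) * ‖w‖ := by
  have hC := Cd_pos (d := d)
  have hCb := Cb_pos (1/2) (1/2) (by norm_num) (by norm_num)
  have hp : 0 < b - τ := by linarith
  rw [ph_duhamel hu hf hlam hf0 hf1 hτ, ph_duhamel hu hf hlam hf0 hf1 hτ x, add_sub_add_comm,
    ← integral_sub (intHrEd hu hf hlam hf1 τ _) (intHrEd hu hf hlam hf1 τ _)]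
  have h1 := Hr_lip (b - τ) hp f hf 1 zero_le_one (fun y => by rw [abs_of_nonneg (hf0 y)]; exact hf1 y) x w
  have h2 : ‖∫ σ in Ioo τ b, (Hr d (σ - τ) (Ed u lam b f σ) (x + w) - Hr d (σ - τ) (Ed u lam b f σ) x)‖ ≤ B * (Cd d * Cb (1/2) (1/2)) * ‖w‖ := by
    refine abs_int_le (k := fun σ => (B * Cd d * ‖w‖) * ((σ - τ) ^ (-(1/2) : ℝ) * (b - σ) ^ (-(1/2) : ℝ))) (by positivity) ?_ ?_
    · rw [ae_restrict_iff' measurableSet_Ioo]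
      refine ae_of_all _ fun σ hσ => ?_
      have := Hr_lip (σ - τ) (by linarith [hσ.1]) _ (meas_slice (Ed_meas hu hf) σ) (B * (b - σ) ^ (-(1/2) : ℝ))
        (mul_nonneg hB (Real.rpow_nonneg (by linarith [hσ.2]) _)) (hE σ hσ) x w
      rw [Real.norm_eq_abs]
      refine this.trans (le_of_eq ?_)
      ring
    · simp_rw [ofReal_mul (show 0 ≤ B * Cd d * ‖w‖ by positivity)]
      rw [lintegral_const_mul' _ _ ofReal_ne_top]
      calc _ ≤ ofReal (B * Cd d * ‖w‖) * ofReal (Cb (1/2) (1/2) * (b - τ) ^ (1 - 1/2 - 1/2 : ℝ)) := by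
            gcongr; exact lint_beta τ b (1/2) (1/2) hτ (by norm_num) (by norm_num) (by norm_num) (by norm_num)
        _ = _ := by
            rw [← ofReal_mul (by positivity)]
            norm_num
            congr 1; ring
  rw [Real.norm_eq_abs] at h2
  refine (abs_add_le _ _).trans ((add_le_add h1 h2).trans (le_of_eq ?_))
  have e : B * (Cd d * Cb (1/2) (1/2)) * ‖w‖ = B * (Cd d * Cb (1/2) (1/2)) * ‖w‖ * ((b - τ) ^ (-(1/2) : ℝ) * (b - τ) ^ (1/2 : ℝ)) := by
    rw [rpow_half_mul _ hp, mul_one]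
  rw [e]; ring

lemma Ed_of_lip (hlam : 0 < lam) {κ A σ : ℝ} (hA : 0 ≤ A) (hσ : σ < b) (hκ : ∀ y, ‖u σ y‖ ≤ κ)
    (hL : ∀ x w, |ph u lam b f σ (x + w) - ph u lam b f σ x| ≤ A * (b - σ) ^ (-(1/2) : ℝ) * ‖w‖) (y : Euc d) :
    |Ed u lam b f σ y| ≤ (A * κ) * (b - σ) ^ (-(1/2) : ℝ) := by
  unfold Ed
  rw [abs_mul, abs_of_pos hlam]
  have h := hL y (lam⁻¹ • u σ y)
  rw [norm_smul, Real.norm_eq_abs, abs_of_pos (inv_pos.2 hlam)] at h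
  have hp : 0 ≤ (b - σ) ^ (-(1/2) : ℝ) := Real.rpow_nonneg (by linarith) _
  calc _ ≤ lam * (A * (b - σ) ^ (-(1/2) : ℝ) * (lam⁻¹ * ‖u σ y‖)) := by gcongr
    _ = A * (b - σ) ^ (-(1/2) : ℝ) * ‖u σ y‖ := by field_simp
    _ ≤ A * (b - σ) ^ (-(1/2) : ℝ) * κ := by gcongr; exact hκ y
    _ = _ := by ring

def SmallB (d : ℕ) (κ h : ℝ) : Prop := κ * (Cd d * Cb (1/2) (1/2)) * h ^ (1/2 : ℝ) ≤ 1/2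

lemma ph_lip (hu : Measurable (uncurry u)) (hf : Measurable f) (hlam : 0 < lam) (hf0 : ∀ x, 0 ≤ f x) (hf1 : ∀ x, f x ≤ 1)
    {κ a : ℝ} (hκ0 : 0 ≤ κ) (hκ : ∀ σ y, ‖u σ y‖ ≤ κ) (hs : SmallB d κ (b - a)) {τ : ℝ} (haτ : a ≤ τ) (hτ : τ < b) (x w : Euc d) :
    |ph u lam b f τ (x + w) - ph u lam b f τ x| ≤ 2 * Cd d * (b - τ) ^ (-(1/2) : ℝ) * ‖w‖ := by
  have hC := Cd_pos (d := d)
  have hCb := Cb_pos (1/2) (1/2) (by norm_num) (by norm_num)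
  have hh : 0 < b - a := by linarith
  set D := lam * (b - a) ^ (1/2 : ℝ) * (Cd d * Cb (1/2) (1/2)) * (b - a) ^ (1/2 : ℝ) with hD
  have hD0 : 0 ≤ D := by positivity
  have key : ∀ n : ℕ, ∀ τ, a ≤ τ → τ < b → ∀ x w, |ph u lam b f τ (x + w) - ph u lam b f τ x| ≤ (2 * Cd d + D * (1/2)^n) * (b - τ) ^ (-(1/2) : ℝ) * ‖w‖ := by
    intro n
    induction n with
    | zero =>
      intro τ h1 h2 x w
      have := ph_lip_step (B := lam * (b - a) ^ (1/2 : ℝ)) hu hf hlam hf0 hf1 (by positivity) h2 (fun σ hσ y => by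
        refine (Ed_abs_le hlam hf1 hσ.2 y).trans ?_
        have hp : 0 < b - σ := by linarith [hσ.2]
        have q : (b - σ) ^ (1/2 : ℝ) ≤ (b - a) ^ (1/2 : ℝ) := Real.rpow_le_rpow hp.le (by linarith [hσ.1]) (by norm_num)
        have q2 : 0 < (b - σ) ^ (-(1/2) : ℝ) := Real.rpow_pos_of_pos hp _
        calc lam = lam * ((b - σ) ^ (-(1/2) : ℝ) * (b - σ) ^ (1/2 : ℝ)) := by rw [rpow_half_mul _ hp, mul_one]
          _ ≤ lam * ((b - σ) ^ (-(1/2) : ℝ) * (b - a) ^ (1/2 : ℝ)) := by gcongr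
          _ = _ := by ring) x w
      have hp : 0 < b - τ := by linarith
      refine this.trans (mul_le_mul_of_nonneg_right (mul_le_mul_of_nonneg_right ?_ (Real.rpow_nonneg hp.le _)) (norm_nonneg w))
      have q : (b - τ) ^ (1/2 : ℝ) ≤ (b - a) ^ (1/2 : ℝ) := Real.rpow_le_rpow hp.le (by linarith) (by norm_num)
      have : lam * (b - a) ^ (1/2 : ℝ) * (Cd d * Cb (1/2) (1/2)) * (b - τ) ^ (1/2 : ℝ) ≤ D := by rw [hD]; gcongr
      simp only [pow_zero, mul_one]; linarith
    | succ n ih =>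
      intro τ h1 h2 x w
      have hA : 0 ≤ 2 * Cd d + D * (1/2)^n := by positivity
      have := ph_lip_step (B := (2 * Cd d + D * (1/2)^n) * κ) hu hf hlam hf0 hf1 (by positivity) h2 (fun σ hσ y => 
        Ed_of_lip hlam hA hσ.2 (hκ σ) (ih σ (by linarith [hσ.1]) hσ.2) y) x w
      have hp : 0 < b - τ := by linarith
      refine this.trans (mul_le_mul_of_nonneg_right (mul_le_mul_of_nonneg_right ?_ (Real.rpow_nonneg hp.le _)) (norm_nonneg w))
      have q : (b - τ) ^ (1/2 : ℝ) ≤ (b - a) ^ (1/2 : ℝ) := Real.rpow_le_rpow hp.le (by linarith) (by norm_num)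
      have : κ * (Cd d * Cb (1/2) (1/2)) * (b - τ) ^ (1/2 : ℝ) ≤ 1/2 := by
        refine le_trans ?_ hs; gcongr
      have := mul_le_mul_of_nonneg_left this hA
      rw [pow_succ]
      nlinarith
  have lim : Tendsto (fun n : ℕ => (2 * Cd d + D * (1/2)^n) * (b - τ) ^ (-(1/2) : ℝ) * ‖w‖) atTop (𝓝 ((2 * Cd d + D * 0) * (b - τ) ^ (-(1/2) : ℝ) * ‖w‖)) := by
    have := tendsto_pow_atTop_nhds_zero_of_lt_one (r := (1/2 : ℝ)) (by norm_num) (by norm_num)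
    exact (((this.const_mul D).const_add _).mul_const _).mul_const _
  rw [mul_zero, add_zero] at lim
  exact ge_of_tendsto' lim fun n => key n τ haτ hτ x w

lemma Ed_le (hu : Measurable (uncurry u)) (hf : Measurable f) (hlam : 0 < lam) (hf0 : ∀ x, 0 ≤ f x) (hf1 : ∀ x, f x ≤ 1)
    {κ a : ℝ} (hκ0 : 0 ≤ κ) (hκ : ∀ σ y, ‖u σ y‖ ≤ κ) (hs : SmallB d κ (b - a)) {σ : ℝ} (haσ : a ≤ σ) (hσ : σ < b) (y : Euc d) :
    |Ed u lam b f σ y| ≤ (2 * Cd d * κ) * (b - σ) ^ (-(1/2) : ℝ) :=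
  Ed_of_lip hlam (by have := Cd_pos (d := d); positivity) hσ (hκ σ) (ph_lip hu hf hlam hf0 hf1 hκ0 hκ hs haσ hσ) y

lemma ph_close (hu : Measurable (uncurry u)) (hf : Measurable f) (hlam : 0 < lam) (hf0 : ∀ x, 0 ≤ f x) (hf1 : ∀ x, f x ≤ 1)
    {κ a : ℝ} (hκ0 : 0 ≤ κ) (hκ : ∀ σ y, ‖u σ y‖ ≤ κ) (hs : SmallB d κ (b - a)) (hab : a < b) (x : Euc d) :
    |ph u lam b f a x - Hr d (b - a) f x| ≤ 4 * Cd d * κ * (b - a) ^ (1/2 : ℝ) := by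
  have hC := Cd_pos (d := d)
  have hh : 0 < b - a := by linarith
  rw [ph_duhamel hu hf hlam hf0 hf1 hab, add_sub_cancel_left, ← Real.norm_eq_abs]
  refine abs_int_le (k := fun σ => (2 * Cd d * κ) * (b - σ) ^ (-(1/2) : ℝ)) (by positivity) ?_ ?_
  · rw [ae_restrict_iff' measurableSet_Ioo]
    refine ae_of_all _ fun σ hσ => ?_
    exact Hr_abs_le _ (by linarith [hσ.1]) _ _ (mul_nonneg (by positivity) (Real.rpow_nonneg (by linarith [hσ.2]) _))
      (Ed_le hu hf hlam hf0 hf1 hκ0 hκ hs hσ.1.le hσ.2) x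
  · simp_rw [ofReal_mul (show 0 ≤ 2 * Cd d * κ by positivity)]
    rw [lintegral_const_mul' _ _ ofReal_ne_top, lint_pow_right a b (1/2) hab (by norm_num), ← ofReal_mul (by positivity)]
    apply ofReal_le_ofReal
    rw [show (1 - 1/2 : ℝ) = 1/2 by norm_num]
    apply le_of_eq; ring

def Dph (u : ℝ → Euc d → Euc d) (lam b : ℝ) (f : Euc d → ℝ) (τ : ℝ) (x : Euc d) : Euc d :=
  DH d (b - τ) f x + ∫ σ in Ioo τ b, DH d (σ - τ) (Ed u lam b f σ) x

lemma DHEd_meas (hu : Measurable (uncurry u)) (hf : Measurable f) (τ : ℝ) (x : Euc d) :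
    Measurable (fun σ => DH d (σ - τ) (Ed u lam b f σ) x) :=
  DH_meas (r := fun σ => σ - τ) (x := fun _ => x) (by fun_prop) (Ed_meas hu hf) measurable_const

lemma DHEd_le (hu : Measurable (uncurry u)) (hf : Measurable f) (hlam : 0 < lam) (hf0 : ∀ x, 0 ≤ f x) (hf1 : ∀ x, f x ≤ 1)
    {κ a : ℝ} (hκ0 : 0 ≤ κ) (hκ : ∀ σ y, ‖u σ y‖ ≤ κ) (hs : SmallB d κ (b - a)) {τ : ℝ} (haτ : a ≤ τ) {σ : ℝ} (hσ : σ ∈ Ioo τ b) (x : Euc d) :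
    ‖DH d (σ - τ) (Ed u lam b f σ) x‖ ≤ (2 * Cd d ^ 2 * κ) * ((σ - τ) ^ (-(1/2) : ℝ) * (b - σ) ^ (-(1/2) : ℝ)) := by
  have hC := Cd_pos (d := d)
  refine (DH_norm_le _ (by linarith [hσ.1]) _ _ (mul_nonneg (by positivity) (Real.rpow_nonneg (by linarith [hσ.2]) _))
      (Ed_le hu hf hlam hf0 hf1 hκ0 hκ hs (haτ.trans hσ.1.le) hσ.2) x).trans (le_of_eq ?_)
  ring

lemma lint_beta_mul (τ b c α β : ℝ) (hc : 0 ≤ c) (h : τ < b) (hα0 : 0 ≤ α) (hα : α < 1) (hβ0 : 0 ≤ β) (hβ : β < 1) :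
    ∫⁻ σ in Ioo τ b, ofReal (c * ((σ - τ) ^ (-α) * (b - σ) ^ (-β))) ≤
      ofReal (c * (Cb α β * (b - τ) ^ (1 - α - β))) := by
  simp_rw [ofReal_mul hc]
  rw [lintegral_const_mul' _ _ ofReal_ne_top]
  gcongr; exact lint_beta τ b α β h hα0 hα hβ0 hβ

lemma DHEd_int (hu : Measurable (uncurry u)) (hf : Measurable f) (hlam : 0 < lam) (hf0 : ∀ x, 0 ≤ f x) (hf1 : ∀ x, f x ≤ 1)
    {κ a : ℝ} (hκ0 : 0 ≤ κ) (hκ : ∀ σ y, ‖u σ y‖ ≤ κ) (hs : SmallB d κ (b - a)) {τ : ℝ} (haτ : a ≤ τ) (hτ : τ < b) (x : Euc d) :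
    IntegrableOn (fun σ => DH d (σ - τ) (Ed u lam b f σ) x) (Ioo τ b) := by
  have hC := Cd_pos (d := d)
  refine integrable_of_bd (DHEd_meas hu hf τ x).aestronglyMeasurable
    ((ae_restrict_iff' measurableSet_Ioo).2 (ae_of_all _ fun σ hσ => DHEd_le hu hf hlam hf0 hf1 hκ0 hκ hs haτ hσ x))
    (lint_beta_mul τ b _ (1/2) (1/2) (by positivity) hτ (by norm_num) (by norm_num) (by norm_num) (by norm_num))

def Crem (d : ℕ) (κ h : ℝ) : ℝ := 2 * Cd d ^ 2 * (1 + 2 * Cd d * κ * Cb (3/4) (1/2) * h ^ (1/2 : ℝ))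

lemma ph_rem (hu : Measurable (uncurry u)) (hf : Measurable f) (hlam : 0 < lam) (hf0 : ∀ x, 0 ≤ f x) (hf1 : ∀ x, f x ≤ 1)
    {κ a : ℝ} (hκ0 : 0 ≤ κ) (hκ : ∀ σ y, ‖u σ y‖ ≤ κ) (hs : SmallB d κ (b - a)) {τ : ℝ} (haτ : a ≤ τ) (hτ : τ < b) (x w : Euc d) :
    |ph u lam b f τ (x + w) - ph u lam b f τ x - inner ℝ (Dph u lam b f τ x) w| ≤ Crem d κ (b - a) * ‖w‖ ^ (3/2 : ℝ) * (b - τ) ^ (-(3/4) : ℝ) := by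
  have hC := Cd_pos (d := d)
  have hCb := Cb_pos (3/4) (1/2) (by norm_num) (by norm_num)
  have hp : 0 < b - τ := by linarith
  have hh : 0 < b - a := by linarith
  have i1 := DHEd_int hu hf hlam hf0 hf1 hκ0 hκ hs haτ hτ x
  have e : inner ℝ (Dph u lam b f τ x) w = inner ℝ (DH d (b - τ) f x) w + ∫ σ in Ioo τ b, inner ℝ (DH d (σ - τ) (Ed u lam b f σ) x) w := by
    unfold Dph
    rw [inner_add_left]
    congr 1
    rw [real_inner_comm, ← integral_inner i1]
    congr 1; ext σ; rw [real_inner_comm]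
  have i2 : IntegrableOn (fun σ => (inner ℝ (DH d (σ - τ) (Ed u lam b f σ) x) w : ℝ)) (Ioo τ b) := i1.inner_const w
  have j1 := intHrEd hu hf hlam hf1 (b := b) (u := u) τ (x + w)
  have j2 := intHrEd hu hf hlam hf1 (b := b) (u := u) τ x
  have j12 : IntegrableOn (fun σ => Hr d (σ - τ) (Ed u lam b f σ) (x + w) - Hr d (σ - τ) (Ed u lam b f σ) x) (Ioo τ b) := j1.sub j2
  rw [ph_duhamel hu hf hlam hf0 hf1 hτ, ph_duhamel hu hf hlam hf0 hf1 hτ x, add_sub_add_comm, e, add_sub_add_comm,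
    ← integral_sub j1 j2, ← integral_sub j12 i2]
  have h1 := Hr_rem (b - τ) hp f hf 1 zero_le_one (fun y => by rw [abs_of_nonneg (hf0 y)]; exact hf1 y) x w
  have h2 : ‖∫ σ in Ioo τ b, ((Hr d (σ - τ) (Ed u lam b f σ) (x + w) - Hr d (σ - τ) (Ed u lam b f σ) x) - inner ℝ (DH d (σ - τ) (Ed u lam b f σ) x) w)‖ ≤
      (2 * Cd d * κ * (2 * Cd d ^ 2 * ‖w‖ ^ (3/2 : ℝ))) * (Cb (3/4) (1/2) * (b - τ) ^ (1 - 3/4 - 1/2 : ℝ)) := by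
    refine abs_int_le (k := fun σ => (2 * Cd d * κ * (2 * Cd d ^ 2 * ‖w‖ ^ (3/2 : ℝ))) * ((σ - τ) ^ (-(3/4) : ℝ) * (b - σ) ^ (-(1/2) : ℝ))) (by positivity) ?_ ?_
    · rw [ae_restrict_iff' measurableSet_Ioo]
      refine ae_of_all _ fun σ hσ => ?_
      have := Hr_rem (σ - τ) (by linarith [hσ.1]) _ (meas_slice (Ed_meas hu hf) σ) ((2 * Cd d * κ) * (b - σ) ^ (-(1/2) : ℝ))
        (mul_nonneg (by positivity) (Real.rpow_nonneg (by linarith [hσ.2]) _)) (Ed_le hu hf hlam hf0 hf1 hκ0 hκ hs (haτ.trans hσ.1.le) hσ.2) x w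
      rw [Real.norm_eq_abs]
      refine this.trans (le_of_eq ?_)
      ring
    · exact lint_beta_mul τ b _ (3/4) (1/2) (by positivity) hτ (by norm_num) (by norm_num) (by norm_num) (by norm_num)
  rw [Real.norm_eq_abs] at h2
  refine (abs_add_le _ _).trans ((add_le_add h1 h2).trans ?_)
  have e2 : (b - τ) ^ (1 - 3/4 - 1/2 : ℝ) = (b - τ) ^ (1/2 : ℝ) * (b - τ) ^ (-(3/4) : ℝ) := by
    rw [← Real.rpow_add hp]; norm_num
  have q : (b - τ) ^ (1/2 : ℝ) ≤ (b - a) ^ (1/2 : ℝ) := Real.rpow_le_rpow hp.le (by linarith) (by norm_num)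
  rw [e2]
  unfold Crem
  have q2 : 0 < (b - τ) ^ (-(3/4) : ℝ) := Real.rpow_pos_of_pos hp _
  have q3 : 0 ≤ ‖w‖ ^ (3/2 : ℝ) := by positivity
  calc _ = 2 * Cd d ^ 2 * (1 + 2 * Cd d * κ * Cb (3/4) (1/2) * (b - τ) ^ (1/2 : ℝ)) * ‖w‖ ^ (3/2 : ℝ) * (b - τ) ^ (-(3/4) : ℝ) := by ring
    _ ≤ _ := by gcongr
end Part6

section Part7
variable {d : ℕ}

def St (d : ℕ) (s t : ℝ) : Set (ℝ × Euc d) := Ioo s t ×ˢ Set.univ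

lemma St_meas (s t : ℝ) : MeasurableSet (St d s t) := measurableSet_Ioo.prod MeasurableSet.univ

lemma St_restrict (s t : ℝ) : (volume : Measure (ℝ × Euc d)).restrict (St d s t) = (volume.restrict (Ioo s t)).prod volume := by
  unfold St
  rw [Measure.volume_eq_prod, ← Measure.prod_restrict, Measure.restrict_univ]

lemma lint_St (s t : ℝ) {g : ℝ × Euc d → ℝ≥0∞} (hg : Measurable g) :
    ∫⁻ p in St d s t, g p = ∫⁻ τ in Ioo s t, ∫⁻ y, g (τ, y) := by
  rw [St_restrict, lintegral_prod _ hg.aemeasurable]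

lemma mem_St {s t : ℝ} {p : ℝ × Euc d} : p ∈ St d s t ↔ p.1 ∈ Ioo s t := by
  unfold St; simp

structure Mild (T N M : ℝ) (ρ : ℝ → Euc d → ℝ) (F : ℝ → Euc d → Euc d) : Prop where
  ρm : Measurable (uncurry ρ)
  Fm : Measurable (uncurry F)
  N0 : 0 ≤ N
  M0 : 0 ≤ M
  mass : ∀ t, 0 ≤ t → t ≤ T → ∫⁻ x, ‖ρ t x‖ₑ ≤ ofReal N
  flux : ∀ t, 0 < t → t ≤ T → ∫⁻ x, ‖F t x‖ₑ ≤ ofReal (M * t ^ (-(1/2) : ℝ))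
  mild : ∀ t, 0 < t → t ≤ T → ∀ᵐ x, ρ t x = Hr d t (ρ 0) x - ∫ τ in Ioo 0 t, ∫ y, (inner ℝ (gk d (t - τ) (x - y)) (F τ y) : ℝ)

variable {T N M : ℝ} {ρ : ℝ → Euc d → ℝ} {F : ℝ → Euc d → Euc d}

lemma Mild.int (h : Mild T N M ρ F) {t : ℝ} (h0 : 0 ≤ t) (hT : t ≤ T) : Integrable (ρ t) :=
  ⟨(meas_slice h.ρm t).aestronglyMeasurable, (h.mass t h0 hT).trans_lt ofReal_lt_top⟩

lemma Mild.fluxk (h : Mild T N M ρ F) {s t c : ℝ} (hc : 0 ≤ c) (h0 : 0 ≤ s) (hst : s < t) (hT : t ≤ T) :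
    ∫⁻ p in St d s t, ofReal (c * (t - p.1) ^ (-(1/2) : ℝ)) * ‖F p.1 p.2‖ₑ ≤ ofReal (c * M * Cb (1/2) (1/2)) := by
  have hm : Measurable (fun p : ℝ × Euc d => ofReal (c * (t - p.1) ^ (-(1/2) : ℝ)) * ‖F p.1 p.2‖ₑ) :=
    Measurable.mul (by fun_prop) h.Fm.enorm
  have hcM : 0 ≤ c * M := mul_nonneg hc h.M0
  rw [lint_St _ _ hm]
  calc _ ≤ ∫⁻ τ in Ioo s t, ofReal ((c * M) * ((τ - 0) ^ (-(1/2) : ℝ) * (t - τ) ^ (-(1/2) : ℝ))) := by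
        refine setLIntegral_mono' measurableSet_Ioo fun τ hτ => ?_
        have p1 : 0 < τ := h0.trans_lt hτ.1
        have p2 : 0 < t - τ := by linarith [hτ.2]
        dsimp only
        rw [lintegral_const_mul' _ _ ofReal_ne_top]
        refine (mul_le_mul_right (h.flux τ p1 (hτ.2.le.trans hT)) _).trans ?_
        rw [← ofReal_mul (by positivity), sub_zero]
        apply ofReal_le_ofReal
        apply le_of_eq; ring
    _ ≤ ∫⁻ τ in Ioo 0 t, ofReal ((c * M) * ((τ - 0) ^ (-(1/2) : ℝ) * (t - τ) ^ (-(1/2) : ℝ))) :=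
        lintegral_mono_set (Set.Ioo_subset_Ioo_left h0)
    _ ≤ _ := by
        refine (lint_beta_mul 0 t _ (1/2) (1/2) hcM (by linarith) (by norm_num) (by norm_num) (by norm_num) (by norm_num)).trans ?_
        norm_num

lemma Mild.Fint (h : Mild T N M ρ F) {s t c : ℝ} (hc : 0 ≤ c) (h0 : 0 ≤ s) (hst : s < t) (hT : t ≤ T) {Ψ : ℝ × Euc d → Euc d}
    (hΨ : Measurable Ψ) (hb : ∀ p, p.1 ∈ Ioo s t → ‖Ψ p‖ ≤ c * (t - p.1) ^ (-(1/2) : ℝ)) :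
    IntegrableOn (fun p => (inner ℝ (F p.1 p.2) (Ψ p) : ℝ)) (St d s t) := by
  refine ⟨(Measurable.inner h.Fm hΨ).aestronglyMeasurable, ?_⟩
  refine lt_of_le_of_lt ?_ ((h.fluxk hc h0 hst hT).trans_lt ofReal_lt_top)
  refine setLIntegral_mono' (St_meas s t) fun p hp => ?_
  rw [mem_St] at hp
  rw [← ofReal_norm, ← ofReal_norm, ← ofReal_mul (mul_nonneg hc (Real.rpow_nonneg (by linarith [hp.2]) _))]
  apply ofReal_le_ofReal
  refine (norm_inner_le_norm _ _).trans ?_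
  rw [mul_comm]
  gcongr
  exact hb p hp

lemma Hr_adj {t : ℝ} (ht : 0 < t) {f g : Euc d → ℝ} (hg : Integrable g) (hgm : Measurable g) (hfm : Measurable f) {c : ℝ} (hf : ∀ x, |f x| ≤ c) :
    Integrable (fun x => Hr d t g x * f x) ∧ ∫ x, Hr d t g x * f x = ∫ y, g y * Hr d t f y := by
  have hi : Integrable (fun p : Euc d × Euc d => f p.1 • (heatKernel d t (p.1 - p.2) * g p.2)) (volume.prod volume) := by
    refine Integrable.bdd_smul ?_ c (hfm.comp measurable_fst).aestronglyMeasurable (ae_of_all _ fun p => hf p.1)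
    have hm : Measurable (fun p : Euc d × Euc d => heatKernel d t (p.1 - p.2) * g p.2) := Measurable.mul (by fun_prop) (hgm.comp measurable_snd)
    refine ⟨hm.aestronglyMeasurable, ?_⟩
    rw [hasFiniteIntegral_iff_enorm, lintegral_prod_symm _ hm.enorm.aemeasurable]
    simp_rw [enorm_mul]
    have : ∀ y, ∫⁻ x, ‖heatKernel d t (x - y)‖ₑ * ‖g y‖ₑ = ‖g y‖ₑ := by
      intro y
      rw [lintegral_mul_const _ (by fun_prop)]
      have : ∀ x, ‖heatKernel d t (x - y)‖ₑ = Ge d t (x - y) := fun x => by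
        unfold Ge; rw [← ofReal_norm, Real.norm_eq_abs, abs_of_nonneg (hk_nonneg t ht.le _)]
      simp_rw [this]
      rw [lintegral_sub_right_eq_self (fun x => Ge d t x), lint_Ge t ht, one_mul]
    simp_rw [this]
    exact hg.2
  have e1 : ∀ x, Hr d t g x * f x = ∫ y, f x • (heatKernel d t (x - y) * g y) := by
    intro x; unfold Hr; rw [integral_smul, smul_eq_mul, mul_comm]
  constructor
  · simp_rw [e1]; exact hi.integral_prod_left
  · simp_rw [e1]
    rw [integral_integral_swap (f := fun x y => f x • (heatKernel d t (x - y) * g y)) hi]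
    congr 1; ext y
    unfold Hr
    rw [← integral_const_mul]
    congr 1; ext x
    have : heatKernel d t (x - y) = heatKernel d t (y - x) := by rw [← hk_neg, neg_sub]
    rw [this, smul_eq_mul]; ring

lemma DH_meas1 {t : ℝ} {f : Euc d → ℝ} (hfm : Measurable f) : Measurable (fun p : ℝ × Euc d => DH d (t - p.1) f p.2) := by
  have hf' : Measurable (uncurry (fun (_ : ℝ × Euc d) => f)) := hfm.comp measurable_snd
  exact DH_meas (r := fun p : ℝ × Euc d => t - p.1) (x := fun p => p.2) (by fun_prop) hf' measurable_snd

lemma Mild.W0 (h : Mild T N M ρ F) {t : ℝ} (ht : 0 < t) (hT : t ≤ T) {f : Euc d → ℝ} (hfm : Measurable f) {c : ℝ} (hc : 0 ≤ c) (hf : ∀ x, |f x| ≤ c) :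
    ∫ x, ρ t x * f x = (∫ x, ρ 0 x * Hr d t f x) + ∫ p in St d 0 t, (inner ℝ (F p.1 p.2) (DH d (t - p.1) f p.2) : ℝ) := by
  set μ := (volume : Measure (ℝ × Euc d)).restrict (St d 0 t) with hμ
  have hC := Cd_pos (d := d)
  set K : Euc d → ℝ × Euc d → ℝ := fun x p => inner ℝ (gk d (t - p.1) (x - p.2)) (F p.1 p.2) with hK
  have hFm : Measurable (fun p : ℝ × Euc d => F p.1 p.2) := h.Fm
  have hKm : Measurable (uncurry K) := by
    rw [hK]; unfold uncurry
    exact Measurable.inner (by fun_prop) (hFm.comp measurable_snd)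
  have hKi : Integrable (uncurry K) (volume.prod μ) := by
    refine ⟨hKm.aestronglyMeasurable, ?_⟩
    rw [hasFiniteIntegral_iff_enorm, lintegral_prod_symm _ hKm.enorm.aemeasurable]
    refine lt_of_le_of_lt ?_ ((h.fluxk hC.le le_rfl ht hT).trans_lt ofReal_lt_top)
    refine setLIntegral_mono' (St_meas 0 t) fun p hp => ?_
    rw [mem_St] at hp
    have q : 0 < t - p.1 := by linarith [hp.2]
    calc _ ≤ ∫⁻ x, ‖gk d (t - p.1) (x - p.2)‖ₑ * ‖F p.1 p.2‖ₑ := by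
          refine lintegral_mono fun x => ?_
          rw [← ofReal_norm, ← ofReal_norm, ← ofReal_norm, ← ofReal_mul (norm_nonneg _)]
          exact ofReal_le_ofReal (norm_inner_le_norm _ _)
      _ = (∫⁻ x, ‖gk d (t - p.1) x‖ₑ) * ‖F p.1 p.2‖ₑ := by
          rw [lintegral_mul_const _ (by fun_prop), lintegral_sub_right_eq_self (fun x => ‖gk d (t - p.1) x‖ₑ)]
      _ ≤ _ := by gcongr; exact lint_gk _ q
  have e0 : ∀ᵐ x, ρ t x * f x = Hr d t (ρ 0) x * f x - ∫ p, f x • K x p ∂μ := by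
    filter_upwards [h.mild t ht hT, hKi.prod_right_ae] with x hx hx2
    rw [hx, sub_mul, integral_smul, smul_eq_mul, mul_comm _ (f x), mul_comm _ (f x)]
    congr 2
    have hx2' : Integrable (K x) ((volume.restrict (Ioo 0 t)).prod volume) := by
      rw [hμ, St_restrict] at hx2; exact hx2
    rw [hμ, St_restrict, integral_prod _ hx2']
  have hfK : Integrable (uncurry (fun x p => f x • K x p)) (volume.prod μ) :=
    hKi.bdd_smul c (hfm.comp measurable_fst).aestronglyMeasurable (ae_of_all _ fun p => hf p.1)
  obtain ⟨a1, a2⟩ := Hr_adj ht (h.int le_rfl (ht.le.trans hT)) (meas_slice h.ρm 0) hfm hf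
  have i2 : Integrable (fun x => ∫ p, f x • K x p ∂μ) := hfK.integral_prod_left
  rw [integral_congr_ae e0, integral_sub a1 i2, a2, integral_integral_swap (f := fun x p => f x • K x p) hfK, sub_eq_add_neg, ← integral_neg]
  congr 1
  refine setIntegral_congr_fun (St_meas 0 t) fun p hp => ?_
  rw [mem_St] at hp
  have q : 0 < t - p.1 := by linarith [hp.2]
  have hi := integrable_kern (integrable_gk (d := d) (t - p.1) q) hfm hf p.2
  unfold DH
  rw [← integral_inner hi, ← integral_neg]
  congr 1; ext x
  rw [inner_smul_right, real_inner_comm, smul_eq_mul]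
  show -(f x * inner ℝ (gk d (t - p.1) (x - p.2)) (F p.1 p.2)) = _
  rw [← neg_sub p.2 x, gk_neg, inner_neg_left]
  ring

lemma Hr_Hr {r s : ℝ} (hr : 0 < r) (hs : 0 < s) {f : Euc d → ℝ} (hfm : Measurable f) {c : ℝ} (hf : ∀ x, |f x| ≤ c) (x : Euc d) :
    Hr d r (Hr d s f) x = Hr d (r + s) f x := by
  have hGm : Measurable (fun y => heatKernel d r (x - y)) := by fun_prop
  have hGi : Integrable (fun y => heatKernel d r (x - y)) := (integrable_hk r hr).comp_sub_left x
  have := (Hr_adj hs hGi hGm hfm hf).2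
  unfold Hr at this ⊢
  rw [← this]
  congr 1; ext z
  rw [← hk_semi r s hr hs (x - z)]
  congr 1
  dsimp only
  rw [← integral_add_right_eq_self (fun y => heatKernel d s (z - y) * heatKernel d r (x - y)) z]
  congr 1; ext y
  rw [show z - (y + z) = -y by abel, hk_neg, show x - (y + z) = x - z - y by abel, mul_comm]

lemma DH_Hr {r s : ℝ} (hr : 0 < r) (hs : 0 < s) {f : Euc d → ℝ} (hfm : Measurable f) {c : ℝ} (hf : ∀ x, |f x| ≤ c) (x : Euc d) :
    DH d r (Hr d s f) x = DH d (r + s) f x := by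
  have hc : 0 ≤ c := (abs_nonneg _).trans (hf x)
  have hHm : Measurable (Hr d s f) := by
    have hf' : Measurable (uncurry (fun (_ : Euc d) => f)) := hfm.comp measurable_snd
    exact Hr_meas (r := fun _ : Euc d => s) (x := fun x => x) (by fun_prop) hf' measurable_id
  refine ext_inner_left ℝ fun v => ?_
  unfold DH
  rw [← integral_inner (integrable_kern (integrable_gk (d := d) r hr) hHm (fun y => Hr_abs_le _ hs _ _ hc hf y) x),
    ← integral_inner (integrable_kern (integrable_gk (d := d) (r + s) (by linarith)) hfm hf x)]
  have hGm : Measurable (fun y => (inner ℝ v (gk d r (x - y)) : ℝ)) := Measurable.inner measurable_const (by fun_prop)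
  have hGi : Integrable (fun y => (inner ℝ v (gk d r (x - y)) : ℝ)) := ((integrable_gk r hr).comp_sub_left x).const_inner v
  have := (Hr_adj hs hGi hGm hfm hf).2
  have e1 : ∀ y, (inner ℝ v (Hr d s f y • gk d r (x - y)) : ℝ) = inner ℝ v (gk d r (x - y)) * Hr d s f y := fun y => by
    rw [inner_smul_right, mul_comm]
  simp_rw [e1]
  rw [← this]
  congr 1; ext z
  rw [inner_smul_right, mul_comm]
  congr 1
  unfold Hr
  have i3 : Integrable (fun y => heatKernel d s (x - z - y) • gk d r y) := by
    refine (integrable_gk (d := d) r hr).bdd_smul ((4*π*s)^(-(d:ℝ)/2)) (φ := fun y => heatKernel d s (x - z - y)) (by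
      have : Measurable (fun y => heatKernel d s (x - z - y)) := by fun_prop
      exact this.aestronglyMeasurable) (ae_of_all _ fun y => ?_)
    rw [Real.norm_eq_abs, abs_of_nonneg (hk_nonneg s hs.le _)]; exact hk_le s hs _
  rw [add_comm r s, ← gk_semi s r hs hr (x - z), ← integral_inner i3]
  rw [← integral_sub_left_eq_self _ volume x]
  congr 1; ext y
  dsimp only
  rw [inner_smul_right, sub_sub_cancel, ← hk_neg]
  congr 2; abel

lemma Mild.W (h : Mild T N M ρ F) {s t : ℝ} (hs : 0 ≤ s) (hst : s < t) (hT : t ≤ T) {f : Euc d → ℝ} (hfm : Measurable f) {c : ℝ} (hc : 0 ≤ c) (hf : ∀ x, |f x| ≤ c) :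
    ∫ x, ρ t x * f x = (∫ x, ρ s x * Hr d (t - s) f x) + ∫ p in St d s t, (inner ℝ (F p.1 p.2) (DH d (t - p.1) f p.2) : ℝ) := by
  rcases hs.eq_or_lt with rfl | hs
  · rw [sub_zero]; exact h.W0 hst hT hfm hc hf
  have p0 : 0 < t - s := by linarith
  have hHm : Measurable (Hr d (t - s) f) := by
    have hf' : Measurable (uncurry (fun (_ : Euc d) => f)) := hfm.comp measurable_snd
    exact Hr_meas (r := fun _ : Euc d => t - s) (x := fun x => x) (by fun_prop) hf' measurable_id
  have w1 := h.W0 (hs.trans hst) hT hfm hc hf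
  have w2 := h.W0 hs (hst.le.trans hT) hHm hc (fun x => Hr_abs_le _ p0 _ _ hc hf x)
  have e1 : ∀ x, Hr d s (Hr d (t - s) f) x = Hr d t f x := fun x => by
    rw [Hr_Hr hs p0 hfm hf]; congr 1; ring
  have e2 : ∫ p in St d 0 s, (inner ℝ (F p.1 p.2) (DH d (s - p.1) (Hr d (t - s) f) p.2) : ℝ) = ∫ p in St d 0 s, (inner ℝ (F p.1 p.2) (DH d (t - p.1) f p.2) : ℝ) := by
    refine setIntegral_congr_fun (St_meas 0 s) fun p hp => ?_
    rw [mem_St] at hp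
    rw [DH_Hr (by linarith [hp.2]) p0 hfm hf]
    congr 2; ring
  simp_rw [e1] at w2
  rw [e2] at w2
  have hi : IntegrableOn (fun p : ℝ × Euc d => (inner ℝ (F p.1 p.2) (DH d (t - p.1) f p.2) : ℝ)) (St d 0 t) := by
    refine h.Fint (c := c * Cd d) (mul_nonneg hc Cd_pos.le) le_rfl (hs.trans hst) hT (DH_meas1 hfm) ?_
    intro p hp
    rw [mul_assoc]
    exact DH_norm_le _ (by linarith [hp.2]) f c hc hf p.2
  have e3 : ∫ p in St d 0 t, (inner ℝ (F p.1 p.2) (DH d (t - p.1) f p.2) : ℝ) = (∫ p in St d 0 s, (inner ℝ (F p.1 p.2) (DH d (t - p.1) f p.2) : ℝ)) + ∫ p in St d s t, (inner ℝ (F p.1 p.2) (DH d (t - p.1) f p.2) : ℝ) := by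
    have hsub : St d 0 s ∪ St d s t ⊆ St d 0 t := by
      intro p hp
      rcases hp with hp | hp <;> rw [mem_St] at hp ⊢
      · exact ⟨hp.1, hp.2.trans hst⟩
      · exact ⟨hs.trans hp.1, hp.2⟩
    have hd : Disjoint (St d 0 s) (St d s t) := by
      rw [Set.disjoint_left]; intro p hp hp2
      rw [mem_St] at hp hp2
      linarith [hp.2, hp2.1]
    rw [← setIntegral_union hd (St_meas _ _) (hi.mono_set (Set.subset_union_left.trans hsub)) (hi.mono_set (Set.subset_union_right.trans hsub))]
    symm
    apply setIntegral_congr_set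
    rw [ae_eq_set]
    constructor
    · rw [Set.sdiff_eq_empty.2 hsub]; simp
    · refine measure_mono_null (t := {s} ×ˢ Set.univ) ?_ ?_
      · intro p hp
        have h1 := hp.1
        have h2 := hp.2
        simp only [Set.mem_union, mem_St, Set.mem_Ioo, not_or, not_and, not_lt] at h1 h2
        have := h2.1 h1.1
        have : p.1 = s := by
          rcases this.eq_or_lt with h' | h'
          · exact h'.symm
          · linarith [h2.2 h', h1.2]
        simp [this]
      · rw [Measure.volume_eq_prod, Measure.prod_prod]; simp
  rw [w1, e3]
  linarith
end Part7

section Part8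
variable {d : ℕ}
variable {T N M : ℝ} {ρ : ℝ → Euc d → ℝ} {F : ℝ → Euc d → Euc d}
variable {u : ℝ → Euc d → Euc d} {lam b : ℝ} {f : Euc d → ℝ}

lemma Mild.Ffin (h : Mild T N M ρ F) {a b : ℝ} (h0 : 0 ≤ a) (hab : a < b) (hT : b ≤ T) :
    ∫⁻ p in St d a b, ‖F p.1 p.2‖ₑ < ⊤ := by
  refine lt_of_le_of_lt ?_ ((h.fluxk (c := (b - a) ^ (1/2 : ℝ)) (Real.rpow_nonneg (by linarith) _) h0 hab hT).trans_lt ofReal_lt_top)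
  refine setLIntegral_mono' (St_meas a b) fun p hp => ?_
  rw [mem_St] at hp
  have q : 0 < b - p.1 := by linarith [hp.2]
  refine le_mul_of_one_le_left' ?_
  rw [ENNReal.one_le_ofReal]
  refine (rpow_half_mul (b - p.1) q).symm.le.trans ?_
  rw [mul_comm]
  have : b - p.1 ≤ b - a := by linarith [hp.1]
  gcongr

lemma Mild.ρint (h : Mild T N M ρ F) {a b : ℝ} (h0 : 0 ≤ a) (hT : b ≤ T) :
    IntegrableOn (fun p : ℝ × Euc d => ρ p.1 p.2) (St d a b) := by
  refine ⟨h.ρm.aestronglyMeasurable, ?_⟩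
  have hm : Measurable (fun p : ℝ × Euc d => ‖ρ p.1 p.2‖ₑ) := h.ρm.enorm
  rw [hasFiniteIntegral_iff_enorm, lint_St _ _ hm]
  refine lt_of_le_of_lt (setLIntegral_mono' measurableSet_Ioo (g := fun _ => ofReal N) fun τ hτ => h.mass τ (by linarith [hτ.1]) (by linarith [hτ.2])) ?_
  rw [setLIntegral_const]
  exact ENNReal.mul_lt_top ofReal_lt_top (by simp)

lemma slice2 {α : Type*} [MeasurableSpace α] {φ : ℝ → Euc d → ℝ} (hφ : Measurable (uncurry φ)) {k : α → ℝ} (hk : Measurable k) :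
    Measurable (uncurry (fun (q : α) (y : Euc d) => φ (k q) y)) := by
  have h2 : Measurable (fun z : α × Euc d => (k z.1, z.2)) := (hk.comp measurable_fst).prodMk measurable_snd
  exact hφ.comp h2

set_option maxHeartbeats 1000000 in
lemma dual1 (h : Mild T N M ρ F) {a : ℝ} (h0 : 0 ≤ a) (hab : a < b) (hT : b ≤ T)
    (hu : Measurable (uncurry u)) (hf : Measurable f) (hlam : 0 < lam) (hf0 : ∀ x, 0 ≤ f x) (hf1 : ∀ x, f x ≤ 1)
    {κ : ℝ} (hκ0 : 0 ≤ κ) (hκ : ∀ σ y, ‖u σ y‖ ≤ κ) (hs : SmallB d κ (b - a)) :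
    IntegrableOn (fun p : ℝ × Euc d => (inner ℝ (F p.1 p.2) (Dph u lam b f p.1 p.2) : ℝ)) (St d a b) ∧
    IntegrableOn (fun p : ℝ × Euc d => ρ p.1 p.2 * Ed u lam b f p.1 p.2) (St d a b) ∧
    (∫ x, ρ b x * f x) + ∫ p in St d a b, ρ p.1 p.2 * Ed u lam b f p.1 p.2 =
      (∫ x, ρ a x * ph u lam b f a x) + ∫ p in St d a b, (inner ℝ (F p.1 p.2) (Dph u lam b f p.1 p.2) : ℝ) := by
  have hC := Cd_pos (d := d)
  have hfa : ∀ x, |f x| ≤ 1 := fun x => abs_le.2 ⟨by linarith [hf0 x], hf1 x⟩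
  set μ := (volume : Measure (ℝ × Euc d)).restrict (St d a b) with hμ
  set ν := (volume : Measure ℝ).restrict (Ioo a b) with hν
  set c := 2 * Cd d ^ 2 * κ with hc
  have hc0 : 0 ≤ c := by positivity
  set J : ℝ × Euc d → ℝ → ℝ := fun p σ => inner ℝ (F p.1 p.2) (DH d (σ - p.1) (Ed u lam b f σ) p.2) with hJ
  set K : ℝ × Euc d → ℝ → ℝ := fun p σ => Set.indicator {q : (ℝ × Euc d) × ℝ | q.1.1 < q.2} (uncurry J) (p, σ) with hK
  have hEm := Ed_meas (lam := lam) (b := b) hu hf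
  have hJm : Measurable (uncurry J) := by
    have hg := slice2 hEm (measurable_snd : Measurable (fun q : (ℝ × Euc d) × ℝ => q.2))
    have hF' : Measurable (fun q : (ℝ × Euc d) × ℝ => F q.1.1 q.1.2) := h.Fm.comp measurable_fst
    have hD' : Measurable (fun q : (ℝ × Euc d) × ℝ => DH d (q.2 - q.1.1) (Ed u lam b f q.2) q.1.2) :=
      DH_meas (r := fun q : (ℝ × Euc d) × ℝ => q.2 - q.1.1) (x := fun q => q.1.2) (by fun_prop) hg (by fun_prop)
    exact Measurable.inner hF' hD'
  have hKm : Measurable (uncurry K) := by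
    exact hJm.indicator (measurableSet_lt (by fun_prop) (by fun_prop))
  have hKi : Integrable (uncurry K) (μ.prod ν) := by
    refine ⟨hKm.aestronglyMeasurable, ?_⟩
    rw [hasFiniteIntegral_iff_enorm, lintegral_prod _ hKm.enorm.aemeasurable]
    have : ∫⁻ p, ‖F p.1 p.2‖ₑ * ofReal (c * Cb (1/2) (1/2)) ∂μ < ⊤ := by
      rw [lintegral_mul_const' _ _ ofReal_ne_top]
      exact ENNReal.mul_lt_top (h.Ffin h0 hab hT) ofReal_lt_top
    refine lt_of_le_of_lt (setLIntegral_mono' (St_meas a b) fun p hp => ?_) this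
    rw [mem_St] at hp
    calc _ ≤ ∫⁻ σ in Ioo a b, (Ioi p.1).indicator (fun σ => ‖F p.1 p.2‖ₑ * ofReal (c * ((σ - p.1) ^ (-(1/2) : ℝ) * (b - σ) ^ (-(1/2) : ℝ)))) σ := by
          refine setLIntegral_mono' measurableSet_Ioo fun σ hσ => ?_
          by_cases hh : p.1 < σ
          · have e1 : uncurry K (p, σ) = J p σ := Set.indicator_of_mem (s := {q : (ℝ × Euc d) × ℝ | q.1.1 < q.2}) hh _
            rw [e1, Set.indicator_of_mem (show σ ∈ Ioi p.1 from hh), ← ofReal_norm, ← ofReal_norm, ← ofReal_mul (norm_nonneg _)]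
            apply ofReal_le_ofReal
            refine (norm_inner_le_norm _ _).trans ?_
            gcongr
            exact DHEd_le hu hf hlam hf0 hf1 hκ0 hκ hs hp.1.le ⟨hh, hσ.2⟩ p.2
          · have e1 : uncurry K (p, σ) = 0 := Set.indicator_of_notMem (s := {q : (ℝ × Euc d) × ℝ | q.1.1 < q.2}) hh _
            rw [e1]; simp
      _ = ∫⁻ σ in Ioo p.1 b, ‖F p.1 p.2‖ₑ * ofReal (c * ((σ - p.1) ^ (-(1/2) : ℝ) * (b - σ) ^ (-(1/2) : ℝ))) := by
          rw [setLIntegral_indicator measurableSet_Ioi]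
          congr 2; ext σ; simp only [Set.mem_inter_iff, Set.mem_Ioi, Set.mem_Ioo]
          constructor
          · rintro ⟨h1, h2, h3⟩; exact ⟨h1, h3⟩
          · rintro ⟨h1, h3⟩; exact ⟨h1, hp.1.trans h1, h3⟩
      _ ≤ _ := by
          rw [lintegral_const_mul' _ _ enorm_ne_top]
          refine mul_le_mul_right ((lint_beta_mul p.1 b c (1/2) (1/2) hc0 hp.2 (by norm_num) (by norm_num) (by norm_num) (by norm_num)).trans ?_) _
          norm_num
  have kp : ∀ p ∈ St d a b, ∫ σ, K p σ ∂ν = inner ℝ (F p.1 p.2) (∫ σ in Ioo p.1 b, DH d (σ - p.1) (Ed u lam b f σ) p.2) := by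
    intro p hp
    rw [mem_St] at hp
    rw [← integral_inner (DHEd_int hu hf hlam hf0 hf1 hκ0 hκ hs hp.1.le hp.2 p.2)]
    have : ∀ σ, K p σ = (Ioi p.1).indicator (J p) σ := fun σ => rfl
    simp_rw [this]
    rw [hν, setIntegral_indicator measurableSet_Ioi]
    congr 2; ext σ; simp only [Set.mem_inter_iff, Set.mem_Ioi, Set.mem_Ioo]
    constructor
    · rintro ⟨⟨h2, h3⟩, h1⟩; exact ⟨h1, h3⟩
    · rintro ⟨h1, h3⟩; exact ⟨⟨hp.1.trans h1, h3⟩, h1⟩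
  have kσ : ∀ σ ∈ Ioo a b, ∫ p, K p σ ∂μ = ∫ p in St d a σ, J p σ := by
    intro σ hσ
    have : ∀ p, K p σ = (St d a σ ∪ {p | p.1 ≤ a}).indicator (fun p => J p σ) p := by
      intro p
      rw [hK]; dsimp only
      by_cases hh : p.1 < σ
      · rw [Set.indicator_of_mem (s := {q : (ℝ × Euc d) × ℝ | q.1.1 < q.2}) hh, Set.indicator_of_mem]
        · rfl
        · by_cases h2 : p.1 ≤ a
          · exact Or.inr h2
          · left; rw [mem_St]; exact ⟨not_le.1 h2, hh⟩
      · rw [Set.indicator_of_notMem (s := {q : (ℝ × Euc d) × ℝ | q.1.1 < q.2}) hh, Set.indicator_of_notMem]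
        rintro (h2 | h2)
        · rw [mem_St] at h2; exact hh h2.2
        · exact hh (lt_of_le_of_lt h2 hσ.1)
    simp_rw [this]
    rw [hμ, setIntegral_indicator ((St_meas a σ).union (measurableSet_le (by fun_prop) (by fun_prop)))]
    congr 2; ext p
    simp only [Set.mem_inter_iff, Set.mem_union, mem_St, Set.mem_Ioo, Set.mem_ofPred_eq]
    constructor
    · rintro ⟨h1, h2 | h2⟩
      · exact h2
      · linarith
    · rintro h2; exact ⟨⟨h2.1, h2.2.trans hσ.2⟩, Or.inl h2⟩
  have ha := h.int h0 (hab.le.trans hT)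
  have ham := meas_slice h.ρm a
  have hHm : Measurable (uncurry (fun (x : Euc d) (σ : ℝ) => Hr d (σ - a) (Ed u lam b f σ) x)) := by
    have hg := slice2 hEm (measurable_snd : Measurable (fun q : Euc d × ℝ => q.2))
    exact Hr_meas (r := fun q : Euc d × ℝ => q.2 - a) (x := fun q => q.1) (by fun_prop) hg (by fun_prop)
  have hLi : Integrable (uncurry (fun (x : Euc d) (σ : ℝ) => ρ a x * Hr d (σ - a) (Ed u lam b f σ) x)) (volume.prod ν) := by
    have i1 : Integrable (fun q : Euc d × ℝ => ρ a q.1 * (1:ℝ)) (volume.prod ν) := ha.mul_prod (integrable_const (1:ℝ))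
    refine (i1.const_mul lam).mono (((ham.comp measurable_fst).mul hHm).aestronglyMeasurable) ?_
    have hmem : ∀ᵐ q ∂((volume : Measure (Euc d)).prod ν), q.2 ∈ Ioo a b :=
      Measure.quasiMeasurePreserving_snd.ae (ae_restrict_mem measurableSet_Ioo)
    filter_upwards [hmem] with q hq
    rw [uncurry, norm_mul, norm_mul, mul_one, mul_comm, Real.norm_of_nonneg hlam.le]
    gcongr
    exact Hr_abs_le _ (by linarith [hq.1]) _ _ hlam.le (fun y => Ed_abs_le hlam hf1 hq.2 y) _
  have hEi : IntegrableOn (fun p : ℝ × Euc d => ρ p.1 p.2 * Ed u lam b f p.1 p.2) (St d a b) := by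
    refine ((h.ρint h0 hT).const_mul lam).mono ((h.ρm.mul hEm).aestronglyMeasurable) ?_
    filter_upwards [ae_restrict_mem (St_meas a b)] with p hp
    rw [mem_St] at hp
    rw [norm_mul, norm_mul, mul_comm, Real.norm_of_nonneg hlam.le]
    gcongr
    exact Ed_abs_le hlam hf1 hp.2 p.2
  have hD1 : IntegrableOn (fun p : ℝ × Euc d => (inner ℝ (F p.1 p.2) (DH d (b - p.1) f p.2) : ℝ)) (St d a b) := by
    refine h.Fint (c := 1 * Cd d) (by positivity) h0 hab hT (DH_meas1 hf) fun p hp => ?_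
    rw [mul_assoc]
    exact DH_norm_le _ (by linarith [hp.2]) f 1 zero_le_one hfa p.2
  have hD2 : Integrable (fun p => ∫ σ, K p σ ∂ν) μ := hKi.integral_prod_left
  have eD : Set.EqOn (fun p : ℝ × Euc d => (inner ℝ (F p.1 p.2) (DH d (b - p.1) f p.2) : ℝ) + ∫ σ, K p σ ∂ν) (fun p : ℝ × Euc d => (inner ℝ (F p.1 p.2) (Dph u lam b f p.1 p.2) : ℝ)) (St d a b) := by
    intro p hp
    dsimp only
    rw [kp p hp, ← inner_add_right]; rfl
  refine ⟨(hD1.add hD2).congr_fun eD (St_meas a b), hEi, ?_⟩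
  have w1 := h.W h0 hab hT hf zero_le_one hfa
  have w2 : ∀ σ ∈ Ioo a b, ∫ x, ρ σ x * Ed u lam b f σ x = (∫ x, ρ a x * Hr d (σ - a) (Ed u lam b f σ) x) + ∫ p, K p σ ∂μ := by
    intro σ hσ
    rw [kσ σ hσ]
    exact h.W h0 hσ.1 (hσ.2.le.trans hT) (meas_slice hEm σ) hlam.le (fun y => Ed_abs_le hlam hf1 hσ.2 y)
  have w3 : ∫ p in St d a b, ρ p.1 p.2 * Ed u lam b f p.1 p.2 = (∫ σ, (∫ x, ρ a x * Hr d (σ - a) (Ed u lam b f σ) x) ∂ν) + ∫ σ, ∫ p, K p σ ∂μ ∂ν := by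
    have hEi' := hEi
    unfold IntegrableOn at hEi'
    rw [St_restrict] at hEi' ⊢
    rw [integral_prod _ hEi', setIntegral_congr_fun measurableSet_Ioo w2]
    exact integral_add hLi.integral_prod_right hKi.integral_prod_right
  have w4 : ∫ σ, (∫ x, ρ a x * Hr d (σ - a) (Ed u lam b f σ) x) ∂ν = ∫ x, ρ a x * (∫ σ in Ioo a b, Hr d (σ - a) (Ed u lam b f σ) x) := by
    rw [← integral_integral_swap hLi]
    congr 1; ext x
    rw [integral_const_mul]
  have hL2 : Integrable (fun x => ρ a x * (∫ σ in Ioo a b, Hr d (σ - a) (Ed u lam b f σ) x)) := by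
    have := hLi.integral_prod_left
    refine this.congr (ae_of_all _ fun x => ?_)
    show ∫ σ, ρ a x * Hr d (σ - a) (Ed u lam b f σ) x ∂ν = ρ a x * _
    exact integral_const_mul _ _
  have hL1 : Integrable (fun x => ρ a x * Hr d (b - a) f x) := by
    have hHf : Measurable (Hr d (b - a) f) := by
      have hf' : Measurable (uncurry (fun (_ : Euc d) => f)) := hf.comp measurable_snd
      exact Hr_meas (r := fun _ : Euc d => b - a) (x := fun x => x) (by fun_prop) hf' measurable_id
    refine (ha.bdd_smul 1 hHf.aestronglyMeasurable (ae_of_all _ fun x => ?_)).congr (ae_of_all _ fun x => mul_comm (Hr d (b - a) f x) (ρ a x))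
    exact Hr_abs_le _ (by linarith) _ _ zero_le_one hfa x
  rw [w3, w4, w1, ← setIntegral_congr_fun (St_meas a b) eD, integral_add hD1 hD2, integral_integral_swap hKi]
  have e5 : ∫ x, ρ a x * ph u lam b f a x = (∫ x, ρ a x * Hr d (b - a) f x) + ∫ x, ρ a x * (∫ σ in Ioo a b, Hr d (σ - a) (Ed u lam b f σ) x) := by
    rw [← integral_add hL1 hL2]
    congr 1; ext x
    rw [ph_duhamel hu hf hlam hf0 hf1 hab]; ring
  rw [e5]; ring

lemma dual2 (h : Mild T N M ρ F) {a : ℝ} (h0 : 0 ≤ a) (hab : a < b) (hT : b ≤ T)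
    (hu : Measurable (uncurry u)) (hf : Measurable f) (hlam : 0 < lam) (hf0 : ∀ x, 0 ≤ f x) (hf1 : ∀ x, f x ≤ 1)
    {κ : ℝ} (hκ0 : 0 ≤ κ) (hκ : ∀ σ y, ‖u σ y‖ ≤ κ) (hs : SmallB d κ (b - a))
    (hF : ∀ τ ∈ Ioo a b, ∀ y, F τ y = ρ τ y • u τ y) :
    |(∫ x, ρ b x * f x) - ∫ x, ρ a x * ph u lam b f a x| ≤ N * (Crem d κ (b - a) * κ ^ (3/2 : ℝ)) * ((b - a) ^ (1 - 3/4 : ℝ) / (1 - 3/4)) * lam ^ (-(1/2) : ℝ) := by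
  obtain ⟨i1, i2, e⟩ := dual1 h h0 hab hT hu hf hlam hf0 hf1 hκ0 hκ hs
  have e2 : (∫ x, ρ b x * f x) - ∫ x, ρ a x * ph u lam b f a x = ∫ p in St d a b, (inner ℝ (F p.1 p.2) (Dph u lam b f p.1 p.2) - ρ p.1 p.2 * Ed u lam b f p.1 p.2) := by
    rw [integral_sub i1 i2]; linarith
  have hC := Cd_pos (d := d)
  have hCr : 0 ≤ Crem d κ (b - a) := by
    unfold Crem
    have := Cb_pos (α := 3/4) (β := 1/2) (by norm_num) (by norm_num)
    have := Real.rpow_nonneg (show 0 ≤ b - a by linarith) (1/2 : ℝ)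
    positivity
  have hba : 0 ≤ b - a := by linarith
  have hN := h.N0
  rw [e2, ← Real.norm_eq_abs]
  set c := Crem d κ (b - a) * κ ^ (3/2 : ℝ) * lam ^ (-(1/2) : ℝ) with hc
  have hc0 : 0 ≤ c := by positivity
  refine abs_int_le (k := fun p => |ρ p.1 p.2| * (c * (b - p.1) ^ (-(3/4) : ℝ))) (by positivity) ?_ ?_
  · filter_upwards [ae_restrict_mem (St_meas a b)] with p hp
    rw [mem_St] at hp
    have q : 0 < b - p.1 := by linarith [hp.2]
    rw [hF p.1 hp p.2, real_inner_smul_left, ← mul_sub, norm_mul, Real.norm_eq_abs, Real.norm_eq_abs]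
    refine mul_le_mul_of_nonneg_left ?_ (abs_nonneg _)
    have hr := ph_rem hu hf hlam hf0 hf1 hκ0 hκ hs hp.1.le hp.2 p.2 (lam⁻¹ • u p.1 p.2)
    unfold Ed
    rw [inner_smul_right, real_inner_comm] at hr
    have e3 : inner ℝ (u p.1 p.2) (Dph u lam b f p.1 p.2) - lam * (ph u lam b f p.1 (p.2 + lam⁻¹ • u p.1 p.2) - ph u lam b f p.1 p.2) =
      -(lam * (ph u lam b f p.1 (p.2 + lam⁻¹ • u p.1 p.2) - ph u lam b f p.1 p.2 - lam⁻¹ * inner ℝ (u p.1 p.2) (Dph u lam b f p.1 p.2))) := by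
      field_simp; ring
    rw [e3, abs_neg, abs_mul, abs_of_pos hlam]
    refine (mul_le_mul_of_nonneg_left hr hlam.le).trans ?_
    have e4 : lam * (lam⁻¹ * κ) ^ (3/2 : ℝ) = κ ^ (3/2 : ℝ) * lam ^ (-(1/2) : ℝ) := by
      rw [Real.mul_rpow (by positivity) hκ0, Real.inv_rpow hlam.le, ← Real.rpow_neg hlam.le]
      rw [show (-(1/2) : ℝ) = 1 + -(3/2) by norm_num, Real.rpow_add hlam, Real.rpow_one]; ring
    have e5 : ‖lam⁻¹ • u p.1 p.2‖ ^ (3/2 : ℝ) ≤ (lam⁻¹ * κ) ^ (3/2 : ℝ) := by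
      rw [norm_smul, Real.norm_of_nonneg (by positivity)]
      gcongr
      exact hκ _ _
    calc _ ≤ lam * (Crem d κ (b - a) * (lam⁻¹ * κ) ^ (3/2 : ℝ) * (b - p.1) ^ (-(3/4) : ℝ)) := by gcongr
      _ = Crem d κ (b - a) * (lam * (lam⁻¹ * κ) ^ (3/2 : ℝ)) * (b - p.1) ^ (-(3/4) : ℝ) := by ring
      _ ≤ _ := by rw [e4, hc]; apply le_of_eq; ring
  · have hm : Measurable (fun p : ℝ × Euc d => ofReal (|ρ p.1 p.2| * (c * (b - p.1) ^ (-(3/4) : ℝ)))) := by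
      have : Measurable (fun p : ℝ × Euc d => ρ p.1 p.2) := h.ρm
      have : Measurable (fun p : ℝ × Euc d => |ρ p.1 p.2|) := measurable_norm.comp this
      exact (this.mul (by fun_prop)).ennreal_ofReal
    rw [lint_St _ _ hm]
    calc _ ≤ ∫⁻ τ in Ioo a b, ofReal (N * c) * ofReal ((b - τ) ^ (-(3/4) : ℝ)) := by
          refine setLIntegral_mono' measurableSet_Ioo fun τ hτ => ?_
          have q : 0 < b - τ := by linarith [hτ.2]
          have : ∀ y, ofReal (|ρ τ y| * (c * (b - τ) ^ (-(3/4) : ℝ))) = ‖ρ τ y‖ₑ * ofReal (c * (b - τ) ^ (-(3/4) : ℝ)) := fun y => by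
            rw [ofReal_mul (abs_nonneg _), ← Real.norm_eq_abs, ofReal_norm]
          simp_rw [this]
          rw [lintegral_mul_const' _ _ ofReal_ne_top, ofReal_mul hN, ofReal_mul hc0, mul_assoc]
          gcongr
          exact h.mass τ (by linarith [hτ.1]) (by linarith [hτ.2])
      _ ≤ _ := by
          rw [lintegral_const_mul' _ _ ofReal_ne_top, lint_pow_right a b (3/4) hab (by norm_num), ← ofReal_mul (by positivity)]
          apply ofReal_le_ofReal
          rw [hc]; apply le_of_eq; ring
end Part8

section Part9
variable {d : ℕ}

def c4 (d : ℕ) (r₀ : ℝ) : ℝ := (1/2) * ((4 * π) ^ (-(d:ℝ)/2) * Real.exp (-r₀ ^ 2) * ((r₀/2) ^ d * (volume (Metric.ball (0 : Euc d) 1)).toReal))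

lemma c4_pos {r₀ : ℝ} (hr : 0 < r₀) : 0 < c4 d r₀ := by
  unfold c4
  have : 0 < (volume (Metric.ball (0 : Euc d) 1)).toReal :=
    ENNReal.toReal_pos (Metric.measure_ball_pos _ _ one_pos).ne' measure_ball_lt_top.ne
  positivity

lemma Hr_ball_low {r₀ h ρ' : ℝ} (hr : 0 < r₀) (hh : 0 < h) (hρ : r₀ * √h ≤ ρ') {x y : Euc d} (hy : dist y x < ρ' + r₀ * √h)
    {f : Euc d → ℝ} (hfm : Measurable f) (hf0 : ∀ z, 0 ≤ f z) (hf1 : ∀ z, f z ≤ 1) (hf : ∀ z ∈ Metric.ball x ρ', f z = 1) :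
    2 * c4 d r₀ ≤ Hr d h f y := by
  set r := r₀ * √h with hrd
  have hs : 0 < √h := Real.sqrt_pos.2 hh
  have hr' : 0 < r := by positivity
  obtain ⟨z₀, hz1, hz2⟩ : ∃ z₀ : Euc d, dist z₀ x ≤ ρ' - r/2 ∧ dist z₀ y ≤ 3 * r / 2 := by
    by_cases hc : dist y x ≤ ρ' - r/2
    · exact ⟨y, hc, by rw [dist_self]; positivity⟩
    · push Not at hc
      have hpos : 0 < dist y x := by linarith
      have hpos' : 0 < ‖y - x‖ := by rwa [← dist_eq_norm]
      refine ⟨x + ((ρ' - r/2) / ‖y - x‖) • (y - x), ?_, ?_⟩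
      · rw [dist_eq_norm, add_sub_cancel_left, norm_smul, Real.norm_of_nonneg (by apply div_nonneg <;> linarith), div_mul_cancel₀ _ hpos'.ne']
      · rw [dist_eq_norm]
        have : x + ((ρ' - r/2) / ‖y - x‖) • (y - x) - y = ((ρ' - r/2) / ‖y - x‖ - 1) • (y - x) := by
          rw [sub_smul, one_smul]; abel
        rw [this, norm_smul, Real.norm_eq_abs, ← abs_of_pos hpos', ← abs_mul, abs_of_pos hpos', sub_mul, div_mul_cancel₀ _ hpos'.ne', one_mul, abs_sub_comm, abs_le, ← dist_eq_norm]
        constructor <;> linarith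
  set k := (4 * π * h) ^ (-(d:ℝ)/2) * Real.exp (-r₀ ^ 2) with hk
  have hk0 : 0 ≤ k := by positivity
  have hi : Integrable (fun z => heatKernel d h (y - z) * f z) := by
    have h1 : Integrable (fun z => heatKernel d h (y - z)) := (integrable_hk h hh).comp_sub_left y
    refine (h1.bdd_smul 1 hfm.aestronglyMeasurable (ae_of_all _ fun z => ?_)).congr (ae_of_all _ fun z => mul_comm (f z) _)
    rw [Real.norm_of_nonneg (hf0 z)]; exact hf1 z
  have hb : Integrable ((Metric.ball z₀ (r/2)).indicator (fun _ : Euc d => k)) :=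
    (integrableOn_const measure_ball_lt_top.ne).integrable_indicator measurableSet_ball
  have hle : ∫ z, (Metric.ball z₀ (r/2)).indicator (fun _ : Euc d => k) z ≤ Hr d h f y := by
    refine integral_mono hb hi fun z => ?_
    by_cases hz : z ∈ Metric.ball z₀ (r/2)
    · rw [Set.indicator_of_mem hz]
      rw [Metric.mem_ball] at hz
      have hz3 : z ∈ Metric.ball x ρ' := by
        rw [Metric.mem_ball]; linarith [dist_triangle z z₀ x]
      rw [hf z hz3, mul_one, hk]
      unfold heatKernel
      gcongr
      have h4 : ‖y - z‖ ≤ 2 * r := by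
        rw [← dist_eq_norm]
        have := dist_triangle y z₀ z
        rw [dist_comm y z₀, dist_comm z₀ z] at this
        linarith
      have h5 : ‖y - z‖ ^ 2 ≤ (2 * r) ^ 2 := by gcongr
      have h6 : (2 * r) ^ 2 = 4 * r₀ ^ 2 * h := by rw [hrd]; ring_nf; rw [Real.sq_sqrt hh.le]
      rw [neg_div, neg_le_neg_iff, div_le_iff₀ (by positivity)]
      linarith
    · rw [Set.indicator_of_notMem hz]
      exact mul_nonneg (hk_nonneg h hh.le _) (hf0 z)
  refine le_trans (le_of_eq ?_) hle
  rw [integral_indicator measurableSet_ball, setIntegral_const, smul_eq_mul]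
  unfold Measure.real
  rw [Measure.addHaar_ball_of_pos volume z₀ (by positivity : (0:ℝ) < r/2), ENNReal.toReal_mul, ENNReal.toReal_ofReal (by positivity), finrank_euclideanSpace_fin, hk]
  unfold c4
  rw [Real.mul_rpow (by positivity) hh.le, hrd]
  have e1 : (r₀ * √h / 2) ^ d = (r₀/2) ^ d * h ^ ((d:ℝ)/2) := by
    rw [show r₀ * √h / 2 = r₀ / 2 * √h by ring, mul_pow]
    congr 1
    rw [Real.sqrt_eq_rpow, ← Real.rpow_natCast, ← Real.rpow_mul hh.le]; congr 1; ring
  have e2 : h ^ (-(d:ℝ)/2) * h ^ ((d:ℝ)/2) = 1 := by rw [← Real.rpow_add hh, show -(d:ℝ)/2 + (d:ℝ)/2 = 0 by ring, Real.rpow_zero]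
  rw [e1]
  generalize (volume (Metric.ball (0 : Euc d) 1)).toReal = v
  generalize (4 * π) ^ (-(d:ℝ)/2) = w
  generalize h ^ (-(d:ℝ)/2) = p at *
  generalize h ^ ((d:ℝ)/2) = q at *
  linear_combination (-(w * Real.exp (-r₀ ^ 2) * (r₀/2) ^ d * v)) * e2

structure Adm (f : Euc d → ℝ) : Prop where
  m : Measurable f
  n : ∀ x, 0 ≤ f x
  o : ∀ x, f x ≤ 1

lemma Adm.compl {f : Euc d → ℝ} (h : Adm f) : Adm (fun x => 1 - f x) :=
  ⟨measurable_const.sub h.m, fun x => by linarith [h.o x], fun x => by linarith [h.n x]⟩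

structure Blk (h ε : ℝ) (P : (Euc d → ℝ) → (Euc d → ℝ)) : Prop where
  adm : ∀ f, Adm f → Adm (P f)
  mono : ∀ f g, Adm f → Adm g → (∀ x, f x ≤ g x) → ∀ x, P f x ≤ P g x
  smul : ∀ f c, Adm f → 0 ≤ c → ∀ x, P (fun y => c * f y) x = c * P f x
  compl : ∀ f, Adm f → ∀ x, P (fun y => 1 - f y) x = 1 - P f x
  close : ∀ f, Adm f → ∀ x, |P f x - Hr d h f x| ≤ ε
  lip : ∀ f, Adm f → ∀ x w, |P f (x + w) - P f x| ≤ 2 * Cd d * h ^ (-(1/2) : ℝ) * ‖w‖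

def r0 (d : ℕ) : ℝ := 1 / (8 * Cd d)

lemma r0_pos : 0 < r0 d := by unfold r0; have := Cd_pos (d := d); positivity

lemma chain_low {h ε : ℝ} (hh : 0 < h) {P : ℕ → (Euc d → ℝ) → (Euc d → ℝ)} {n : ℕ} (hP : ∀ k < n + 1, Blk h ε (P k)) (hε : ε ≤ c4 d (r0 d))
    {g : ℕ → Euc d → ℝ} (h0 : Adm (g 0)) (hg : ∀ k, g (k + 1) = P k (g k)) {x : Euc d} (hx : 1/2 ≤ g 1 x) (k : ℕ) (hk : k < n + 1) :
    Adm (g (k + 1)) ∧ ∀ y, dist y x < (k + 1) * (r0 d * √h) → 1/4 * c4 d (r0 d) ^ k ≤ g (k + 1) y := by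
  have hC := Cd_pos (d := d)
  have hr := r0_pos (d := d)
  have hs : 0 < √h := Real.sqrt_pos.2 hh
  have hc4 := c4_pos (d := d) hr
  induction k with
  | zero =>
    rw [zero_add]
    have h01 : Adm (g 1) := by rw [← zero_add 1, hg]; exact (hP 0 hk).adm _ h0
    refine ⟨h01, fun y hy => ?_⟩
    have hl := (hP 0 hk).lip (g 0) h0 x (y - x)
    rw [← hg, zero_add, add_sub_cancel, ← dist_eq_norm] at hl
    have e : 2 * Cd d * h ^ (-(1/2) : ℝ) * dist y x ≤ 1/4 := by
      have : 2 * Cd d * h ^ (-(1/2) : ℝ) * dist y x ≤ 2 * Cd d * h ^ (-(1/2) : ℝ) * (r0 d * √h) := by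
        gcongr; simpa using hy.le
      refine this.trans (le_of_eq ?_)
      have := rpow_half_mul h hh
      rw [Real.sqrt_eq_rpow]; unfold r0
      field_simp
      linear_combination 8 * this
    have := (abs_le.1 (hl.trans e)).1
    simp only [pow_zero]; linarith
  | succ k ih =>
    obtain ⟨a1, ih⟩ := ih (by omega)
    have hB := hP (k + 1) hk
    refine ⟨by rw [hg]; exact hB.adm _ a1, fun y hy => ?_⟩
    set α := 1/4 * c4 d (r0 d) ^ k with hα
    have hα0 : 0 ≤ α := by positivity
    set R := ((k:ℝ) + 1) * (r0 d * √h) with hR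
    set χ : Euc d → ℝ := (Metric.ball x R).indicator (fun _ => 1) with hχ
    have hχa : Adm χ := ⟨measurable_const.indicator measurableSet_ball, fun z => Set.indicator_nonneg (fun _ _ => zero_le_one) z,
      fun z => Set.indicator_le_self' (fun _ _ => zero_le_one) z |>.trans le_rfl⟩
    have hle : ∀ z, α * χ z ≤ g (k + 1) z := by
      intro z
      by_cases hz : z ∈ Metric.ball x R
      · rw [hχ, Set.indicator_of_mem hz, mul_one]; exact ih z hz
      · rw [hχ, Set.indicator_of_notMem hz, mul_zero]; exact a1.n z
    have hα1 : Adm (fun z => α * χ z) := ⟨hχa.m.const_mul α, fun z => mul_nonneg hα0 (hχa.n z), fun z => (hle z).trans (a1.o z)⟩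
    have h1 := hB.mono _ _ hα1 a1 hle y
    rw [hB.smul χ α hχa hα0 y, ← hg] at h1
    have h2 := (abs_le.1 (hB.close χ hχa y)).1
    have h3 : 2 * c4 d (r0 d) ≤ Hr d h χ y := by
      refine Hr_ball_low (ρ' := R) (x := x) hr hh ?_ ?_ hχa.m hχa.n hχa.o fun z hz => Set.indicator_of_mem hz _
      · rw [hR]; nlinarith [mul_pos hr hs, (Nat.cast_nonneg k : (0:ℝ) ≤ k)]
      · rw [hR]; push_cast at hy; linarith
    have h4 : c4 d (r0 d) ≤ P (k + 1) χ y := by linarith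
    calc _ = α * c4 d (r0 d) := by rw [hα, pow_succ]; ring
      _ ≤ α * P (k + 1) χ y := by gcongr
      _ ≤ _ := h1

lemma chain_osc {h ε : ℝ} (hh : 0 < h) {P : ℕ → (Euc d → ℝ) → (Euc d → ℝ)} {n : ℕ} (hP : ∀ k < n + 1, Blk h ε (P k)) (hε : ε ≤ c4 d (r0 d))
    {g : ℕ → Euc d → ℝ} (h0 : Adm (g 0)) (hg : ∀ k, g (k + 1) = P k (g k)) {x y : Euc d} (hxy : dist y x < (n + 1) * (r0 d * √h)) :
    Adm (g (n + 1)) ∧ g (n + 1) x - g (n + 1) y ≤ 1 - 1/4 * c4 d (r0 d) ^ n := by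
  have hr := r0_pos (d := d)
  have hs : 0 < √h := Real.sqrt_pos.2 hh
  have hadm : ∀ k < n + 2, Adm (g k) := by
    intro k
    induction k with
    | zero => intro _; exact h0
    | succ k ih => intro hk; rw [hg]; exact (hP k (by omega)).adm _ (ih (by omega))
  refine ⟨hadm _ (by omega), ?_⟩
  by_cases hx : 1/2 ≤ g 1 x
  · have := (chain_low hh hP hε h0 hg hx n (by omega)).2 y hxy
    linarith [(hadm (n + 1) (by omega)).o x]
  · push Not at hx
    set Q : ℕ → (Euc d → ℝ) → (Euc d → ℝ) := fun k f => if k < n + 1 then P k f else fun x => 1 - g (k + 1) x with hQ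
    have hgQ : ∀ k, (fun x => 1 - g (k + 1) x) = Q k (fun x => 1 - g k x) := by
      intro k
      rw [hQ]; dsimp only
      split_ifs with hk
      · ext x; rw [hg, (hP k hk).compl _ (hadm k (by omega))]
      · rfl
    have hQB : ∀ k < n + 1, Blk h ε (Q k) := by
      intro k hk
      have : Q k = P k := by rw [hQ]; simp [hk]
      rw [this]; exact hP k hk
    have := (chain_low (g := fun k x => 1 - g k x) hh hQB hε h0.compl hgQ (x := x) (by linarith) n (by omega)).2 x (by rw [dist_self]; positivity)
    linarith [(hadm (n + 1) (by omega)).n y]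

lemma blk_ph {u : ℝ → Euc d → Euc d} {lam a b κ : ℝ} (hu : Measurable (uncurry u)) (hlam : 0 < lam) (hab : a < b)
    (hκ0 : 0 ≤ κ) (hκ : ∀ σ y, ‖u σ y‖ ≤ κ) (hs : SmallB d κ (b - a)) :
    Blk (b - a) (4 * Cd d * κ * (b - a) ^ (1/2 : ℝ)) (fun f => ph u lam b f a) where
  adm f hf := ⟨meas_slice (ph_meas hu hf.m) a, fun x => ph_nonneg a x, fun x => ph_le_one hlam hf.o hab x⟩
  mono f g _ hg hfg x := ph_mono hlam hfg hg.o hab x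
  smul f c hf hc x := ph_smul hu hf.m hc a x
  compl f hf x := ph_compl hu hlam hf.m hf.n hf.o hab x
  close f hf x := ph_close hu hf.m hlam hf.n hf.o hκ0 hκ hs hab x
  lip f hf x w := ph_lip hu hf.m hlam hf.n hf.o hκ0 hκ hs le_rfl hab x w

variable {T N M : ℝ} {ρ : ℝ → Euc d → ℝ} {F : ℝ → Euc d → Euc d} {u : ℝ → Euc d → Euc d}

lemma dual_chain (h : Mild T N M ρ F) {s hh κ : ℝ} {n : ℕ} (h0 : 0 ≤ s) (hh0 : 0 < hh) (hT : s + (n + 1) * hh ≤ T)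
    (hu : Measurable (uncurry u)) (hκ0 : 0 ≤ κ) (hκ : ∀ σ y, ‖u σ y‖ ≤ κ) (hs : SmallB d κ hh)
    (hF : ∀ τ ∈ Ioo s (s + (n + 1) * hh), ∀ y, F τ y = ρ τ y • u τ y) (hsm : 4 * Cd d * κ * hh ^ (1/2 : ℝ) ≤ c4 d (r0 d))
    {f : Euc d → ℝ} (hf : Adm f) {ε : ℝ} (hε : 0 < ε) :
    ∃ φ : Euc d → ℝ, Adm φ ∧ (∀ x y, dist y x < (n + 1) * (r0 d * √hh) → φ x - φ y ≤ 1 - 1/4 * c4 d (r0 d) ^ n) ∧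
      |(∫ x, ρ (s + (n + 1) * hh) x * f x) - ∫ x, ρ s x * φ x| ≤ ε ∧
      |(∫ x, ρ (s + (n + 1) * hh) x * (1 - f x)) - ∫ x, ρ s x * (1 - φ x)| ≤ ε := by
  set B := N * (Crem d κ hh * κ ^ (3/2 : ℝ)) * (hh ^ (1 - 3/4 : ℝ) / (1 - 3/4)) with hB
  obtain ⟨lam, hlam, hlB⟩ : ∃ lam : ℝ, 0 < lam ∧ (n + 1) * (B * lam ^ (-(1/2) : ℝ)) < ε := by
    have ht : Tendsto (fun l : ℝ => ((n:ℝ) + 1) * (B * l ^ (-(1/2) : ℝ))) atTop (𝓝 (((n:ℝ) + 1) * (B * 0))) :=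
      ((tendsto_rpow_neg_atTop (by norm_num : (0:ℝ) < 1/2)).const_mul B).const_mul _
    rw [mul_zero, mul_zero] at ht
    obtain ⟨l, h1, h2⟩ := ((ht.eventually (gt_mem_nhds hε)).and (eventually_gt_atTop 0)).exists
    exact ⟨l, h2, h1⟩
  set b : ℕ → ℝ := fun k => s + ((n:ℝ) + 1 - k) * hh with hb
  have hbs : ∀ k, b k - b (k + 1) = hh := fun k => by rw [hb]; push_cast; ring
  set g : ℕ → Euc d → ℝ := fun k => Nat.rec f (fun k gk => ph u lam (b k) gk (b (k + 1))) k with hg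
  have hg1 : ∀ k, g (k + 1) = ph u lam (b k) (g k) (b (k + 1)) := fun k => rfl
  have hblk : ∀ k, Blk hh (4 * Cd d * κ * hh ^ (1/2 : ℝ)) (fun f => ph u lam (b k) f (b (k + 1))) := by
    intro k
    have := blk_ph (d := d) (a := b (k + 1)) (b := b k) hu hlam (by linarith [hbs k]) hκ0 hκ (by rw [hbs]; exact hs)
    rw [hbs] at this; exact this
  have hadm : ∀ k, Adm (g k) := by
    intro k
    induction k with
    | zero => exact hf
    | succ k ih => exact (hblk k).adm _ ih
  have hB0 : b 0 = s + (n + 1) * hh := by rw [hb]; simp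
  have hBn : b (n + 1) = s := by rw [hb]; push_cast; ring
  have hrange : ∀ k < n + 1, s ≤ b (k + 1) ∧ b k ≤ s + (n + 1) * hh := by
    intro k hk
    have h1 : (k:ℝ) + 1 ≤ n + 1 := by exact_mod_cast hk
    have h2 : (0:ℝ) ≤ k := Nat.cast_nonneg k
    rw [hb]; push_cast
    constructor <;> nlinarith
  have key : ∀ k ≤ n + 1, |(∫ x, ρ (b 0) x * f x) - ∫ x, ρ (b k) x * g k x| ≤ k * (B * lam ^ (-(1/2) : ℝ)) ∧
      |(∫ x, ρ (b 0) x * (1 - f x)) - ∫ x, ρ (b k) x * (1 - g k x)| ≤ k * (B * lam ^ (-(1/2) : ℝ)) := by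
    intro k
    induction k with
    | zero => intro _; simp [hg]
    | succ k ih =>
      intro hk
      obtain ⟨i1, i2⟩ := ih (by omega)
      obtain ⟨r1, r2⟩ := hrange k (by omega)
      have hlt : b (k + 1) < b k := by linarith [hbs k]
      have hF' : ∀ τ ∈ Ioo (b (k + 1)) (b k), ∀ y, F τ y = ρ τ y • u τ y := fun τ hτ =>
        hF τ ⟨lt_of_le_of_lt r1 hτ.1, lt_of_lt_of_le hτ.2 r2⟩
      have d1 := dual2 h (h0.trans r1) hlt (r2.trans hT) hu (hadm k).m hlam (hadm k).n (hadm k).o hκ0 hκ (by rw [hbs]; exact hs) hF'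
      have d2 := dual2 h (h0.trans r1) hlt (r2.trans hT) hu (hadm k).compl.m hlam (hadm k).compl.n (hadm k).compl.o hκ0 hκ (by rw [hbs]; exact hs) hF'
      rw [hbs, ← hB, ← hg1] at d1
      rw [hbs, ← hB] at d2
      have e2 : ∀ x, ph u lam (b k) (fun x => 1 - g k x) (b (k + 1)) x = 1 - g (k + 1) x := (hblk k).compl _ (hadm k)
      simp_rw [e2] at d2
      push_cast
      constructor
      · refine (abs_sub_le _ (∫ x, ρ (b k) x * g k x) _).trans ?_
        linarith
      · refine (abs_sub_le _ (∫ x, ρ (b k) x * (1 - g k x)) _).trans ?_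
        linarith
  obtain ⟨k1, k2⟩ := key (n + 1) le_rfl
  rw [hBn, hB0] at k1 k2
  push_cast at k1 k2
  exact ⟨g (n + 1), hadm (n + 1), fun x y hxy => (chain_osc hh0 (fun k _ => hblk k) hsm hf hg1 hxy).2, k1.trans hlB.le, k2.trans hlB.le⟩
end Part9

section Part10
variable {d : ℕ}
variable {T N M : ℝ} {ρ : ℝ → Euc d → ℝ} {F : ℝ → Euc d → Euc d} {u : ℝ → Euc d → Euc d}

lemma Hr_lip2 {t : ℝ} (ht : 0 < t) {f : Euc d → ℝ} (hfm : Measurable f) {c Λ : ℝ} (hf : ∀ y, |f y| ≤ c)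
    (hL : ∀ x y, |f x - f y| ≤ Λ * dist x y) (x w : Euc d) : |Hr d t f (x + w) - Hr d t f x| ≤ Λ * ‖w‖ := by
  have e : ∀ x, Hr d t f x = ∫ z, f (x - z) • heatKernel d t z := by
    intro x
    rw [Hr_eq, ← integral_sub_left_eq_self _ volume x]
    congr 1; ext z; rw [sub_sub_cancel]
  have hi : ∀ x, Integrable (fun z => f (x - z) • heatKernel d t z) := fun x =>
    (integrable_hk t ht).bdd_smul c (hfm.comp (measurable_const.sub measurable_id)).aestronglyMeasurable (ae_of_all _ fun z => hf _)
  rw [e, e, ← integral_sub (hi _) (hi _), ← Real.norm_eq_abs]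
  have hb : Integrable (fun z => (Λ * ‖w‖) * heatKernel d t z) := (integrable_hk t ht).const_mul _
  refine (norm_integral_le_of_norm_le hb (ae_of_all _ fun z => ?_)).trans (le_of_eq ?_)
  · rw [← sub_smul, norm_smul, Real.norm_of_nonneg (hk_nonneg t ht.le z)]
    refine mul_le_mul_of_nonneg_right ?_ (hk_nonneg t ht.le z)
    refine (hL _ _).trans (le_of_eq ?_)
    rw [dist_eq_norm]; congr 2; abel
  · rw [integral_const_mul, integral_hk t ht, mul_one]

lemma DH_lip {t : ℝ} (ht : 0 < t) {f : Euc d → ℝ} (hfm : Measurable f) {c Λ : ℝ} (hf : ∀ y, |f y| ≤ c)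
    (hL : ∀ x y, |f x - f y| ≤ Λ * dist x y) (hΛ : 0 ≤ Λ) (x : Euc d) : ‖DH d t f x‖ ≤ Λ := by
  have hc : 0 ≤ c := (abs_nonneg _).trans (hf x)
  set D := DH d t f x with hD
  by_contra hcon
  push Not at hcon
  have hD0 : 0 < ‖D‖ := by linarith
  set B := c * (2 * Cd d ^ 2 * t ^ (-(3 / 4) : ℝ)) with hB
  have key : ∀ ε : ℝ, 0 < ε → ‖D‖ - Λ ≤ B * ε ^ (1/2 : ℝ) := by
    intro ε hε
    have hw : ‖(ε / ‖D‖) • D‖ = ε := by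
      rw [norm_smul, Real.norm_of_nonneg (by positivity)]; field_simp
    have h1 := Hr_rem t ht f hfm c hc hf x ((ε / ‖D‖) • D)
    have h2 := Hr_lip2 ht hfm hf hL x ((ε / ‖D‖) • D)
    rw [hw] at h1 h2
    rw [← hD, inner_smul_right, real_inner_self_eq_norm_sq] at h1
    have e1 : ε / ‖D‖ * ‖D‖ ^ 2 = ε * ‖D‖ := by field_simp
    have e2 : ε ^ (3/2 : ℝ) = ε * ε ^ (1/2 : ℝ) := by
      rw [show (3/2 : ℝ) = 1 + 1/2 by norm_num, Real.rpow_add hε, Real.rpow_one]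
    rw [e1, e2] at h1
    have h3 := (abs_le.1 h1).1
    have h4 := (abs_le.1 h2).2
    have : ε * (‖D‖ - Λ) ≤ ε * (B * ε ^ (1/2 : ℝ)) := by rw [hB]; linarith
    exact le_of_mul_le_mul_left this hε
  have ht' : Tendsto (fun ε : ℝ => B * ε ^ (1/2 : ℝ)) (𝓝[>] 0) (𝓝 (B * (0:ℝ) ^ (1/2 : ℝ))) :=
    ((Real.continuous_rpow_const (by norm_num)).tendsto 0 |>.mono_left nhdsWithin_le_nhds).const_mul B
  have := ge_of_tendsto ht' (eventually_nhdsWithin_of_forall fun ε hε => key ε hε)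
  rw [Real.zero_rpow (by norm_num), mul_zero] at this
  linarith

theorem pt_aux {a φ ψ c : ℝ} (hc : 0 < c) (b1 : 0 ≤ φ) (b2 : φ ≤ 1) (p1 : -1 ≤ ψ) (p2 : ψ ≤ 1)
    (h1 : 1 - c/4 ≤ φ → ψ = 1) (h2 : φ ≤ c/4 → ψ = -1) :
    |a| - (4 / c) * (|a| - (a * φ - a * (1 - φ))) ≤ a * ψ := by
  have big : ∀ A B : ℝ, 0 ≤ A → A * (c / 2) ≤ B → A - 4 / c * B ≤ - A := by
    intro A B hA hAB
    have : 4 / c * (A * (c / 2)) ≤ 4 / c * B := by gcongr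
    have e : 4 / c * (A * (c / 2)) = 2 * A := by field_simp; ring
    linarith
  have h4c : 0 < 4 / c := by positivity
  rcases le_or_gt 0 a with hp | hp
  · rw [abs_of_nonneg hp]
    by_cases hx : 1 - c/4 ≤ φ
    · rw [h1 hx]
      have : 0 ≤ (4 / c) * (a - (a * φ - a * (1 - φ))) := by
        apply mul_nonneg h4c.le; nlinarith
      linarith
    · push Not at hx
      refine (big a _ hp ?_).trans ?_ <;> nlinarith
  · rw [abs_of_neg hp]
    by_cases hx : φ ≤ c / 4
    · rw [h2 hx]
      have : 0 ≤ (4 / c) * (-a - (a * φ - a * (1 - φ))) := by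
        apply mul_nonneg h4c.le; nlinarith
      linarith
    · push Not at hx
      refine (big (-a) _ (by linarith) ?_).trans ?_ <;> nlinarith

set_option maxHeartbeats 2000000 in
lemma massBound (h : Mild T N M ρ F) (hT : 0 < T) {K θ : ℝ} (hK : 0 ≤ K) (hu : Measurable (uncurry u))
    (hub : ∀ τ ∈ Ioc 0 T, ∀ y, ‖u τ y‖ ≤ K * τ ^ (-(1/2) : ℝ)) (hF : ∀ τ ∈ Ioc 0 T, ∀ y, F τ y = ρ τ y • u τ y)
    (hθ : 0 ≤ θ) (h0 : ∫⁻ x, ‖ρ 0 x‖ₑ ≤ ofReal θ) {t : ℝ} (ht : t ∈ Icc 0 T) : ∫⁻ x, ‖ρ t x‖ₑ ≤ ofReal (2 * θ) := by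
  set m : ℝ → ℝ := fun t => ∫ x, |ρ t x| with hm
  have mE : ∀ t ∈ Icc 0 T, ∫⁻ x, ‖ρ t x‖ₑ = ofReal (m t) := fun t ht =>
    (ofReal_integral_norm_eq_lintegral_enorm (h.int ht.1 ht.2)).symm
  have m0 : ∀ t, 0 ≤ m t := fun t => integral_nonneg fun x => abs_nonneg _
  have hbdd : BddAbove (m '' Icc 0 T) := by
    refine ⟨N, ?_⟩
    rintro _ ⟨t, ht, rfl⟩
    have := h.mass t ht.1 ht.2
    rw [mE t ht, ofReal_le_ofReal_iff h.N0] at this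
    exact this
  set L := sSup (m '' Icc 0 T) with hL
  have hmL : ∀ t ∈ Icc 0 T, m t ≤ L := fun t ht => le_csSup hbdd ⟨t, ht, rfl⟩
  rw [mE t ht]
  apply ofReal_le_ofReal
  refine (hmL t ht).trans ?_
  by_contra hcon
  push Not at hcon
  have hLpos : 0 < L := by linarith
  have hm0 : m 0 ≤ θ := by
    rw [mE 0 ⟨le_rfl, hT.le⟩, ofReal_le_ofReal_iff hθ] at h0; exact h0
  have hC := Cd_pos (d := d)
  have hr := r0_pos (d := d)
  have hc4 := c4_pos (d := d) hr
  have hCb := Cb_pos (α := 1/2) (β := 1/2) (by norm_num) (by norm_num)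
  obtain ⟨n, hn1, hn2, hn3⟩ : ∃ n : ℕ, K * (Cd d * Cb (1/2) (1/2)) * 2 ≤ √((n:ℝ) + 1) ∧ 4 * Cd d * K / c4 d (r0 d) ≤ √((n:ℝ) + 1) ∧ 16 * K / r0 d ≤ √((n:ℝ) + 1) := by
    set Q := max (K * (Cd d * Cb (1/2) (1/2)) * 2) (max (4 * Cd d * K / c4 d (r0 d)) (16 * K / r0 d)) with hQ
    obtain ⟨n, hn⟩ := exists_nat_gt (Q ^ 2)
    have : Q ≤ √((n:ℝ) + 1) := Real.le_sqrt_of_sq_le (by linarith)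
    exact ⟨n, (le_max_left _ _).trans this, ((le_max_left _ _).trans (le_max_right _ _)).trans this, ((le_max_right _ _).trans (le_max_right _ _)).trans this⟩
  set q := √((n:ℝ) + 1) with hq
  have hq0 : 0 < q := Real.sqrt_pos.2 (by positivity)
  have hq2 : q ^ 2 = n + 1 := Real.sq_sqrt (by positivity)
  set c := 1/4 * c4 d (r0 d) ^ n with hc
  have hc0 : 0 < c := by positivity
  set δ := L / (8 * (1 + 4 / c)) with hδ
  have hδ0 : 0 < δ := by positivity
  have hδL : δ ≤ L / 8 := by
    rw [hδ]; apply div_le_div_of_nonneg_left hLpos.le (by norm_num)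
    have : 0 < 4 / c := by positivity
    linarith
  obtain ⟨_, ⟨t₀, ht₀, rfl⟩, hlt⟩ := exists_lt_of_lt_csSup (Set.Nonempty.image m (⟨0, le_rfl, hT.le⟩ : (Icc (0:ℝ) T).Nonempty)) (show L - δ < L by linarith)
  have ht0 : 0 < t₀ := by
    rcases ht₀.1.eq_or_lt with h' | h'
    · rw [← h'] at hlt; linarith
    · exact h'
  set s := t₀ / 2 with hs
  have hs0 : 0 < s := by positivity
  have hsT : s ∈ Icc 0 T := ⟨hs0.le, by linarith [ht₀.2]⟩
  set hh := s / ((n:ℝ) + 1) with hhh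
  have hhh0 : 0 < hh := by positivity
  have hend : s + ((n:ℝ) + 1) * hh = t₀ := by rw [hhh, mul_div_cancel₀ _ (by positivity)]; linarith
  have hsq : √hh = √s / q := by rw [hhh, Real.sqrt_div hs0.le]
  have hss : 0 < √s := Real.sqrt_pos.2 hs0
  set κ := K * s ^ (-(1/2) : ℝ) with hκ
  have hκ0 : 0 ≤ κ := by positivity
  have hκh : κ * hh ^ (1/2 : ℝ) = K / q := by
    rw [hκ, ← Real.sqrt_eq_rpow, hsq, Real.rpow_neg hs0.le, ← Real.sqrt_eq_rpow]; field_simp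
  set u' : ℝ → Euc d → Euc d := fun τ y => if τ ∈ Ioo s t₀ then u τ y else 0 with hu'
  have hum : Measurable (uncurry u') := by
    have : MeasurableSet {p : ℝ × Euc d | p.1 ∈ Ioo s t₀} := measurableSet_Ioo.preimage measurable_fst
    exact Measurable.ite this hu measurable_const
  have huκ : ∀ τ y, ‖u' τ y‖ ≤ κ := by
    intro τ y
    rw [hu']; dsimp only
    split_ifs with hτ
    · refine (hub τ ⟨hs0.trans hτ.1, hτ.2.le.trans ht₀.2⟩ y).trans ?_
      rw [hκ]
      refine mul_le_mul_of_nonneg_left ?_ hK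
      exact Real.rpow_le_rpow_of_nonpos hs0 hτ.1.le (by norm_num)
    · rw [norm_zero]; exact hκ0
  have hF' : ∀ τ ∈ Ioo s (s + ((n:ℝ) + 1) * hh), ∀ y, F τ y = ρ τ y • u' τ y := by
    intro τ hτ y
    rw [hend] at hτ
    have : u' τ y = u τ y := if_pos hτ
    rw [this]
    exact hF τ ⟨hs0.trans hτ.1, hτ.2.le.trans ht₀.2⟩ y
  have hSB : SmallB d κ hh := by
    unfold SmallB
    rw [mul_right_comm, hκh, div_mul_eq_mul_div, div_le_iff₀ hq0]; linarith
  have hsm : 4 * Cd d * κ * hh ^ (1/2 : ℝ) ≤ c4 d (r0 d) := by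
    rw [mul_assoc, hκh, ← mul_div_assoc, div_le_iff₀ hq0, mul_comm (c4 d _), ← div_le_iff₀ hc4]; exact hn2
  set f : Euc d → ℝ := fun x => if 0 < ρ t₀ x then 1 else 0 with hf
  have hρm : ∀ t, Measurable (ρ t) := fun t => meas_slice h.ρm t
  have hfA : Adm f := ⟨Measurable.ite (measurableSet_lt measurable_const (hρm t₀)) measurable_const measurable_const,
    fun x => by rw [hf]; dsimp only; split_ifs <;> norm_num, fun x => by rw [hf]; dsimp only; split_ifs <;> norm_num⟩
  obtain ⟨φ, hφ, hosc, hd1, hd2⟩ := dual_chain h hs0.le hhh0 (by rw [hend]; exact ht₀.2) hum hκ0 huκ hSB hF' hsm hfA (half_pos hδ0)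
  rw [hend] at hd1 hd2
  have hint : ∀ t ∈ Icc 0 T, ∀ g : Euc d → ℝ, Measurable g → (∀ x, |g x| ≤ 1) → Integrable (fun x => ρ t x * g x) := by
    intro t ht g hg hg1
    exact ((h.int ht.1 ht.2).bdd_smul 1 hg.aestronglyMeasurable (ae_of_all _ hg1)).congr (ae_of_all _ fun x => mul_comm (g x) (ρ t x))
  have hA1 : ∀ {g : Euc d → ℝ}, Adm g → ∀ x, |g x| ≤ 1 := fun hg x => abs_le.2 ⟨by linarith [hg.n x], hg.o x⟩
  have e1 : m t₀ = (∫ x, ρ t₀ x * f x) - ∫ x, ρ t₀ x * (1 - f x) := by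
    rw [← integral_sub (hint t₀ ht₀ f hfA.m (hA1 hfA)) (hint t₀ ht₀ _ hfA.compl.m (hA1 hfA.compl))]
    refine integral_congr_ae (ae_of_all _ fun x => ?_)
    show |ρ t₀ x| = ρ t₀ x * f x - ρ t₀ x * (1 - f x)
    rw [hf]; dsimp only
    split_ifs with hx
    · rw [abs_of_pos hx]; ring
    · rw [abs_of_nonpos (not_lt.1 hx)]; ring
  set X := (∫ x, ρ s x * φ x) - ∫ x, ρ s x * (1 - φ x) with hX
  have hXlow : L - 2 * δ ≤ X := by
    have a1 := (abs_le.1 hd1).2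
    have a2 := (abs_le.1 hd2).1
    linarith
  have iφ := hint s hsT φ hφ.m (hA1 hφ)
  have iφ' := hint s hsT _ hφ.compl.m (hA1 hφ.compl)
  set E : Set (Euc d) := {x | 1 - c/4 ≤ φ x} with hE
  set R := ((n:ℝ) + 1) * (r0 d * √hh) with hR
  have hR0 : 0 < R := by have := Real.sqrt_pos.2 hhh0; positivity
  have hRe : R = q * r0 d * √s := by rw [hR, hsq, ← hq2]; field_simp
  set χ := thickenedIndicator hR0 E with hχ
  have hχL := lipschitzWith_thickenedIndicator hR0 E
  set ψ : Euc d → ℝ := fun x => 2 * (χ x : ℝ) - 1 with hψ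
  have hχ1 : ∀ x, (χ x : ℝ) ≤ 1 := fun x => by exact_mod_cast thickenedIndicator_le_one hR0 E x
  have hψm : Measurable ψ := by
    have : Continuous fun x => (χ x : ℝ) := NNReal.continuous_coe.comp χ.continuous
    exact (this.measurable.const_mul 2).sub_const 1
  have hψ1 : ∀ x, |ψ x| ≤ 1 := fun x => abs_le.2 ⟨by rw [hψ]; linarith [(χ x).coe_nonneg], by rw [hψ]; linarith [hχ1 x]⟩
  have hψL : ∀ x y, |ψ x - ψ y| ≤ (2 / R) * dist x y := by
    intro x y
    have h1 := hχL.dist_le_mul x y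
    rw [NNReal.dist_eq] at h1
    have : ψ x - ψ y = 2 * ((χ x : ℝ) - χ y) := by rw [hψ]; ring
    rw [this, abs_mul, abs_two]
    have h2 : |(χ x : ℝ) - χ y| ≤ R⁻¹ * dist x y := by
      refine h1.trans (le_of_eq ?_)
      congr 1
      simp [Real.coe_toNNReal _ hR0.le]
    calc _ ≤ 2 * (R⁻¹ * dist x y) := by linarith
      _ = _ := by ring
  have hpt : ∀ x, |ρ s x| - (4 / c) * (|ρ s x| - (ρ s x * φ x - ρ s x * (1 - φ x))) ≤ ρ s x * ψ x := by
    intro x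
    have b1 := hφ.n x
    have b2 := hφ.o x
    have b3 := abs_le.1 (hψ1 x)
    refine pt_aux hc0 b1 b2 b3.1 b3.2 (fun hx => ?_) (fun hx => ?_)
    · have : χ x = 1 := thickenedIndicator_one hR0 E hx
      show 2 * ((χ x : NNReal) : ℝ) - 1 = 1
      rw [this]; norm_num
    · have : χ x = 0 := by
        refine thickenedIndicator_zero hR0 E fun hmem => ?_
        obtain ⟨z, hz, hzx⟩ := Metric.mem_thickening_iff.1 hmem
        have h1 := hosc z x hzx
        have h2 : 1 - c/4 ≤ φ z := hz
        linarith
      show 2 * ((χ x : NNReal) : ℝ) - 1 = -1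
      rw [this]; norm_num
  have iabs : Integrable (fun x => |ρ s x|) := (h.int hsT.1 hsT.2).abs
  have hXm : X ≤ m s := by
    rw [hX, ← integral_sub iφ iφ']
    refine integral_mono (iφ.sub iφ') iabs fun x => ?_
    have b1 := hφ.n x
    have b2 := hφ.o x
    show ρ s x * φ x - ρ s x * (1 - φ x) ≤ |ρ s x|
    rcases le_or_gt 0 (ρ s x) with hp | hp
    · rw [abs_of_nonneg hp]; nlinarith
    · rw [abs_of_neg hp]; nlinarith
  have hlow : m s - (4 / c) * (m s - X) ≤ ∫ x, ρ s x * ψ x := by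
    have i3 := (iabs.sub (iφ.sub iφ')).const_mul (4 / c)
    have := integral_mono (iabs.sub i3) (hint s hsT ψ hψm hψ1) hpt
    refine le_trans (le_of_eq ?_) this
    rw [integral_sub' iabs i3, integral_const_mul, integral_sub' iabs (iφ.sub iφ'), integral_sub' iφ iφ']
  have hW := h.W le_rfl hs0 hsT.2 hψm zero_le_one hψ1
  have up1 : ‖∫ x, ρ 0 x * Hr d (s - 0) ψ x‖ ≤ θ := by
    refine abs_int_le (k := fun x => |ρ 0 x|) hθ (ae_of_all _ fun x => ?_) ?_
    · rw [norm_mul, Real.norm_eq_abs]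
      refine mul_le_of_le_one_right (abs_nonneg _) ?_
      exact Hr_abs_le _ (by linarith) _ _ zero_le_one hψ1 x
    · refine le_trans (le_of_eq ?_) h0
      congr 1; ext x; rw [← Real.norm_eq_abs, ofReal_norm]
  have up2 : ‖∫ p in St d 0 s, (inner ℝ (F p.1 p.2) (DH d (s - p.1) ψ p.2) : ℝ)‖ ≤ L / 4 := by
    refine abs_int_le (k := fun p => ‖F p.1 p.2‖ * (2 / R)) (by positivity) ?_ ?_
    · filter_upwards [ae_restrict_mem (St_meas 0 s)] with p hp
      rw [mem_St] at hp
      refine (norm_inner_le_norm _ _).trans ?_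
      refine mul_le_mul_of_nonneg_left ?_ (norm_nonneg _)
      exact DH_lip (by linarith [hp.2]) hψm hψ1 hψL (by positivity) p.2
    · have hFm : Measurable (fun p : ℝ × Euc d => F p.1 p.2) := h.Fm
      have hm2 : Measurable (fun p : ℝ × Euc d => ofReal (‖F p.1 p.2‖ * (2 / R))) := (hFm.norm.mul_const _).ennreal_ofReal
      rw [lint_St _ _ hm2]
      calc _ ≤ ∫⁻ τ in Ioo 0 s, ofReal (2 / R * K * L) * ofReal ((τ - 0) ^ (-(1/2) : ℝ)) := by
            refine setLIntegral_mono' measurableSet_Ioo fun τ hτ => ?_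
            have hτT : τ ∈ Ioc 0 T := ⟨hτ.1, hτ.2.le.trans hsT.2⟩
            have p1 := hτ.1
            calc _ ≤ ∫⁻ y, ofReal (K * τ ^ (-(1/2) : ℝ) * (2 / R)) * ‖ρ τ y‖ₑ := by
                  refine lintegral_mono fun y => ?_
                  dsimp only
                  rw [hF τ hτT y, norm_smul, ← ofReal_norm, ← ofReal_mul (by positivity)]
                  apply ofReal_le_ofReal
                  have := mul_le_mul_of_nonneg_left (hub τ hτT y) (mul_nonneg (norm_nonneg (ρ τ y)) (by positivity : 0 ≤ 2 / R))
                  linarith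
              _ ≤ _ := by
                  rw [lintegral_const_mul' _ _ ofReal_ne_top, mE τ ⟨p1.le, hτT.2⟩, ← ofReal_mul (by positivity), ← ofReal_mul (by positivity), sub_zero]
                  apply ofReal_le_ofReal
                  have := mul_le_mul_of_nonneg_left (hmL τ ⟨p1.le, hτT.2⟩) (by positivity : 0 ≤ K * τ ^ (-(1/2) : ℝ) * (2 / R))
                  linarith
        _ ≤ _ := by
            rw [lintegral_const_mul' _ _ ofReal_ne_top, lint_pow_left 0 s (1/2) hs0 (by norm_num), ← ofReal_mul (by positivity)]
            apply ofReal_le_ofReal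
            rw [sub_zero, show (1 - 1/2 : ℝ) = 1/2 by norm_num, ← Real.sqrt_eq_rpow, hRe]
            rw [div_le_iff₀ hr] at hn3
            have : 2 / (q * r0 d * √s) * K * L * (√s / (1/2)) = 4 * K * L / (q * r0 d) := by field_simp; ring
            rw [this, div_le_iff₀ (by positivity)]
            nlinarith
  rw [Real.norm_eq_abs] at up1 up2
  have u1 := (abs_le.1 up1).2
  have u2 := (abs_le.1 up2).2
  have fin : L - 2 * δ - 4 / c * (2 * δ) ≤ θ + L / 4 := by
    have h4c : 0 < 4 / c := by positivity
    have : 4 / c * (m s - X) ≤ 4 / c * (2 * δ) := by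
      apply mul_le_mul_of_nonneg_left _ h4c.le
      linarith [hmL s hsT]
    linarith
  have : 2 * δ + 4 / c * (2 * δ) = L / 4 := by
    rw [hδ]; field_simp; ring
  linarith
end Part10

section Part11
variable {d : ℕ}
variable {T N M : ℝ} {ρ : ℝ → Euc d → ℝ} {F : ℝ → Euc d → Euc d} {u : ℝ → Euc d → Euc d}

lemma Ge_le_two {t : ℝ} (ht : 0 < t) (x : Euc d) : Ge d t x ≤ ofReal (Cd d) * Ge d (2 * t) x := by
  unfold Ge Cd
  rw [← ofReal_mul (by positivity)]
  exact ofReal_le_ofReal (hk_le_two t ht x)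

lemma Hr_enorm_le {t : ℝ} (ht : 0 < t) {f : Euc d → ℝ} {g : Euc d → ℝ≥0∞} (hfg : ∀ y, ‖f y‖ₑ ≤ g y) (x : Euc d) :
    ‖Hr d t f x‖ₑ ≤ ofReal (Cd d) * He d (2 * t) g x := by
  unfold Hr He
  rw [← lintegral_const_mul' _ _ ofReal_ne_top]
  refine (enorm_integral_le_lintegral_enorm _).trans (lintegral_mono fun y => ?_)
  rw [enorm_mul, Real.enorm_of_nonneg (hk_nonneg t ht.le _), ← mul_assoc]
  exact mul_le_mul' (Ge_le_two ht _) (hfg y)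

lemma DH_enorm_le {t : ℝ} (ht : 0 < t) {f : Euc d → ℝ} {g : Euc d → ℝ≥0∞} (hfg : ∀ y, ‖f y‖ₑ ≤ g y) (x : Euc d) :
    ‖DH d t f x‖ₑ ≤ ofReal (Cd d * t ^ (-(1/2) : ℝ)) * He d (2 * t) g x := by
  unfold DH He
  rw [← lintegral_const_mul' _ _ ofReal_ne_top]
  refine (enorm_integral_le_lintegral_enorm _).trans (lintegral_mono fun y => ?_)
  rw [enorm_smul, mul_comm, ← mul_assoc]
  exact mul_le_mul' (gk_enorm_le t ht _) (hfg y)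

lemma He_self {t : ℝ} {f g : Euc d → ℝ≥0∞} (hf : Measurable f) (hg : Measurable g) :
    ∫⁻ x, f x * He d t g x = ∫⁻ x, g x * He d t f x := by
  unfold He
  have a1 : ∀ x, f x * ∫⁻ y, Ge d t (x - y) * g y = ∫⁻ y, f x * (Ge d t (x - y) * g y) := fun x => by
    rw [lintegral_const_mul _ (by fun_prop)]
  have a2 : ∀ x, g x * ∫⁻ y, Ge d t (x - y) * f y = ∫⁻ y, g x * (Ge d t (x - y) * f y) := fun x => by
    rw [lintegral_const_mul _ (by fun_prop)]
  simp_rw [a1, a2]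
  rw [lintegral_lintegral_swap (by fun_prop)]
  congr 1; ext x; congr 1; ext y
  rw [Ge_sub_comm]; ring

def Du (d : ℕ) (s t : ℝ) (f : ℝ → Euc d → ℝ≥0∞) (x : Euc d) : ℝ≥0∞ :=
  ∫⁻ τ in Ioo s t, ofReal ((t - τ) ^ (-(1/2) : ℝ)) * He d (2 * (t - τ)) (f τ) x

lemma Du_meas2 {f : ℝ → Euc d → ℝ≥0∞} (hf : Measurable (uncurry f)) (t : ℝ) :
    Measurable (fun p : Euc d × ℝ => ofReal ((t - p.2) ^ (-(1/2) : ℝ)) * He d (2 * (t - p.2)) (f p.2) p.1) := by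
  have hf' : Measurable (uncurry (fun (p : Euc d × ℝ) => f p.2)) :=
    hf.comp ((measurable_snd.comp measurable_fst).prodMk measurable_snd)
  exact Measurable.mul (by fun_prop) (He_meas (r := fun p : Euc d × ℝ => 2 * (t - p.2)) (f := fun p => f p.2) (x := fun p => p.1)
    (by fun_prop) hf' measurable_fst)

lemma Du_meas {f : ℝ → Euc d → ℝ≥0∞} (hf : Measurable (uncurry f)) (s t : ℝ) : Measurable (Du d s t f) :=
  Measurable.lintegral_prod_right' (Du_meas2 hf t)

lemma lint_Du {f : ℝ → Euc d → ℝ≥0∞} (hf : Measurable (uncurry f)) (s t : ℝ) {g : Euc d → ℝ≥0∞} (hg : Measurable g) :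
    ∫⁻ x, g x * Du d s t f x = ∫⁻ τ in Ioo s t, ofReal ((t - τ) ^ (-(1/2) : ℝ)) * ∫⁻ x, f τ x * He d (2 * (t - τ)) g x := by
  unfold Du
  have hm := Du_meas2 hf t
  have hs : ∀ x, Measurable (fun τ : ℝ => ofReal ((t - τ) ^ (-(1/2) : ℝ)) * He d (2 * (t - τ)) (f τ) x) :=
    fun x => hm.comp (measurable_prodMk_left (x := x))
  have hs' : ∀ τ, Measurable (fun x : Euc d => He d (2 * (t - τ)) (f τ) x) := fun τ => He_meas1 measurable_const (meas_slice hf τ) measurable_id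
  have a1 : ∀ x, g x * ∫⁻ τ in Ioo s t, ofReal ((t - τ) ^ (-(1/2) : ℝ)) * He d (2 * (t - τ)) (f τ) x
      = ∫⁻ τ in Ioo s t, g x * (ofReal ((t - τ) ^ (-(1/2) : ℝ)) * He d (2 * (t - τ)) (f τ) x) := fun x => by
    rw [lintegral_const_mul _ (hs x)]
  simp_rw [a1]
  rw [lintegral_lintegral_swap ((hg.comp measurable_fst).mul hm).aemeasurable]
  congr 1; ext τ
  rw [← He_self hg (meas_slice hf τ), ← lintegral_const_mul' _ _ ofReal_ne_top]
  congr 1; ext x; ring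

lemma Mild.ptw (h : Mild T N M ρ F) {s t : ℝ} (hs : 0 ≤ s) (hst : s < t) (hT : t ≤ T) :
    ∀ᵐ x, ‖ρ t x‖ₑ ≤ ofReal (Cd d) * (He d (2 * (t - s)) (fun y => ‖ρ s y‖ₑ) x + Du d s t (fun τ y => ‖F τ y‖ₑ) x) := by
  have hC := Cd_pos (d := d)
  have p0 : 0 < t - s := by linarith
  have hρm : ∀ t, Measurable (ρ t) := fun t => meas_slice h.ρm t
  have hρe : ∀ t, Measurable (fun y => ‖ρ t y‖ₑ) := fun t => (hρm t).enorm
  have hFe : Measurable (uncurry (fun τ y => ‖F τ y‖ₑ)) := h.Fm.enorm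
  have hHm : Measurable (He d (2 * (t - s)) (fun y => ‖ρ s y‖ₑ)) := He_meas1 measurable_const (hρe s) measurable_id
  have hDm := Du_meas hFe s t
  refine ae_le_of_forall_setLIntegral_le_of_sigmaFinite (hρe t) fun A hA _ => ?_
  set g : Euc d → ℝ≥0∞ := A.indicator 1 with hg
  have hgm : Measurable g := measurable_one.indicator hA
  set f : Euc d → ℝ := A.indicator (fun x => if 0 ≤ ρ t x then 1 else -1) with hf
  have hfm : Measurable f := (Measurable.ite (measurableSet_le measurable_const (hρm t)) measurable_const measurable_const).indicator hA
  have hf1 : ∀ x, |f x| ≤ 1 := by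
    intro x; rw [hf]; by_cases hx : x ∈ A
    · rw [Set.indicator_of_mem hx]; split_ifs <;> norm_num
    · rw [Set.indicator_of_notMem hx]; norm_num
  have hfg : ∀ x, ‖f x‖ₑ ≤ g x := by
    intro x; rw [hf, hg]; by_cases hx : x ∈ A
    · rw [Set.indicator_of_mem hx, Set.indicator_of_mem hx]; split_ifs <;> simp
    · rw [Set.indicator_of_notMem hx]; simp
  have hW := h.W hs hst hT hfm zero_le_one hf1
  have e1 : ∫⁻ x in A, ‖ρ t x‖ₑ = ofReal (∫ x, ρ t x * f x) := by
    have e2 : ∫ x, ρ t x * f x = ∫ x in A, ‖ρ t x‖ := by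
      rw [← integral_indicator hA]
      congr 1; ext x
      rw [hf]; by_cases hx : x ∈ A
      · rw [Set.indicator_of_mem hx, Set.indicator_of_mem hx, Real.norm_eq_abs]
        split_ifs with h0
        · rw [abs_of_nonneg h0, mul_one]
        · rw [abs_of_neg (not_le.1 h0), mul_neg_one]
      · rw [Set.indicator_of_notMem hx, Set.indicator_of_notMem hx, mul_zero]
    rw [e2]; exact (ofReal_integral_norm_eq_lintegral_enorm (h.int (hs.trans hst.le) hT).integrableOn).symm
  have e3 : ∀ G : Euc d → ℝ≥0∞, ∫⁻ x in A, G x = ∫⁻ x, g x * G x := by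
    intro G
    rw [← lintegral_indicator hA]
    congr 1; ext x; rw [hg]; by_cases hx : x ∈ A
    · rw [Set.indicator_of_mem hx, Set.indicator_of_mem hx, Pi.one_apply, one_mul]
    · rw [Set.indicator_of_notMem hx, Set.indicator_of_notMem hx, zero_mul]
  rw [e1, hW, lintegral_const_mul' _ _ ofReal_ne_top, e3]
  simp_rw [mul_add]
  rw [lintegral_add_left (show Measurable (fun x => g x * He d (2 * (t - s)) (fun y => ‖ρ s y‖ₑ) x) from hgm.mul hHm), lint_Du hFe s t hgm, He_self hgm (hρe s), mul_add]
  refine ofReal_add_le.trans (add_le_add ?_ ?_)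
  · rw [← lintegral_const_mul' _ _ ofReal_ne_top]
    refine (Real.ofReal_le_enorm _).trans ((enorm_integral_le_lintegral_enorm _).trans (lintegral_mono fun x => ?_))
    rw [enorm_mul]
    calc _ ≤ ‖ρ s x‖ₑ * (ofReal (Cd d) * He d (2 * (t - s)) g x) := mul_le_mul' le_rfl (Hr_enorm_le p0 hfg x)
      _ = _ := by ring
  · refine (Real.ofReal_le_enorm _).trans ((enorm_integral_le_lintegral_enorm _).trans ?_)
    have hm2 : Measurable (fun p : ℝ × Euc d => ‖(inner ℝ (F p.1 p.2) (DH d (t - p.1) f p.2) : ℝ)‖ₑ) :=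
      (Measurable.inner h.Fm (DH_meas1 hfm)).enorm
    rw [lint_St _ _ hm2, ← lintegral_const_mul' _ _ ofReal_ne_top]
    refine setLIntegral_mono' measurableSet_Ioo fun τ hτ => ?_
    have hτ' : 0 < t - τ := by linarith [hτ.2]
    rw [← lintegral_const_mul' _ _ ofReal_ne_top, ← lintegral_const_mul' _ _ ofReal_ne_top]
    refine lintegral_mono fun y => ?_
    dsimp only
    calc _ ≤ ‖F τ y‖ₑ * ‖DH d (t - τ) f y‖ₑ := by
          rw [← ofReal_norm, ← ofReal_norm, ← ofReal_norm, ← ofReal_mul (norm_nonneg _)]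
          exact ofReal_le_ofReal (norm_inner_le_norm _ _)
      _ ≤ ‖F τ y‖ₑ * (ofReal (Cd d * (t - τ) ^ (-(1/2) : ℝ)) * He d (2 * (t - τ)) g y) := mul_le_mul' le_rfl (DH_enorm_le hτ' hfg y)
      _ = _ := by rw [ofReal_mul hC.le]; ring
end Part11

section Part12
variable {d : ℕ}

def kp (d : ℕ) (α : ℝ) (z : Euc d) : ℝ≥0∞ := ‖z‖ₑ ^ (-α)

@[fun_prop]
lemma kp_meas (α : ℝ) : Measurable (kp d α) := by unfold kp; fun_prop

@[fun_prop]
lemma kp_meas_comp {β : Type*} [MeasurableSpace β] (α : ℝ) {g : β → Euc d} (hg : Measurable g) : Measurable (fun b => kp d α (g b)) :=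
  (kp_meas α).comp hg

lemma kp_neg (α : ℝ) (z : Euc d) : kp d α (-z) = kp d α z := by unfold kp; rw [enorm_neg]
lemma kp_comm (α : ℝ) (x y : Euc d) : kp d α (x - y) = kp d α (y - x) := by rw [← kp_neg, neg_sub]

lemma kp_real (α : ℝ) {z : Euc d} (hz : z ≠ 0) : kp d α z = ofReal (‖z‖ ^ (-α)) := by
  unfold kp
  rw [← ofReal_norm, ofReal_rpow_of_pos (norm_pos_iff.2 hz)]

lemma lint_scale {R : ℝ} (hR : 0 < R) {g : Euc d → ℝ≥0∞} (hg : Measurable g) :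
    ∫⁻ z, g z = ofReal (R ^ d) * ∫⁻ z, g (R • z) := by
  have h1 := Measure.map_addHaar_smul (volume : Measure (Euc d)) hR.ne'
  have h2 : ∫⁻ z, g (R • z) = ∫⁻ z, g z ∂(Measure.map (R • ·) volume) := by
    rw [lintegral_map hg (by fun_prop)]
  rw [h2, h1, lintegral_smul_measure, smul_eq_mul, ← mul_assoc, ← ofReal_mul (by positivity), finrank_euclideanSpace_fin,
    abs_of_pos (by positivity), mul_inv_cancel₀ (by positivity), ofReal_one, one_mul]

lemma kp_smul {R : ℝ} (hR : 0 < R) (α : ℝ) (z : Euc d) : kp d α (R • z) = ofReal (R ^ (-α)) * kp d α z := by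
  unfold kp
  rw [enorm_smul, Real.enorm_of_nonneg hR.le, ← ofReal_rpow_of_pos hR, ENNReal.mul_rpow_eq_ite, if_neg]
  have h0 : ofReal R ≠ 0 := by rw [ne_eq, ofReal_eq_zero, not_le]; exact hR
  rintro ⟨h | h, _⟩
  · exact h0 h.1
  · exact ofReal_ne_top h.1

def Kn (d : ℕ) (α : ℝ) : ℝ := (∫⁻ z in Metric.ball (0 : Euc d) 1, kp d α z).toReal
def Kf (d : ℕ) : ℝ := (∫⁻ z in (Metric.ball (0 : Euc d) 1)ᶜ, kp d (2 * d) z).toReal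

lemma Kn_nonneg (α : ℝ) : 0 ≤ Kn d α := ENNReal.toReal_nonneg
lemma Kf_nonneg : 0 ≤ Kf d := ENNReal.toReal_nonneg

lemma kp_near (hd : 1 ≤ d) {α : ℝ} (hα : α < d) {R : ℝ} (hR : 0 < R) :
    ∫⁻ z in Metric.ball (0 : Euc d) R, kp d α z = ofReal (Kn d α * R ^ (d - α)) := by
  have hfin : ∫⁻ z in Metric.ball (0 : Euc d) 1, kp d α z ≠ ⊤ := by
    have : IntegrableOn (fun z : Euc d => ‖z‖ ^ (-α)) (Metric.ball 0 1) := by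
      refine integrableOn_ball_of_norm_le_rpow (C := 1) (α := α) (by simpa using hd) (by simpa using hα) (ae_of_all _ fun x => ?_) (measurable_norm.pow_const (-α)).aestronglyMeasurable
      rw [one_mul, Real.norm_of_nonneg (by positivity)]
    refine ne_of_lt (lt_of_le_of_lt ?_ this.2)
    refine lintegral_mono_ae ?_
    have : ∀ᵐ z : Euc d, z ≠ 0 := by
      haveI : Nonempty (Fin d) := ⟨⟨0, hd⟩⟩
      exact Measure.ae_ne volume 0
    filter_upwards [ae_restrict_of_ae this] with z hz
    rw [kp_real α hz, ← ofReal_norm, Real.norm_of_nonneg (by positivity)]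
  rw [← lintegral_indicator measurableSet_ball, lint_scale hR ((kp_meas α).indicator measurableSet_ball)]
  have : ∀ z : Euc d, (Metric.ball (0 : Euc d) R).indicator (kp d α) (R • z) = ofReal (R ^ (-α)) * (Metric.ball (0 : Euc d) 1).indicator (kp d α) z := by
    intro z
    have hm : R • z ∈ Metric.ball (0 : Euc d) R ↔ z ∈ Metric.ball (0 : Euc d) 1 := by
      rw [mem_ball_zero_iff, mem_ball_zero_iff, norm_smul, Real.norm_of_nonneg hR.le]
      constructor <;> intro h <;> nlinarith
    by_cases h : z ∈ Metric.ball (0 : Euc d) 1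
    · rw [Set.indicator_of_mem h, Set.indicator_of_mem (hm.2 h), kp_smul hR]
    · rw [Set.indicator_of_notMem h, Set.indicator_of_notMem (fun h' => h (hm.1 h')), mul_zero]
  simp_rw [this]
  rw [lintegral_const_mul' _ _ ofReal_ne_top, lintegral_indicator measurableSet_ball]
  unfold Kn
  rw [mul_comm (ENNReal.toReal _), ofReal_mul (by positivity), ofReal_toReal hfin, ← mul_assoc, ← ofReal_mul (by positivity),
    ← Real.rpow_natCast, ← Real.rpow_add hR, sub_eq_add_neg]

lemma kp_far (hd : 1 ≤ d) {R : ℝ} (hR : 0 < R) :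
    ∫⁻ z in (Metric.ball (0 : Euc d) R)ᶜ, kp d (2 * d) z = ofReal (Kf d * R ^ (-d : ℝ)) := by
  have hd' : (1:ℝ) ≤ d := by exact_mod_cast hd
  have hfin : ∫⁻ z in (Metric.ball (0 : Euc d) 1)ᶜ, kp d (2 * d) z ≠ ⊤ := by
    have h1 := finite_integral_one_add_norm (E := Euc d) (μ := volume) (r := 2 * d) (by rw [finrank_euclideanSpace_fin]; linarith)
    refine ne_of_lt (lt_of_le_of_lt ?_ (ENNReal.mul_lt_top (ofReal_lt_top (r := 2 ^ (2 * d : ℝ))) h1))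
    rw [← lintegral_const_mul' _ _ ofReal_ne_top]
    refine (setLIntegral_mono' measurableSet_ball.compl fun z hz => ?_).trans (setLIntegral_le_lintegral _ _)
    have hz1 : 1 ≤ ‖z‖ := by simpa using hz
    have hz0 : 0 < ‖z‖ := by linarith
    rw [kp_real _ (norm_pos_iff.1 hz0), ← ofReal_mul (by positivity)]
    apply ofReal_le_ofReal
    rw [Real.rpow_neg (by positivity), Real.rpow_neg (by positivity), ← div_eq_mul_inv, ← Real.div_rpow (by norm_num) (by positivity), ← Real.inv_rpow (by positivity)]
    refine Real.rpow_le_rpow (by positivity) ?_ (by positivity)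
    rw [inv_eq_one_div, div_le_div_iff₀ hz0 (by positivity)]; linarith
  rw [← lintegral_indicator measurableSet_ball.compl, lint_scale hR ((kp_meas _).indicator measurableSet_ball.compl)]
  have : ∀ z : Euc d, (Metric.ball (0 : Euc d) R)ᶜ.indicator (kp d (2 * d)) (R • z) = ofReal (R ^ (-(2 * d) : ℝ)) * (Metric.ball (0 : Euc d) 1)ᶜ.indicator (kp d (2 * d)) z := by
    intro z
    have hm : R • z ∈ (Metric.ball (0 : Euc d) R)ᶜ ↔ z ∈ (Metric.ball (0 : Euc d) 1)ᶜ := by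
      rw [Set.mem_compl_iff, Set.mem_compl_iff, mem_ball_zero_iff, mem_ball_zero_iff, norm_smul, Real.norm_of_nonneg hR.le, not_iff_not]
      constructor <;> intro h <;> nlinarith
    by_cases h : z ∈ (Metric.ball (0 : Euc d) 1)ᶜ
    · rw [Set.indicator_of_mem h, Set.indicator_of_mem (hm.2 h), kp_smul hR]
    · rw [Set.indicator_of_notMem h, Set.indicator_of_notMem (fun h' => h (hm.1 h')), mul_zero]
  simp_rw [this]
  rw [lintegral_const_mul' _ _ ofReal_ne_top, lintegral_indicator measurableSet_ball.compl]
  unfold Kf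
  rw [mul_comm (ENNReal.toReal _), ofReal_mul (by positivity), ofReal_toReal hfin, ← mul_assoc, ← ofReal_mul (by positivity),
    ← Real.rpow_natCast, ← Real.rpow_add hR]
  congr 4; ring

def Ck (d : ℕ) (α : ℝ) : ℝ := Kn d α + 1

lemma Ck_pos (α : ℝ) : 0 < Ck d α := by unfold Ck; linarith [Kn_nonneg (d := d) α]

lemma hk_le' {r : ℝ} (hr : 0 < r) (x : Euc d) : heatKernel d r x ≤ r ^ (-(d:ℝ)/2) := by
  refine (hk_le r hr x).trans ?_
  refine Real.rpow_le_rpow_of_nonpos hr ?_ (by rw [neg_div]; exact neg_nonpos.2 (by positivity))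
  nlinarith [Real.pi_gt_three]

lemma He_kp0 (hd : 1 ≤ d) {α : ℝ} (hα0 : 0 ≤ α) (hα : α < d) {r : ℝ} (hr : 0 < r) (x : Euc d) :
    He d r (kp d α) x ≤ ofReal (Ck d α * r ^ (-(α/2))) := by
  have hs : 0 < √r := Real.sqrt_pos.2 hr
  unfold He
  calc _ ≤ ∫⁻ y, ((Metric.ball (0 : Euc d) (√r)).indicator (fun y => ofReal (r ^ (-(d:ℝ)/2)) * kp d α y) y + Ge d r (x - y) * ofReal (r ^ (-(α/2)))) := by
        refine lintegral_mono fun y => ?_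
        by_cases hy : y ∈ Metric.ball (0 : Euc d) (√r)
        · rw [Set.indicator_of_mem hy]
          refine le_add_right (mul_le_mul' ?_ le_rfl)
          exact ofReal_le_ofReal (hk_le' hr _)
        · refine le_add_left (mul_le_mul' le_rfl ?_)
          have hy' : √r ≤ ‖y‖ := by simpa using hy
          rw [kp_real _ (norm_pos_iff.1 (hs.trans_le hy'))]
          apply ofReal_le_ofReal
          calc _ ≤ (√r) ^ (-α) := Real.rpow_le_rpow_of_nonpos hs hy' (by linarith)
            _ = _ := by rw [Real.sqrt_eq_rpow, ← Real.rpow_mul hr.le]; congr 1; ring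
    _ = ofReal (r ^ (-(d:ℝ)/2)) * ofReal (Kn d α * √r ^ (d - α)) + ofReal (r ^ (-(α/2))) := by
        rw [lintegral_add_right _ (by fun_prop), lintegral_indicator measurableSet_ball, lintegral_const_mul' _ _ ofReal_ne_top, kp_near hd hα hs,
          lintegral_mul_const' _ _ ofReal_ne_top, lint_Ge_sub r hr, one_mul]
    _ = _ := by
        have := Kn_nonneg (d := d) α
        rw [← ofReal_mul (by positivity), ← ofReal_add (by positivity) (by positivity)]
        congr 1
        have e : r ^ (-(d:ℝ)/2) * √r ^ (d - α) = r ^ (-(α/2)) := by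
          rw [Real.sqrt_eq_rpow, ← Real.rpow_mul hr.le, ← Real.rpow_add hr]; congr 1; ring
        unfold Ck
        rw [add_mul, one_mul, ← e]; ring

lemma hk_mom {β r : ℝ} (hβ0 : 0 ≤ β) (hβ : β ≤ 1) (hr : 0 < r) (w : Euc d) :
    ‖w‖ₑ ^ β * Ge d r w ≤ ofReal (3 * Cd d * r ^ (β/2)) * Ge d (2 * r) w := by
  have hs : 0 < √r := Real.sqrt_pos.2 hr
  have hC := Cd_pos (d := d)
  have hG : 0 ≤ heatKernel d (2 * r) w := hk_nonneg _ (by positivity) _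
  have hG1 : 0 ≤ heatKernel d r w := hk_nonneg _ hr.le _
  unfold Ge
  rw [← ofReal_norm, ofReal_rpow_of_nonneg (norm_nonneg _) hβ0, ← ofReal_mul (by positivity), ← ofReal_mul (by positivity)]
  apply ofReal_le_ofReal
  have h1 : ‖w‖ ^ β ≤ r ^ (β/2) * (1 + ‖w‖ / √r) := by
    have h2 : (‖w‖ / √r) ^ β ≤ 1 + ‖w‖ / √r := by
      have p : 0 ≤ ‖w‖ / √r := by positivity
      rcases le_total (‖w‖ / √r) 1 with h | h
      · exact (Real.rpow_le_one p h hβ0).trans (by linarith)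
      · calc _ ≤ (‖w‖ / √r) ^ (1:ℝ) := Real.rpow_le_rpow_of_exponent_le h hβ
          _ ≤ _ := by rw [Real.rpow_one]; linarith
    have h3 : (√r) ^ β = r ^ (β/2) := by rw [Real.sqrt_eq_rpow, ← Real.rpow_mul hr.le]; congr 1; ring
    rw [Real.div_rpow (norm_nonneg _) hs.le, div_le_iff₀ (by positivity), h3] at h2
    linarith
  have h4 : heatKernel d r w ≤ Cd d * heatKernel d (2 * r) w := hk_le_two r hr w
  have h5 : ‖w‖ / √r * heatKernel d r w ≤ 2 * Cd d * heatKernel d (2 * r) w := by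
    have := gk_enorm_le r hr w
    unfold Ge at this
    rw [← ofReal_norm, ← ofReal_mul (by positivity), ofReal_le_ofReal_iff (by positivity)] at this
    unfold gk at this
    rw [norm_smul, Real.norm_eq_abs, abs_mul, abs_of_nonneg hG1, abs_neg, abs_of_pos (by positivity), Real.rpow_neg hr.le, ← Real.sqrt_eq_rpow] at this
    have hrr : √r * √r = r := Real.mul_self_sqrt hr.le
    calc _ = 2 * √r * (1 / (2 * r) * heatKernel d r w * ‖w‖) := by
          rw [div_mul_eq_mul_div, div_eq_iff hs.ne']; rw [show 2 * √r * (1 / (2 * r) * heatKernel d r w * ‖w‖) * √r = (√r * √r) * (1 / r) * (‖w‖ * heatKernel d r w) by ring, hrr]; field_simp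
      _ ≤ 2 * √r * (Cd d * (√r)⁻¹ * heatKernel d (2 * r) w) := by gcongr
      _ = _ := by field_simp
  calc _ ≤ r ^ (β/2) * (1 + ‖w‖ / √r) * heatKernel d r w := mul_le_mul_of_nonneg_right h1 hG1
    _ = r ^ (β/2) * (heatKernel d r w + ‖w‖ / √r * heatKernel d r w) := by ring
    _ ≤ r ^ (β/2) * (3 * Cd d * heatKernel d (2 * r) w) := by gcongr; linarith
    _ = _ := by ring

def Ck' (d : ℕ) (α β : ℝ) : ℝ := 3 * Cd d * Ck d α + Ck d (α - β)

lemma Ck'_pos (α β : ℝ) : 0 < Ck' d α β := by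
  have := Cd_pos (d := d); have := Ck_pos (d := d) α; have := Ck_pos (d := d) (α - β); unfold Ck'; positivity

lemma He_kp (hd : 1 ≤ d) {α β : ℝ} (hβ0 : 0 < β) (hβ : β ≤ 1) (hβα : β ≤ α) (hα : α < d) {r : ℝ} (hr : 0 < r) (x : Euc d) :
    He d r (kp d α) x ≤ ofReal (Ck' d α β * r ^ (-((α-β)/2))) * kp d β x := by
  have hC' := Ck'_pos (d := d) α β
  have hC := Cd_pos (d := d)
  have hC1 := Ck_pos (d := d) α
  have hC2 := Ck_pos (d := d) (α - β)
  by_cases hx : x = 0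
  · subst hx
    unfold kp
    rw [enorm_zero, ENNReal.zero_rpow_of_neg (by linarith), ENNReal.mul_top (by rw [ne_eq, ofReal_eq_zero, not_le]; positivity)]
    exact le_top
  have hx0 : ‖x‖ₑ ^ β ≠ 0 := (ENNReal.rpow_pos (enorm_pos.2 hx) enorm_ne_top).ne'
  have hxt : ‖x‖ₑ ^ β ≠ ⊤ := ENNReal.rpow_ne_top_of_nonneg hβ0.le enorm_ne_top
  have key : ‖x‖ₑ ^ β * He d r (kp d α) x ≤ ofReal (Ck' d α β * r ^ (-((α-β)/2))) := by
    unfold He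
    rw [← lintegral_const_mul' _ _ hxt]
    calc _ ≤ ∫⁻ y, (ofReal (3 * Cd d * r ^ (β/2)) * (Ge d (2 * r) (x - y) * kp d α y) + Ge d r (x - y) * kp d (α - β) y) := by
          refine lintegral_mono fun y => ?_
          have h1 : ‖x‖ₑ ^ β ≤ ‖x - y‖ₑ ^ β + ‖y‖ₑ ^ β := by
            refine le_trans (ENNReal.rpow_le_rpow ?_ hβ0.le) (ENNReal.rpow_add_le_add_rpow _ _ hβ0.le hβ)
            calc ‖x‖ₑ = ‖(x - y) + y‖ₑ := by rw [sub_add_cancel]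
              _ ≤ _ := enorm_add_le _ _
          have h2 : ‖y‖ₑ ^ β * kp d α y ≤ kp d (α - β) y := by
            by_cases hy : y = 0
            · subst hy; rw [enorm_zero, ENNReal.zero_rpow_of_pos hβ0, zero_mul]; exact zero_le
            · unfold kp
              rw [← ENNReal.rpow_add _ _ (enorm_ne_zero.2 hy) enorm_ne_top]
              apply le_of_eq; congr 1; ring
          calc _ ≤ (‖x - y‖ₑ ^ β + ‖y‖ₑ ^ β) * (Ge d r (x - y) * kp d α y) := mul_le_mul' h1 le_rfl
            _ = (‖x - y‖ₑ ^ β * Ge d r (x - y)) * kp d α y + Ge d r (x - y) * (‖y‖ₑ ^ β * kp d α y) := by ring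
            _ ≤ _ := by
                rw [← mul_assoc (ofReal _)]
                exact add_le_add (mul_le_mul' (hk_mom hβ0.le hβ hr _) le_rfl) (mul_le_mul' le_rfl h2)
      _ = ofReal (3 * Cd d * r ^ (β/2)) * He d (2 * r) (kp d α) x + He d r (kp d (α - β)) x := by
          rw [lintegral_add_right _ (by fun_prop), lintegral_const_mul' _ _ ofReal_ne_top]; rfl
      _ ≤ ofReal (3 * Cd d * r ^ (β/2)) * ofReal (Ck d α * (2 * r) ^ (-(α/2))) + ofReal (Ck d (α - β) * r ^ (-((α-β)/2))) :=
          add_le_add (mul_le_mul' le_rfl (He_kp0 hd (by linarith) hα (by positivity) x)) (He_kp0 hd (by linarith) (by linarith) hr x)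
      _ ≤ _ := by
          rw [← ofReal_mul (by positivity), ← ofReal_add (by positivity) (by positivity)]
          apply ofReal_le_ofReal
          have e1 : (2 * r) ^ (-(α/2)) ≤ r ^ (-(α/2)) := Real.rpow_le_rpow_of_nonpos hr (by linarith) (by linarith)
          have e2 : r ^ (β/2) * r ^ (-(α/2)) = r ^ (-((α-β)/2)) := by rw [← Real.rpow_add hr]; congr 1; ring
          unfold Ck'
          calc _ ≤ 3 * Cd d * r ^ (β/2) * (Ck d α * r ^ (-(α/2))) + Ck d (α - β) * r ^ (-((α-β)/2)) := by gcongr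
            _ = _ := by rw [← e2]; ring
  calc _ = (‖x‖ₑ ^ β)⁻¹ * (‖x‖ₑ ^ β * He d r (kp d α) x) := by rw [← mul_assoc, ENNReal.inv_mul_cancel hx0 hxt, one_mul]
    _ ≤ (‖x‖ₑ ^ β)⁻¹ * ofReal (Ck' d α β * r ^ (-((α-β)/2))) := mul_le_mul' le_rfl key
    _ = _ := by rw [mul_comm]; unfold kp; rw [ENNReal.rpow_neg]

def Pt (d : ℕ) (α : ℝ) (f : Euc d → ℝ≥0∞) (x : Euc d) : ℝ≥0∞ := ∫⁻ y, kp d α (x - y) * f y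

lemma Pt_meas (α : ℝ) {f : ℝ → Euc d → ℝ≥0∞} (hf : Measurable (uncurry f)) : Measurable (uncurry fun t => Pt d α (f t)) := by
  unfold Pt
  have hf' : Measurable (fun q : (ℝ × Euc d) × Euc d => f q.1.1 q.2) := hf.comp (by fun_prop : Measurable (fun q : (ℝ × Euc d) × Euc d => (q.1.1, q.2)))
  exact Measurable.lintegral_prod_right' (f := fun q : (ℝ × Euc d) × Euc d => kp d α (q.1.2 - q.2) * f q.1.1 q.2) (Measurable.mul (by fun_prop) hf')

lemma Pt_meas1 (α : ℝ) {f : Euc d → ℝ≥0∞} (hf : Measurable f) : Measurable (Pt d α f) := by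
  unfold Pt
  exact Measurable.lintegral_prod_right' (f := fun q : Euc d × Euc d => kp d α (q.1 - q.2) * f q.2) (by fun_prop)

lemma Pt_He (α r : ℝ) {f : Euc d → ℝ≥0∞} (hf : Measurable f) (x : Euc d) :
    Pt d α (He d r f) x = ∫⁻ z, He d r (kp d α) (x - z) * f z := by
  unfold Pt
  have h1 := He_self (t := r) (f := fun y => kp d α (x - y)) (g := f) (by fun_prop) hf
  rw [h1]
  congr 1; ext z
  rw [mul_comm]; congr 1
  unfold He
  rw [← lintegral_sub_left_eq_self _ x]
  congr 1; ext y
  dsimp only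
  rw [sub_sub_cancel, show z - (x - y) = -(x - z - y) by abel, Ge_neg]
end Part12

section Part13
variable {d : ℕ}

def Ch (d : ℕ) : ℝ := Kn d 1 + 1 + Kf d

lemma Ch_pos : 0 < Ch d := by unfold Ch; linarith [Kn_nonneg (d := d) 1, Kf_nonneg (d := d)]

lemma young_aux {e n : ℝ} (he : 0 < e) (hn : 0 < n) (hen : e * n = 1) {f k ε : ℝ≥0∞} (h0 : ε ≠ 0) (ht : ε ≠ ⊤) :
    k * f ≤ ε * f ^ (1 + e) + ε ^ (-n) * k ^ (n + 1) := by
  rcases le_or_gt k (ε * f ^ e) with h | h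
  · refine le_add_right ?_
    calc k * f ≤ ε * f ^ e * f := mul_le_mul' h le_rfl
      _ = ε * f ^ (1 + e) := by
          rw [add_comm, ENNReal.rpow_add_of_nonneg _ _ he.le zero_le_one, ENNReal.rpow_one, mul_assoc]
  · refine le_add_left ?_
    have h1 : f ≤ ε ^ (-n) * k ^ n := by
      calc f = (f ^ e) ^ n := by rw [← ENNReal.rpow_mul, hen, ENNReal.rpow_one]
        _ ≤ (ε⁻¹ * k) ^ n := by
            refine ENNReal.rpow_le_rpow ?_ hn.le
            calc f ^ e = ε⁻¹ * (ε * f ^ e) := by rw [← mul_assoc, ENNReal.inv_mul_cancel h0 ht, one_mul]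
              _ ≤ _ := mul_le_mul' le_rfl h.le
        _ = _ := by rw [ENNReal.mul_rpow_of_nonneg _ _ hn.le, ENNReal.inv_rpow, ENNReal.rpow_neg]
    calc k * f ≤ k * (ε ^ (-n) * k ^ n) := mul_le_mul' le_rfl h1
      _ = _ := by rw [ENNReal.rpow_add_of_nonneg _ _ hn.le zero_le_one, ENNReal.rpow_one]; ring

def qr (d : ℕ) : ℝ := 1 + 1 / (2 * d - 1)

lemma hls_pt (hd : 2 ≤ d) {f : Euc d → ℝ≥0∞} (hf : Measurable f) (hq : ∫⁻ x, f x ^ qr d ≤ 1) (x : Euc d) (hx : f x ≠ ⊤) :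
    f x * ∫⁻ y, (if f y ≤ f x then kp d 1 (x - y) * f y else 0) ≤ ofReal (Ch d) * f x ^ qr d := by
  by_cases hx0 : f x = 0
  · rw [hx0, zero_mul]; exact zero_le
  have hd' : (2:ℝ) ≤ d := by exact_mod_cast hd
  have hd1 : 1 ≤ d := by omega
  set a := (f x).toReal with ha
  have ha0 : 0 < a := ENNReal.toReal_pos hx0 hx
  have hfa : f x = ofReal a := (ofReal_toReal hx).symm
  set e : ℝ := 1 / (2 * d - 1) with he
  have hn0 : (0:ℝ) < 2 * d - 1 := by linarith
  have he0 : 0 < e := by positivity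
  have hen : e * (2 * d - 1) = 1 := by rw [he]; field_simp
  set R := a ^ (-(2 * e)) with hR
  have hR0 : 0 < R := by positivity
  have hK1 := Kn_nonneg (d := d) 1
  have hK2 := Kf_nonneg (d := d)
  have key : ∫⁻ y, (if f y ≤ f x then kp d 1 (x - y) * f y else 0) ≤ ofReal (Ch d * a ^ e) := by
    rw [← lintegral_sub_left_eq_self _ x]
    calc _ ≤ ∫⁻ z, ((Metric.ball (0 : Euc d) R).indicator (fun z => ofReal a * kp d 1 z) z +
            (ofReal (a ^ e) * f (x - z) ^ qr d + (Metric.ball (0 : Euc d) R)ᶜ.indicator (fun z => ofReal (a⁻¹) * kp d (2 * d) z) z)) := by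
          refine lintegral_mono fun z => ?_
          dsimp only
          split_ifs with hz
          swap
          · exact zero_le
          rw [sub_sub_cancel]
          by_cases hz1 : z ∈ Metric.ball (0 : Euc d) R
          · rw [Set.indicator_of_mem hz1]
            refine le_add_right ?_
            rw [mul_comm, ← hfa]; exact mul_le_mul' hz le_rfl
          · rw [Set.indicator_of_notMem hz1, zero_add, Set.indicator_of_mem (Set.mem_compl hz1)]
            have := young_aux he0 hn0 hen (f := f (x - z)) (k := kp d 1 z) (ε := ofReal (a ^ e))
              (by rw [ne_eq, ofReal_eq_zero, not_le]; positivity) ofReal_ne_top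
            refine this.trans (le_of_eq ?_)
            congr 1
            congr 1
            · rw [ofReal_rpow_of_pos (by positivity), ← Real.rpow_mul ha0.le, mul_neg, hen, Real.rpow_neg_one]
            · unfold kp; rw [← ENNReal.rpow_mul]; congr 1; ring
      _ = ofReal a * ofReal (Kn d 1 * R ^ ((d:ℝ) - 1)) + (ofReal (a ^ e) * (∫⁻ x, f x ^ qr d) + ofReal (a⁻¹) * ofReal (Kf d * R ^ (-d : ℝ))) := by
          rw [lintegral_add_left (by fun_prop (disch := exact measurableSet_ball)), lintegral_add_right _ (by fun_prop (disch := exact measurableSet_ball.compl)), lintegral_indicator measurableSet_ball,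
            lintegral_indicator measurableSet_ball.compl, lintegral_const_mul' _ _ ofReal_ne_top, lintegral_const_mul' _ _ ofReal_ne_top,
            lintegral_const_mul' _ _ ofReal_ne_top, kp_near hd1 (by linarith) hR0, kp_far hd1 hR0, lintegral_sub_left_eq_self (fun y => f y ^ qr d) x]
      _ ≤ ofReal a * ofReal (Kn d 1 * R ^ ((d:ℝ) - 1)) + (ofReal (a ^ e) * 1 + ofReal (a⁻¹) * ofReal (Kf d * R ^ (-d : ℝ))) := by
          gcongr
      _ = _ := by
          rw [mul_one, ← ofReal_mul ha0.le, ← ofReal_mul (by positivity), ← ofReal_add (by positivity) (by positivity), ← ofReal_add (by positivity) (by positivity)]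
          congr 1
          have e1 : a * R ^ ((d:ℝ) - 1) = a ^ e := by
            rw [hR, ← Real.rpow_mul ha0.le]
            nth_rw 1 [← Real.rpow_one a]
            rw [← Real.rpow_add ha0]; congr 1
            linarith
          have e2 : a⁻¹ * R ^ (-d : ℝ) = a ^ e := by
            rw [hR, ← Real.rpow_mul ha0.le, ← Real.rpow_neg_one, ← Real.rpow_add ha0]; congr 1
            linarith
          unfold Ch
          calc _ = Kn d 1 * (a * R ^ ((d:ℝ) - 1)) + (a ^ e + Kf d * (a⁻¹ * R ^ (-d : ℝ))) := by ring
            _ = _ := by rw [e1, e2]; ring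
  refine (mul_le_mul' le_rfl key).trans (le_of_eq ?_)
  have := Ch_pos (d := d)
  rw [hfa, ofReal_rpow_of_pos ha0, ← ofReal_mul ha0.le, ← ofReal_mul this.le]
  congr 1
  unfold qr
  rw [Real.rpow_add ha0, Real.rpow_one]; ring

lemma hls (hd : 2 ≤ d) {f : Euc d → ℝ≥0∞} (hf : Measurable f) (hq : ∫⁻ x, f x ^ qr d ≤ 1) :
    ∫⁻ x, f x * Pt d 1 f x ≤ ofReal (2 * Ch d) := by
  have hq0 : 0 < qr d := by
    have hd' : (2:ℝ) ≤ d := by exact_mod_cast hd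
    have : (0:ℝ) < 2 * d - 1 := by linarith
    unfold qr; positivity
  have hC := Ch_pos (d := d)
  have hfin : ∀ᵐ x, f x ≠ ⊤ := by
    filter_upwards [ae_lt_top (by fun_prop) (ne_of_lt (hq.trans_lt ENNReal.one_lt_top))] with x hx h
    rw [h, ENNReal.top_rpow_of_pos hq0] at hx
    exact lt_irrefl _ hx
  set k : Euc d → Euc d → ℝ≥0∞ := fun x y => f x * (if f y ≤ f x then kp d 1 (x - y) * f y else 0) with hk
  have hkm : Measurable (fun p : Euc d × Euc d => k p.1 p.2) := by
    refine Measurable.mul (by fun_prop) (Measurable.ite (measurableSet_le (by fun_prop) (by fun_prop)) (by fun_prop) measurable_const)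
  have hkm1 : ∀ x, Measurable (fun y => if f y ≤ f x then kp d 1 (x - y) * f y else 0) := fun x =>
    Measurable.ite (measurableSet_le hf measurable_const) (by fun_prop) measurable_const
  have h1 : ∫⁻ x, ∫⁻ y, k x y ≤ ofReal (Ch d) := by
    calc _ = ∫⁻ x, f x * ∫⁻ y, (if f y ≤ f x then kp d 1 (x - y) * f y else 0) := by
          congr 1; ext x; rw [← lintegral_const_mul _ (hkm1 x)]
      _ ≤ ∫⁻ x, ofReal (Ch d) * f x ^ qr d := by
          refine lintegral_mono_ae ?_
          filter_upwards [hfin] with x hx using hls_pt hd hf hq x hx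
      _ ≤ ofReal (Ch d) * 1 := by
          rw [lintegral_const_mul' _ _ ofReal_ne_top]; exact mul_le_mul' le_rfl hq
      _ = _ := mul_one _
  have h2 : ∫⁻ x, ∫⁻ y, k y x = ∫⁻ x, ∫⁻ y, k x y := by
    rw [lintegral_lintegral_swap (f := fun x y => k y x) (hkm.comp measurable_swap).aemeasurable]
  calc _ ≤ ∫⁻ x, ∫⁻ y, (k x y + k y x) := by
        refine lintegral_mono fun x => ?_
        unfold Pt
        dsimp only
        rw [← lintegral_const_mul _ (by fun_prop)]
        refine lintegral_mono fun y => ?_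
        rw [hk]; dsimp only
        rcases le_total (f y) (f x) with h | h
        · rw [if_pos h]; exact le_add_right le_rfl
        · rw [if_pos h]; refine le_add_left (le_of_eq ?_)
          rw [kp_comm]; ring
    _ = (∫⁻ x, ∫⁻ y, k x y) + ∫⁻ x, ∫⁻ y, k y x := by
        rw [← lintegral_add_left (Measurable.lintegral_prod_right' hkm)]
        congr 1; ext x
        rw [lintegral_add_left (show Measurable (fun y => k x y) from hkm.comp (measurable_prodMk_left (x := x)))]
    _ ≤ ofReal (Ch d) + ofReal (Ch d) := by rw [h2]; exact add_le_add h1 h1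
    _ = _ := by rw [← ofReal_add hC.le hC.le, two_mul]
end Part13

section Part14
variable {d : ℕ}
variable {T N M : ℝ} {ρ : ℝ → Euc d → ℝ} {F : ℝ → Euc d → Euc d}

lemma He_trans (r : ℝ) (k : Euc d → ℝ≥0∞) (x z : Euc d) : He d r (fun y => k (y - x)) z = He d r k (z - x) := by
  unfold He
  rw [← lintegral_add_right_eq_self _ x]
  simp only [add_sub_cancel_right, sub_sub, add_comm x]

lemma He_Pt (α r : ℝ) {g : Euc d → ℝ≥0∞} (hg : Measurable g) (z : Euc d) :
    He d r (Pt d α g) z = ∫⁻ y, He d r (kp d α) (z - y) * g y := by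
  have := He_lint (d := d) volume r (f := fun a y => kp d α (y - a) * g a) (by simp only [Function.uncurry_def]; fun_prop) z
  unfold Pt
  rw [this]
  congr 1; ext a
  rw [← He_trans, mul_comm, ← He_smul _ (by fun_prop)]
  simp only [mul_comm]

lemma Mild.test2 (h : Mild T N M ρ F) {s t : ℝ} (hs : 0 ≤ s) (hst : s < t) (hT : t ≤ T) {w v : Euc d → ℝ≥0∞} (hw : Measurable w)
    {B γ E0 E : ℝ} (hB : 0 ≤ B) (hγ0 : 0 ≤ γ) (hγ : γ < 1/2) (h0 : 0 ≤ E0) (h1 : 0 ≤ E)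
    (hHe : ∀ r, 0 < r → ∀ y, He d r w y ≤ ofReal (B * r ^ (-γ)) * v y)
    (hE0 : ∫⁻ x, ‖ρ s x‖ₑ * v x ≤ ofReal E0) (hE : ∀ τ ∈ Ioo s t, ∫⁻ x, ‖F τ x‖ₑ * v x ≤ ofReal E) :
    ∫⁻ x, w x * ‖ρ t x‖ₑ ≤ ofReal (Cd d * B * ((t - s) ^ (-γ) * E0 + (t - s) ^ (1/2 - γ) / (1/2 - γ) * E)) := by
  have hC := Cd_pos (d := d)
  have hts : 0 < t - s := by linarith
  have hg2 : 0 < 1/2 - γ := by linarith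
  have hHe' : ∀ r, 0 < r → ∀ y, He d (2 * r) w y ≤ ofReal (B * r ^ (-γ)) * v y := fun r hr y => by
    refine (hHe (2 * r) (by positivity) y).trans (mul_le_mul' (ofReal_le_ofReal ?_) le_rfl)
    exact mul_le_mul_of_nonneg_left (Real.rpow_le_rpow_of_nonpos hr (by linarith) (by linarith)) hB
  have hmm : ∀ τ, Measurable (fun y => ‖ρ τ y‖ₑ) := fun τ => (meas_slice h.ρm τ).enorm
  have hfm : Measurable (uncurry (fun τ y => ‖F τ y‖ₑ)) := h.Fm.enorm
  have hfτ : ∀ τ, Measurable (fun y => ‖F τ y‖ₑ) := fun τ => (meas_slice h.Fm τ).enorm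
  have gen : ∀ (r : ℝ) (hr : 0 < r) (f : Euc d → ℝ≥0∞) (e : ℝ), 0 ≤ e → ∫⁻ x, f x * v x ≤ ofReal e →
      ∫⁻ x, f x * He d (2 * r) w x ≤ ofReal (B * r ^ (-γ) * e) := fun r hr f e he hf => by
    rw [ofReal_mul (by positivity)]
    refine le_trans ?_ (mul_le_mul' le_rfl hf)
    rw [← lintegral_const_mul' _ _ ofReal_ne_top]
    refine lintegral_mono fun x => ?_
    refine (mul_le_mul' le_rfl (hHe' r hr x)).trans (le_of_eq ?_)
    ring
  calc ∫⁻ x, w x * ‖ρ t x‖ₑ ≤ ∫⁻ x, ofReal (Cd d) * (w x * He d (2 * (t - s)) (fun y => ‖ρ s y‖ₑ) x + w x * Du d s t (fun τ y => ‖F τ y‖ₑ) x) := by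
        refine lintegral_mono_ae ?_
        filter_upwards [h.ptw hs hst hT] with x hx
        refine (mul_le_mul' le_rfl hx).trans (le_of_eq ?_)
        ring
    _ = ofReal (Cd d) * ((∫⁻ x, ‖ρ s x‖ₑ * He d (2 * (t - s)) w x) + ∫⁻ τ in Ioo s t, ofReal ((t - τ) ^ (-(1/2) : ℝ)) * ∫⁻ x, ‖F τ x‖ₑ * He d (2 * (t - τ)) w x) := by
        rw [lintegral_const_mul' _ _ ofReal_ne_top, lintegral_add_right _ (show Measurable (fun x => w x * Du d s t (fun τ y => ‖F τ y‖ₑ) x) from hw.mul (Du_meas hfm s t)), lint_Du hfm s t hw, He_self hw (hmm s)]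
    _ ≤ ofReal (Cd d) * (ofReal (B * (t - s) ^ (-γ) * E0) + ofReal (B * E * ((t - s) ^ (1/2 - γ) / (1/2 - γ)))) := by
        refine mul_le_mul' le_rfl (add_le_add (gen _ hts _ _ h0 hE0) ?_)
        calc _ ≤ ∫⁻ τ in Ioo s t, ofReal (B * E) * ofReal ((t - τ) ^ (-(1/2 + γ))) := by
              refine setLIntegral_mono' measurableSet_Ioo fun τ hτ => ?_
              have p2 : 0 < t - τ := by linarith [hτ.2]
              refine (mul_le_mul' le_rfl (gen _ p2 _ _ h1 (hE τ hτ))).trans (le_of_eq ?_)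
              rw [← ofReal_mul (by positivity), ← ofReal_mul (by positivity), neg_add, Real.rpow_add p2]
              congr 1; ring
          _ = _ := by
              rw [lintegral_const_mul' _ _ ofReal_ne_top, lint_pow_right s t (1/2 + γ) hst (by linarith), ← ofReal_mul (by positivity),
                show 1 - (1/2 + γ) = 1/2 - γ by ring]
    _ = _ := by
        rw [← ofReal_add (by positivity) (by positivity), ← ofReal_mul hC.le]
        congr 1; ring

lemma Mild.sp (h : Mild T N M ρ F) {t : ℝ} (ht : 0 < t) (hT : t ≤ T) {w v : Euc d → ℝ≥0∞} (hw : Measurable w)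
    {B γ e E0 E : ℝ} (hB : 0 ≤ B) (hγ0 : 0 ≤ γ) (hγ : γ < 1/2) (he : 0 ≤ e) (h0 : 0 ≤ E0) (h1 : 0 ≤ E)
    (hHe : ∀ r, 0 < r → ∀ y, He d r w y ≤ ofReal (B * r ^ (-γ)) * v y)
    (hE0 : ∫⁻ x, ‖ρ (t/2) x‖ₑ * v x ≤ ofReal (E0 * (t/2) ^ (-e)))
    (hE : ∀ τ, 0 < τ → τ ≤ T → ∫⁻ x, ‖F τ x‖ₑ * v x ≤ ofReal (E * τ ^ (-(e + 1/2)))) :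
    ∫⁻ x, w x * ‖ρ t x‖ₑ ≤ ofReal (Cd d * B * (E0 + E / (1/2 - γ)) * (t/2) ^ (-(γ + e))) := by
  have h2 : 0 < t / 2 := by positivity
  have := h.test2 h2.le (by linarith) hT hw (v := v) hB hγ0 hγ (E0 := E0 * (t/2) ^ (-e)) (E := E * (t/2) ^ (-(e + 1/2)))
    (by positivity) (by positivity) hHe hE0 (fun τ hτ => (hE τ (h2.trans hτ.1) (hτ.2.le.trans hT)).trans (ofReal_le_ofReal
      (mul_le_mul_of_nonneg_left (Real.rpow_le_rpow_of_nonpos h2 hτ.1.le (by linarith)) h1)))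
  refine this.trans (le_of_eq ?_)
  congr 1
  rw [show t - t/2 = t/2 by ring, show -(e + 1/2) = -(γ + e) + -(1/2 - γ) by ring, Real.rpow_add h2, Real.rpow_neg h2.le (1/2 - γ), neg_add, Real.rpow_add h2]
  have : 0 < (t/2) ^ (1/2 - γ) := by positivity
  have : 0 < 1/2 - γ := by linarith
  field_simp

def K1 (d : ℕ) (N M α : ℝ) : ℝ := Cd d * Ck d α * (N + M / (1/2 - α/2)) * 2 ^ (α/2)

lemma K1_nn {α : ℝ} (hN : 0 ≤ N) (hM : 0 ≤ M) (hα : α < 1) : 0 ≤ K1 d N M α := by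
  have := Cd_pos (d := d); have := Ck_pos (d := d) α
  have : 0 < 1/2 - α/2 := by linarith
  unfold K1; positivity

lemma Mild.step1 (hd : 2 ≤ d) (h : Mild T N M ρ F) {α : ℝ} (hα0 : 0 ≤ α) (hα : α < 1) {t : ℝ} (ht : 0 < t) (hT : t ≤ T) (x : Euc d) :
    Pt d α (fun y => ‖ρ t y‖ₑ) x ≤ ofReal (K1 d N M α * t ^ (-(α/2))) := by
  have hd' : (2:ℝ) ≤ d := by exact_mod_cast hd
  have hC := Ck_pos (d := d) α
  have := h.sp ht hT (w := fun y => kp d α (x - y)) (v := fun _ => 1) (by fun_prop) (B := Ck d α) (γ := α/2) (e := 0) (E0 := N) (E := M)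
    hC.le (by positivity) (by linarith) le_rfl h.N0 h.M0 (fun r hr y => by
      simp only [kp_comm α x]
      rw [He_trans, mul_one]; exact He_kp0 (by omega) hα0 (by linarith) hr _)
      (by simpa using h.mass (t/2) (by positivity) (by linarith)) (fun τ h1 h2 => by simpa using h.flux τ h1 h2)
  refine this.trans (le_of_eq ?_)
  congr 1
  unfold K1
  rw [add_zero, Real.div_rpow ht.le (by norm_num), Real.rpow_neg (by norm_num : (0:ℝ) ≤ 2)]
  field_simp

def K2 (d : ℕ) (N M : ℝ) : ℝ := Cd d * (Ck' d 1 (1/4) * (2 * K1 d N M (1/2))) * (N + M / (1/2 - 3/8)) * 2 ^ (3/8 : ℝ)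

lemma K2_nn (hN : 0 ≤ N) (hM : 0 ≤ M) : 0 ≤ K2 d N M := by
  have := Cd_pos (d := d); have := Ck'_pos (d := d) 1 (1/4); have := K1_nn (d := d) (α := 1/2) hN hM (by norm_num)
  have : (0:ℝ) < 1/2 - 3/8 := by norm_num
  unfold K2; positivity

lemma kp_prod (a b : Euc d) : kp d (1/4) a * kp d (1/4) b ≤ kp d (1/2) a + kp d (1/2) b := by
  have key : ∀ z : Euc d, kp d (1/4) z * kp d (1/4) z = kp d (1/2) z := fun z => by
    unfold kp
    rw [← sq, ← ENNReal.rpow_natCast, ← ENNReal.rpow_mul]; norm_num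
  rw [← key, ← key]
  rcases le_total (kp d (1/4) a) (kp d (1/4) b) with h | h
  · exact le_add_left (mul_le_mul' h le_rfl)
  · exact le_add_right (mul_le_mul' le_rfl h)

lemma Mild.step2 (hd : 2 ≤ d) (h : Mild T N M ρ F) {t : ℝ} (ht : 0 < t) (hT : t ≤ T) (x : Euc d) :
    ∫⁻ y, kp d (1/4) (x - y) * (‖ρ t y‖ₑ * Pt d 1 (fun z => ‖ρ t z‖ₑ) y) ≤ ofReal (K2 d N M * t ^ (-(5/8) : ℝ)) := by
  have hd' : (2:ℝ) ≤ d := by exact_mod_cast hd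
  have hC := Ck'_pos (d := d) 1 (1/4)
  have hm : Measurable (fun y => ‖ρ t y‖ₑ) := (meas_slice h.ρm t).enorm
  have hk1 := K1_nn (d := d) (α := 1/2) h.N0 h.M0 (by norm_num)
  set g : Euc d → ℝ≥0∞ := fun y => kp d (1/4) (x - y) * ‖ρ t y‖ₑ with hg
  have hgm : Measurable g := by fun_prop
  have e1 : ∫⁻ y, kp d (1/4) (x - y) * (‖ρ t y‖ₑ * Pt d 1 (fun z => ‖ρ t z‖ₑ) y) = ∫⁻ z, Pt d 1 g z * ‖ρ t z‖ₑ := by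
    have hj : Measurable (fun p : Euc d × Euc d => g p.1 * (kp d 1 (p.1 - p.2) * ‖ρ t p.2‖ₑ)) :=
      (hgm.comp measurable_fst).mul ((kp_meas_comp 1 (measurable_fst.sub measurable_snd)).mul (hm.comp measurable_snd))
    unfold Pt
    calc _ = ∫⁻ y, ∫⁻ z, g y * (kp d 1 (y - z) * ‖ρ t z‖ₑ) := by
          congr 1; ext y; rw [lintegral_const_mul _ (by fun_prop), hg, mul_assoc]
      _ = ∫⁻ z, ∫⁻ y, g y * (kp d 1 (y - z) * ‖ρ t z‖ₑ) := lintegral_lintegral_swap hj.aemeasurable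
      _ = _ := by
          congr 1; ext z
          rw [← lintegral_mul_const _ (show Measurable (fun y => kp d 1 (z - y) * g y) from Measurable.mul (kp_meas_comp 1 (by fun_prop)) hgm)]
          congr 1; ext y
          rw [kp_comm]; ring
  rw [e1]
  have gb : ∀ z, Pt d (1/4) g z ≤ ofReal (2 * K1 d N M (1/2) * t ^ (-(1/4) : ℝ)) := fun z => by
    calc _ ≤ ∫⁻ y, (kp d (1/2) (z - y) * ‖ρ t y‖ₑ + kp d (1/2) (x - y) * ‖ρ t y‖ₑ) := by
          unfold Pt
          refine lintegral_mono fun y => ?_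
          rw [← add_mul, show kp d (1/4) (z - y) * g y = kp d (1/4) (z - y) * kp d (1/4) (x - y) * ‖ρ t y‖ₑ from (mul_assoc _ _ _).symm]
          exact mul_le_mul' (kp_prod _ _) le_rfl
      _ = Pt d (1/2) (fun y => ‖ρ t y‖ₑ) z + Pt d (1/2) (fun y => ‖ρ t y‖ₑ) x := lintegral_add_left (by fun_prop) _
      _ ≤ _ := add_le_add (h.step1 hd (by norm_num) (by norm_num) ht hT z) (h.step1 hd (by norm_num) (by norm_num) ht hT x)
      _ = _ := by
          rw [← ofReal_add (by positivity) (by positivity)]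
          congr 1; norm_num; ring
  have := h.sp ht hT (w := Pt d 1 g) (v := fun _ => 1) (Pt_meas1 1 hgm) (B := Ck' d 1 (1/4) * (2 * K1 d N M (1/2) * t ^ (-(1/4) : ℝ))) (γ := 3/8) (e := 0) (E0 := N) (E := M)
    (by positivity) (by norm_num) (by norm_num) le_rfl h.N0 h.M0 (fun r hr z => by
      rw [He_Pt _ _ hgm, mul_one]
      calc _ ≤ ∫⁻ y, ofReal (Ck' d 1 (1/4) * r ^ (-(3/8) : ℝ)) * (kp d (1/4) (z - y) * g y) := by
            refine lintegral_mono fun y => ?_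
            rw [← mul_assoc (ofReal _)]
            refine mul_le_mul' ?_ (le_refl (g y))
            have := He_kp (d := d) (α := 1) (β := 1/4) (by omega) (by norm_num) (by norm_num) (by norm_num) (by linarith) hr (z - y)
            rwa [show -((1 - 1/4 : ℝ)/2) = -(3/8) by norm_num] at this
        _ ≤ ofReal (Ck' d 1 (1/4) * r ^ (-(3/8) : ℝ)) * ofReal (2 * K1 d N M (1/2) * t ^ (-(1/4) : ℝ)) := by
            rw [lintegral_const_mul' _ _ ofReal_ne_top]
            exact mul_le_mul' le_rfl (gb z)
        _ = _ := by
            rw [← ofReal_mul (by positivity)]; congr 1; ring)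
      (by simpa using h.mass (t/2) (by positivity) (by linarith)) (fun τ h1 h2 => by simpa using h.flux τ h1 h2)
  refine this.trans (le_of_eq ?_)
  congr 1
  unfold K2
  rw [add_zero, Real.div_rpow ht.le (by norm_num), Real.rpow_neg (by norm_num : (0:ℝ) ≤ 2), show (-(5/8) : ℝ) = -(1/4) + -(3/8) by norm_num, Real.rpow_add ht]
  field_simp

def K3 (d : ℕ) (N M : ℝ) : ℝ := Cd d * Ck' d 1 (1/4) * (K1 d N M (1/4) + K2 d N M / (1/2 - 3/8)) * 2 ^ (1/2 : ℝ)

lemma K3_nn (hN : 0 ≤ N) (hM : 0 ≤ M) : 0 ≤ K3 d N M := by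
  have := Cd_pos (d := d); have := Ck'_pos (d := d) 1 (1/4); have := K1_nn (d := d) (α := 1/4) hN hM (by norm_num); have := K2_nn (d := d) hN hM
  have : (0:ℝ) < 1/2 - 3/8 := by norm_num
  unfold K3; positivity

lemma Mild.step3 (hd : 2 ≤ d) (h : Mild T N M ρ F) (hfP : ∀ τ, 0 < τ → τ ≤ T → ∀ y, ‖F τ y‖ₑ ≤ ‖ρ τ y‖ₑ * Pt d 1 (fun z => ‖ρ τ z‖ₑ) y)
    {t : ℝ} (ht : 0 < t) (hT : t ≤ T) (x : Euc d) :
    Pt d 1 (fun y => ‖ρ t y‖ₑ) x ≤ ofReal (K3 d N M * t ^ (-(1/2) : ℝ)) := by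
  have hd' : (2:ℝ) ≤ d := by exact_mod_cast hd
  have hC := Ck'_pos (d := d) 1 (1/4)
  have := h.sp ht hT (w := fun y => kp d 1 (x - y)) (v := fun y => kp d (1/4) (x - y)) (by fun_prop) (B := Ck' d 1 (1/4)) (γ := 3/8) (e := 1/8) (E0 := K1 d N M (1/4)) (E := K2 d N M)
    hC.le (by norm_num) (by norm_num) (by norm_num) (K1_nn h.N0 h.M0 (by norm_num)) (K2_nn h.N0 h.M0) (fun r hr y => by
      simp only [kp_comm _ x]
      rw [He_trans]
      have := He_kp (d := d) (α := 1) (β := 1/4) (by omega) (by norm_num) (by norm_num) (by norm_num) (by linarith) hr (y - x)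
      rwa [show -((1 - 1/4 : ℝ)/2) = -(3/8) by norm_num] at this)
      (by
        have := h.step1 hd (α := 1/4) (by norm_num) (by norm_num) (t := t/2) (by positivity) (by linarith) x
        rw [show -((1/4 : ℝ)/2) = -(1/8) by norm_num] at this
        simpa only [mul_comm, Pt] using this) (fun τ h1 h2 => by
        have := h.step2 hd h1 h2 x
        rw [show (-(1/8 + 1/2) : ℝ) = -(5/8) by norm_num]
        refine le_trans (lintegral_mono fun y => ?_) this
        rw [mul_comm]; exact mul_le_mul' le_rfl (hfP τ h1 h2 y))
  refine this.trans (le_of_eq ?_)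
  congr 1
  unfold K3
  rw [show (-(3/8 + 1/8) : ℝ) = -(1/2) by norm_num, Real.div_rpow ht.le (by norm_num), Real.rpow_neg (by norm_num : (0:ℝ) ≤ 2)]
  field_simp
end Part14

section Part15
variable {d : ℕ}
variable {T N M : ℝ} {ρ : ℝ → Euc d → ℝ} {F : ℝ → Euc d → Euc d}

lemma Mild.block (h : Mild T N M ρ F) {s t κ : ℝ} (hs : 0 ≤ s) (hst : s < t) (hT : t ≤ T) (hκ : 0 ≤ κ)
    (hF : ∀ τ ∈ Ioc s t, ∀ y, ‖F τ y‖ₑ ≤ ofReal κ * ‖ρ τ y‖ₑ) (hsm : 4 * Cd d * κ * (t - s) ^ (1/2 : ℝ) ≤ 1) :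
    ∀ᵐ x, ‖ρ t x‖ₑ ≤ ofReal (2 * Cd d) * He d (2 * (t - s)) (fun y => ‖ρ s y‖ₑ) x := by
  have hC := Cd_pos (d := d)
  have hts : 0 < t - s := by linarith
  set C := Cd d with hCdef
  set ms : Euc d → ℝ≥0∞ := fun y => ‖ρ s y‖ₑ with hms
  have hmsm : Measurable ms := (meas_slice h.ρm s).enorm
  set V : ℝ → Euc d → ℝ≥0∞ := fun τ x => ofReal (2 * C) * He d (2 * (τ - s)) ms x with hV
  have hVm : Measurable (uncurry V) := by
    refine Measurable.mul measurable_const ?_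
    exact He_meas1 (d := d) (r := fun p : ℝ × Euc d => 2 * (p.1 - s)) (by fun_prop) hmsm measurable_snd
  set D : ℝ → Euc d → ℝ≥0∞ := fun τ x => ‖ρ τ x‖ₑ - V τ x with hD
  have hmm : Measurable (uncurry (fun τ x => ‖ρ τ x‖ₑ)) := h.ρm.enorm
  have hDm : Measurable (uncurry D) := hmm.sub hVm
  have hmD : ∀ τ x, ‖ρ τ x‖ₑ ≤ V τ x + D τ x := fun τ x => by rw [hD]; exact le_add_tsub
  have key : ∀ t' ∈ Ioc s t, ∀ᵐ x, D t' x ≤ ofReal (C * κ) * Du d s t' D x := fun t' ht' => by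
    have hts' : 0 < t' - s := by linarith [ht'.1]
    filter_upwards [h.ptw hs ht'.1 (ht'.2.trans hT)] with x hx
    rw [hD]; dsimp only
    rw [tsub_le_iff_left]
    refine hx.trans ?_
    have e1 : Du d s t' (fun τ y => ‖F τ y‖ₑ) x ≤ ofReal κ * (V t' x * ofReal ((t' - s) ^ (1/2 : ℝ) / (1/2)) + Du d s t' D x) := by
      calc _ ≤ ∫⁻ τ in Ioo s t', ofReal κ * (V t' x * ofReal ((t' - τ) ^ (-(1/2) : ℝ)) + ofReal ((t' - τ) ^ (-(1/2) : ℝ)) * He d (2 * (t' - τ)) (D τ) x) := by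
            unfold Du
            refine setLIntegral_mono' measurableSet_Ioo fun τ hτ => ?_
            have p1 : 0 < t' - τ := by linarith [hτ.2]
            have p2 : 0 < τ - s := by linarith [hτ.1]
            have e2 : He d (2 * (t' - τ)) (fun y => ‖F τ y‖ₑ) x ≤ ofReal κ * (V t' x + He d (2 * (t' - τ)) (D τ) x) := by
              calc _ ≤ He d (2 * (t' - τ)) (fun y => ofReal κ * (V τ y + D τ y)) x :=
                    He_mono _ (fun y => (hF τ ⟨hτ.1, hτ.2.le.trans ht'.2⟩ y).trans (mul_le_mul' le_rfl (hmD τ y))) x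
                _ = ofReal κ * (He d (2 * (t' - τ)) (V τ) x + He d (2 * (t' - τ)) (D τ) x) := by
                    rw [He_smul _ (show Measurable (fun y => V τ y + D τ y) from (meas_slice hVm τ).add (meas_slice hDm τ)), He_add _ (meas_slice hVm τ)]
                _ = _ := by
                    rw [hV]; dsimp only
                    rw [He_smul _ (show Measurable (fun y => He d (2 * (τ - s)) ms y) from He_meas1 (d := d) (r := fun _ : Euc d => 2 * (τ - s)) measurable_const hmsm measurable_id), He_semi _ _ (by positivity) (by positivity) hmsm,
                      show 2 * (t' - τ) + 2 * (τ - s) = 2 * (t' - s) by ring]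
            refine (mul_le_mul' le_rfl e2).trans (le_of_eq ?_)
            ring
        _ = _ := by
            rw [lintegral_const_mul' _ _ ofReal_ne_top, lintegral_add_left (by fun_prop), lintegral_const_mul _ (by fun_prop), lint_pow_right s t' (1/2) ht'.1 (by norm_num)]
            norm_num [Du]
    have e3 : ofReal C * (He d (2 * (t' - s)) ms x + ofReal κ * (V t' x * ofReal ((t' - s) ^ (1/2 : ℝ) / (1/2)))) ≤ V t' x := by
      have : ofReal C * (ofReal κ * (ofReal (2 * C) * ofReal ((t' - s) ^ (1/2 : ℝ) / (1/2)))) ≤ ofReal C := by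
        rw [← ofReal_mul (by positivity), ← ofReal_mul (by positivity), ← ofReal_mul (by positivity)]
        apply ofReal_le_ofReal
        have : (t' - s) ^ (1/2 : ℝ) ≤ (t - s) ^ (1/2 : ℝ) := Real.rpow_le_rpow hts'.le (by linarith [ht'.2]) (by norm_num)
        have : 4 * C * κ * (t' - s) ^ (1/2 : ℝ) ≤ 1 := (mul_le_mul_of_nonneg_left this (by positivity)).trans hsm
        calc _ = C * (4 * C * κ * (t' - s) ^ (1/2 : ℝ)) := by ring
          _ ≤ C * 1 := mul_le_mul_of_nonneg_left this hC.le
          _ = C := mul_one C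
      calc _ = ofReal C * He d (2 * (t' - s)) ms x + ofReal C * (ofReal κ * (ofReal (2 * C) * ofReal ((t' - s) ^ (1/2 : ℝ) / (1/2)))) * He d (2 * (t' - s)) ms x := by
            rw [hV]; ring
        _ ≤ ofReal C * He d (2 * (t' - s)) ms x + ofReal C * He d (2 * (t' - s)) ms x := by gcongr
        _ = _ := by
            rw [hV, ofReal_mul (by norm_num)]; simp; ring
    calc _ ≤ ofReal C * (He d (2 * (t' - s)) ms x + ofReal κ * (V t' x * ofReal ((t' - s) ^ (1/2 : ℝ) / (1/2)) + Du d s t' D x)) := by gcongr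
      _ = ofReal C * (He d (2 * (t' - s)) ms x + ofReal κ * (V t' x * ofReal ((t' - s) ^ (1/2 : ℝ) / (1/2)))) + ofReal (C * κ) * Du d s t' D x := by
          rw [ofReal_mul hC.le]; ring
      _ ≤ _ := by gcongr
  set S := ⨆ τ ∈ Ioc s t, ∫⁻ x, D τ x with hS
  have hSN : S ≤ ofReal N := iSup₂_le fun τ hτ => (lintegral_mono fun x => by rw [hD]; exact tsub_le_self).trans (h.mass τ (hs.trans hτ.1.le) (hτ.2.trans hT))
  have hSS : S ≤ ofReal (1/2) * S := iSup₂_le fun t' ht' => by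
    have hts' : 0 < t' - s := by linarith [ht'.1]
    have h1 := lint_Du hDm s t' (g := fun _ => 1) measurable_const
    simp only [one_mul] at h1
    calc _ ≤ ∫⁻ x, ofReal (C * κ) * Du d s t' D x := lintegral_mono_ae (key t' ht')
      _ ≤ ofReal (C * κ) * ∫⁻ τ in Ioo s t', ofReal ((t' - τ) ^ (-(1/2) : ℝ)) * S := by
          rw [lintegral_const_mul' _ _ ofReal_ne_top, h1]
          refine mul_le_mul' le_rfl (setLIntegral_mono' measurableSet_Ioo fun τ hτ => mul_le_mul' le_rfl ?_)
          have p1 : 0 < t' - τ := by linarith [hτ.2]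
          simp only [He_const (d := d) (2 * (t' - τ)) (by positivity), mul_one]
          exact le_iSup₂_of_le τ ⟨hτ.1, hτ.2.le.trans ht'.2⟩ le_rfl
      _ = ofReal (C * κ) * ofReal ((t' - s) ^ (1/2 : ℝ) / (1/2)) * S := by
          rw [lintegral_mul_const _ (by fun_prop), lint_pow_right s t' (1/2) ht'.1 (by norm_num), mul_assoc]; norm_num
      _ ≤ _ := by
          rw [← ofReal_mul (by positivity)]
          refine mul_le_mul' (ofReal_le_ofReal ?_) le_rfl
          have : (t' - s) ^ (1/2 : ℝ) ≤ (t - s) ^ (1/2 : ℝ) := Real.rpow_le_rpow hts'.le (by linarith [ht'.2]) (by norm_num)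
          have : 4 * C * κ * (t' - s) ^ (1/2 : ℝ) ≤ 1 := (mul_le_mul_of_nonneg_left this (by positivity)).trans hsm
          linarith
  have hS0 : S = 0 := by
    have hfin : S ≠ ⊤ := ne_top_of_le_ne_top ofReal_ne_top hSN
    rw [← ofReal_toReal hfin, ← ofReal_mul (by norm_num)] at hSS
    have := (ofReal_le_ofReal_iff (by positivity)).1 hSS
    have h0 : S.toReal = 0 := by linarith [ENNReal.toReal_nonneg (a := S)]
    exact ((ENNReal.toReal_eq_zero_iff S).1 h0).resolve_right hfin
  have hDt : ∫⁻ x, D t x = 0 := le_antisymm ((le_iSup₂_of_le (f := fun τ (_ : τ ∈ Ioc s t) => ∫⁻ x, D τ x) t ⟨hst, le_rfl⟩ le_rfl).trans hS0.le) zero_le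
  rw [lintegral_eq_zero_iff (meas_slice hDm t)] at hDt
  filter_upwards [hDt] with x hx
  exact tsub_eq_zero_iff_le.1 hx

def Ga (d : ℕ) : ℝ := 12 * Cd d ^ 2 * Ck d 1

lemma Mild.choose (h : Mild T N M ρ F) (hfP : ∀ τ, 0 < τ → τ ≤ T → ∀ y, ‖F τ y‖ₑ ≤ ‖ρ τ y‖ₑ * Pt d 1 (fun z => ‖ρ τ z‖ₑ) y)
    {U : ℝ} (hU : 1 ≤ U) (hP : ∀ t, 0 < t → t ≤ T → ∀ x, Pt d 1 (fun z => ‖ρ t z‖ₑ) x ≤ ofReal (U * t ^ (-(1/2) : ℝ)))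
    {t : ℝ} (ht : 0 < t) (hT : t ≤ T) :
    ∃ s, 0 < s ∧ s < t ∧ t - s = t / (32 * Cd d ^ 2 * U ^ 2) ∧ ∀ᵐ x, ‖ρ t x‖ₑ ≤ ofReal (2 * Cd d) * He d (2 * (t - s)) (fun y => ‖ρ s y‖ₑ) x := by
  have hC := one_le_Cd (d := d)
  have hX : 1 ≤ Cd d ^ 2 * U ^ 2 := by
    have : 1 ≤ Cd d * U := one_le_mul_of_one_le_of_one_le hC hU
    nlinarith
  have hη : t / (32 * Cd d ^ 2 * U ^ 2) ≤ t / 32 := div_le_div_of_nonneg_left ht.le (by norm_num) (by nlinarith)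
  have hη0 : 0 < t / (32 * Cd d ^ 2 * U ^ 2) := by positivity
  set e := t / (32 * Cd d ^ 2 * U ^ 2) with he
  have hs0 : 0 < t - e := by linarith
  refine ⟨t - e, hs0, by linarith, by ring, ?_⟩
  refine h.block hs0.le (by linarith) hT (κ := U * (t - e) ^ (-(1/2) : ℝ)) (by positivity) (fun τ hτ y => ?_) ?_
  · have p : 0 < τ := hs0.trans hτ.1
    refine (hfP τ p (hτ.2.trans hT) y).trans ?_
    rw [mul_comm]
    refine mul_le_mul' ((hP τ p (hτ.2.trans hT) y).trans (ofReal_le_ofReal ?_)) le_rfl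
    exact mul_le_mul_of_nonneg_left (Real.rpow_le_rpow_of_nonpos hs0 hτ.1.le (by norm_num)) (by positivity)
  · rw [sub_sub_cancel, Real.rpow_neg hs0.le, ← Real.sqrt_eq_rpow, ← Real.sqrt_eq_rpow]
    have h1 : 0 < √(t - e) := Real.sqrt_pos.2 hs0
    have h2 : 4 * Cd d * U * √e ≤ √(t - e) := by
      apply Real.le_sqrt_of_sq_le
      rw [mul_pow, Real.sq_sqrt hη0.le, he]
      have : (4 * Cd d * U) ^ 2 * (t / (32 * Cd d ^ 2 * U ^ 2)) = t / 2 := by field_simp; norm_num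
      rw [this]; linarith
    calc _ = 4 * Cd d * U * √e / √(t - e) := by field_simp
      _ ≤ 1 := (div_le_one h1).2 h2

lemma Mild.improve (hd : 2 ≤ d) (h : Mild T N M ρ F) (hfP : ∀ τ, 0 < τ → τ ≤ T → ∀ y, ‖F τ y‖ₑ ≤ ‖ρ τ y‖ₑ * Pt d 1 (fun z => ‖ρ τ z‖ₑ) y)
    {U : ℝ} (hU : 1 ≤ U) (hP : ∀ t, 0 < t → t ≤ T → ∀ x, Pt d 1 (fun z => ‖ρ t z‖ₑ) x ≤ ofReal (U * t ^ (-(1/2) : ℝ)))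
    {t : ℝ} (ht : 0 < t) (hT : t ≤ T) (x : Euc d) :
    Pt d 1 (fun z => ‖ρ t z‖ₑ) x ≤ ofReal (Ga d * N * U * t ^ (-(1/2) : ℝ)) := by
  have hd' : (2:ℝ) ≤ d := by exact_mod_cast hd
  have hC := one_le_Cd (d := d)
  have hK := Ck_pos (d := d) 1
  have hN := h.N0
  obtain ⟨s, hs0, hst, hse, hb⟩ := h.choose hfP hU hP ht hT
  have hts : 0 < t - s := by linarith
  have hmsm : Measurable (fun y => ‖ρ s y‖ₑ) := (meas_slice h.ρm s).enorm
  calc _ ≤ ∫⁻ y, ofReal (2 * Cd d) * (kp d 1 (x - y) * He d (2 * (t - s)) (fun y => ‖ρ s y‖ₑ) y) := by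
        unfold Pt
        refine lintegral_mono_ae ?_
        filter_upwards [hb] with y hy
        refine (mul_le_mul' le_rfl hy).trans (le_of_eq ?_)
        ring
    _ = ofReal (2 * Cd d) * Pt d 1 (He d (2 * (t - s)) (fun y => ‖ρ s y‖ₑ)) x := by
        rw [lintegral_const_mul' _ _ ofReal_ne_top, Pt]
    _ ≤ ofReal (2 * Cd d) * (ofReal (Ck d 1 * (2 * (t - s)) ^ (-(1/2) : ℝ)) * ofReal N) := by
        rw [Pt_He _ _ hmsm]
        refine mul_le_mul' le_rfl (le_trans ?_ (mul_le_mul' le_rfl (h.mass s hs0.le (hst.le.trans hT))))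
        rw [← lintegral_const_mul' _ _ ofReal_ne_top]
        exact lintegral_mono fun z => mul_le_mul' (He_kp0 (by omega) (by norm_num) (by linarith) (by positivity) _) le_rfl
    _ ≤ _ := by
        rw [← ofReal_mul (by positivity), ← ofReal_mul (by positivity)]
        apply ofReal_le_ofReal
        have h1 : (2 * (t - s)) ^ (-(1/2) : ℝ) ≤ 6 * Cd d * U * t ^ (-(1/2) : ℝ) := by
          rw [Real.rpow_neg (by positivity), Real.rpow_neg ht.le, ← Real.sqrt_eq_rpow, ← Real.sqrt_eq_rpow]
          have p1 : 0 < √t := Real.sqrt_pos.2 ht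
          have p2 : √t ≤ 6 * Cd d * U * √(2 * (t - s)) := by
            apply Real.sqrt_le_iff.2 ⟨by positivity, ?_⟩
            rw [mul_pow, Real.sq_sqrt (by positivity), hse]
            have : (6 * Cd d * U) ^ 2 * (2 * (t / (32 * Cd d ^ 2 * U ^ 2))) = 9 / 4 * t := by field_simp; norm_num
            rw [this]; linarith
          have p3 : 0 < √(2 * (t - s)) := Real.sqrt_pos.2 (by positivity)
          rw [inv_le_iff_one_le_mul₀ p3]
          calc (1:ℝ) = √t / √t := (div_self p1.ne').symm
            _ ≤ 6 * Cd d * U * √(2 * (t - s)) / √t := by gcongr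
            _ = _ := by field_simp
        calc _ ≤ 2 * Cd d * (Ck d 1 * (6 * Cd d * U * t ^ (-(1/2) : ℝ)) * N) := by gcongr
          _ = _ := by unfold Ga; ring

lemma Mild.valid1 (hd : 2 ≤ d) (h : Mild T N M ρ F) (hfP : ∀ τ, 0 < τ → τ ≤ T → ∀ y, ‖F τ y‖ₑ ≤ ‖ρ τ y‖ₑ * Pt d 1 (fun z => ‖ρ τ z‖ₑ) y)
    (hN : Ga d * N ≤ 1/2) (n : ℕ) (hP : ∀ t, 0 < t → t ≤ T → ∀ x, Pt d 1 (fun z => ‖ρ t z‖ₑ) x ≤ ofReal (2 ^ n * t ^ (-(1/2) : ℝ))) :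
    ∀ t, 0 < t → t ≤ T → ∀ x, Pt d 1 (fun z => ‖ρ t z‖ₑ) x ≤ ofReal (1 * t ^ (-(1/2) : ℝ)) := by
  induction n with
  | zero => simpa using hP
  | succ n ih =>
    refine ih fun t ht hT x => (h.improve hd hfP (one_le_pow₀ (by norm_num)) hP ht hT x).trans (ofReal_le_ofReal ?_)
    refine mul_le_mul_of_nonneg_right ?_ (by positivity)
    calc _ ≤ 1/2 * (2:ℝ) ^ (n + 1) := mul_le_mul_of_nonneg_right hN (by positivity)
      _ = _ := by ring

def Gi (d : ℕ) : ℝ := 2 * Cd d * (32 * Cd d ^ 2) ^ ((d:ℝ)/2)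

lemma Mild.sup (hd : 2 ≤ d) (h : Mild T N M ρ F) (hfP : ∀ τ, 0 < τ → τ ≤ T → ∀ y, ‖F τ y‖ₑ ≤ ‖ρ τ y‖ₑ * Pt d 1 (fun z => ‖ρ τ z‖ₑ) y)
    (hN : Ga d * N ≤ 1/2) {t : ℝ} (ht : 0 < t) (hT : t ≤ T) : ∀ᵐ x, ‖ρ t x‖ₑ ≤ ofReal (Gi d * N * t ^ (-((d:ℝ)/2))) := by
  have hC := Cd_pos (d := d)
  have hN0 := h.N0
  obtain ⟨n, hn⟩ := pow_unbounded_of_one_lt (K3 d N M) (by norm_num : (1:ℝ) < 2)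
  have hv := h.valid1 hd hfP hN n fun t ht hT x => (h.step3 hd hfP ht hT x).trans (ofReal_le_ofReal (mul_le_mul_of_nonneg_right hn.le (by positivity)))
  obtain ⟨s, hs0, hst, hse, hb⟩ := h.choose hfP le_rfl hv ht hT
  have hts : 0 < t - s := by linarith
  filter_upwards [hb] with x hx
  refine hx.trans ?_
  have : He d (2 * (t - s)) (fun y => ‖ρ s y‖ₑ) x ≤ ofReal ((2 * (t - s)) ^ (-(d:ℝ)/2)) * ofReal N := by
    refine (le_trans ?_ (mul_le_mul' le_rfl (h.mass s hs0.le (hst.le.trans hT))))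
    rw [← lintegral_const_mul' _ _ ofReal_ne_top]
    exact lintegral_mono fun z => mul_le_mul' (ofReal_le_ofReal (hk_le' (by positivity) _)) le_rfl
  refine (mul_le_mul' le_rfl this).trans ?_
  rw [← ofReal_mul (by positivity), ← ofReal_mul (by positivity)]
  apply ofReal_le_ofReal
  have h1 : (2 * (t - s)) ^ (-(d:ℝ)/2) ≤ (t - s) ^ (-(d:ℝ)/2) := Real.rpow_le_rpow_of_nonpos hts (by linarith) (by rw [neg_div]; simp; positivity)
  have h2 : (t - s) ^ (-(d:ℝ)/2) = (32 * Cd d ^ 2) ^ ((d:ℝ)/2) * t ^ (-((d:ℝ)/2)) := by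
    rw [hse, one_pow, mul_one, Real.div_rpow ht.le (by positivity), neg_div, Real.rpow_neg (by positivity : (0:ℝ) ≤ 32 * Cd d ^ 2)]
    rw [div_inv_eq_mul, mul_comm]
  rw [h2] at h1
  calc _ ≤ 2 * Cd d * ((32 * Cd d ^ 2) ^ ((d:ℝ)/2) * t ^ (-((d:ℝ)/2)) * N) := by gcongr
    _ = _ := by unfold Gi; ring
end Part15

section Part16
variable {d : ℕ}

lemma gradc_le (hd : 1 ≤ d) (f : Euc d → ℝ) (y : Euc d) : ‖gradc d f y‖ₑ ≤ Pt d 1 (fun z => ‖f z‖ₑ) y := by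
  unfold gradc Pt
  rw [enorm_smul]
  have hd' : (1:ℝ) ≤ d := by exact_mod_cast hd
  have h1 : ‖-(1 / (d * π))‖ₑ ≤ 1 := by
    rw [enorm_neg, Real.enorm_of_nonneg (by positivity)]
    refine ofReal_le_one.2 ?_
    have := Real.pi_gt_three
    rw [div_le_one (by positivity)]
    nlinarith
  calc _ ≤ 1 * ∫⁻ z, ‖(f z / ‖y - z‖ ^ 2) • (y - z)‖ₑ := mul_le_mul' h1 (enorm_integral_le_lintegral_enorm _)
    _ ≤ _ := by
        rw [one_mul]
        refine lintegral_mono fun z => ?_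
        dsimp only
        by_cases hz : y - z = 0
        · rw [hz]; simp
        · rw [kp_real 1 hz, ← ofReal_norm, ← ofReal_norm, ← ofReal_mul (by positivity)]
          apply ofReal_le_ofReal
          have : 0 < ‖y - z‖ := norm_pos_iff.2 hz
          rw [norm_smul, norm_div, norm_pow, norm_norm, Real.rpow_neg_one]
          apply le_of_eq; field_simp

lemma qd_eq (hd : 1 ≤ d) : qd d = ofReal (qr d) := by
  have hd' : (1:ℝ) ≤ d := by exact_mod_cast hd
  unfold qd qr
  rw [show (2 * d : ℝ≥0∞) = ofReal (2 * d) by rw [ofReal_mul (by norm_num)]; simp,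
    show (1 : ℝ≥0∞) = ofReal 1 by simp, ← ofReal_sub _ (by norm_num), ← ofReal_div_of_pos (by linarith)]
  congr 1
  have : (2 * d - 1 : ℝ) ≠ 0 := by linarith
  field_simp; ring

lemma hls_flux (hd : 2 ≤ d) {f : Euc d → ℝ} (hf : Measurable f) {C : ℝ≥0∞} (hC : C ≠ ⊤) {t : ℝ} (ht : 0 < t)
    (h : ofReal (t ^ (1/4 : ℝ)) * eLpNorm f (qd d) volume ≤ C) :
    ∫⁻ x, ‖f x‖ₑ * Pt d 1 (fun z => ‖f z‖ₑ) x ≤ ofReal (2 * Ch d * (C.toReal + 1) ^ 2 * t ^ (-(1/2) : ℝ)) := by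
  have hd' : (2:ℝ) ≤ d := by exact_mod_cast hd
  have hq0 : 0 < qr d := by
    have : (0:ℝ) < 2 * d - 1 := by linarith
    unfold qr; positivity
  have hCh := Ch_pos (d := d)
  have hC0 : 0 < C.toReal + 1 := by positivity
  set c := t ^ (1/4 : ℝ) / (C.toReal + 1) with hc
  have hc0 : 0 < c := by positivity
  have hm : Measurable (fun x => ‖f x‖ₑ) := hf.enorm
  have h1 : ∫⁻ x, (ofReal c * ‖f x‖ₑ) ^ qr d ≤ 1 := by
    have e1 : ofReal c * eLpNorm f (qd d) volume ≤ 1 := by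
      calc _ = ofReal (C.toReal + 1)⁻¹ * (ofReal (t ^ (1/4 : ℝ)) * eLpNorm f (qd d) volume) := by
            rw [← mul_assoc, ← ofReal_mul (by positivity), hc, div_eq_inv_mul]
        _ ≤ ofReal (C.toReal + 1)⁻¹ * ofReal C.toReal := by rw [ofReal_toReal hC]; exact mul_le_mul' le_rfl h
        _ ≤ 1 := by
            rw [← ofReal_mul (by positivity)]
            refine ofReal_le_one.2 ?_
            rw [inv_mul_le_one₀ hC0]; linarith
    rw [qd_eq (by omega), eLpNorm_eq_lintegral_rpow_enorm_toReal (by simpa using hq0) ofReal_ne_top, ENNReal.toReal_ofReal hq0.le] at e1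
    calc _ = (ofReal c * (∫⁻ x, ‖f x‖ₑ ^ qr d) ^ (1 / qr d)) ^ qr d := by
          simp_rw [ENNReal.mul_rpow_of_nonneg _ _ hq0.le]
          rw [lintegral_const_mul _ (by fun_prop), ← ENNReal.rpow_mul, one_div_mul_cancel hq0.ne', ENNReal.rpow_one]
      _ ≤ 1 ^ qr d := ENNReal.rpow_le_rpow e1 hq0.le
      _ = 1 := ENNReal.one_rpow _
  have h2 := hls hd (by fun_prop) h1
  have h3 : ∀ x, Pt d 1 (fun z => ofReal c * ‖f z‖ₑ) x = ofReal c * Pt d 1 (fun z => ‖f z‖ₑ) x := fun x => by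
    unfold Pt
    rw [← lintegral_const_mul' _ _ ofReal_ne_top]
    congr 1; ext z; ring
  have h4 : ofReal (c * c) * ∫⁻ x, ‖f x‖ₑ * Pt d 1 (fun z => ‖f z‖ₑ) x ≤ ofReal (2 * Ch d) := by
    refine le_trans (le_of_eq ?_) h2
    rw [← lintegral_const_mul' _ _ ofReal_ne_top, ofReal_mul hc0.le]
    congr 1; ext x; rw [h3]; ring
  calc _ = ofReal (c * c)⁻¹ * (ofReal (c * c) * ∫⁻ x, ‖f x‖ₑ * Pt d 1 (fun z => ‖f z‖ₑ) x) := by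
        rw [← mul_assoc, ← ofReal_mul (by positivity), inv_mul_cancel₀ (by positivity), ofReal_one, one_mul]
    _ ≤ ofReal (c * c)⁻¹ * ofReal (2 * Ch d) := mul_le_mul' le_rfl h4
    _ = _ := by
        rw [← ofReal_mul (by positivity)]
        congr 1
        have e : t ^ (1/4 : ℝ) * t ^ (1/4 : ℝ) * t ^ (-(1/2) : ℝ) = 1 := by
          rw [← Real.rpow_add ht, ← Real.rpow_add ht]; norm_num
        have e' : t ^ (-(1/2) : ℝ) = (t ^ (1/4 : ℝ) * t ^ (1/4 : ℝ))⁻¹ := eq_inv_of_mul_eq_one_right e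
        rw [hc, e']
        field_simp

lemma massA {ρ₀ : Euc d → ℝ} {T θ : ℝ} (hm : MemLp ρ₀ 1 volume) (h0 : ∀ x, 0 ≤ ρ₀ x) (hT : 0 < T) (hA : AssumptionA d ρ₀ T θ) :
    ∫⁻ x, ‖ρ₀ x‖ₑ ≤ ofReal θ := by
  have hA := hA 1 le_rfl T ⟨hT, le_rfl⟩
  have hi : Integrable ρ₀ := memLp_one_iff_integrable.1 hm
  simp only [inv_one, ENNReal.toReal_one, sub_self, mul_zero, Real.rpow_zero, ofReal_one, one_mul] at hA
  rw [eLpNorm_one_eq_lintegral_enorm] at hA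
  refine le_trans (le_of_eq ?_) hA
  have hgm : Measurable (fun x => ‖hm.1.mk _ x‖ₑ) := hm.1.stronglyMeasurable_mk.measurable.enorm
  have hae : ∀ᵐ x, ‖hm.1.mk _ x‖ₑ = ‖ρ₀ x‖ₑ := by filter_upwards [hm.1.ae_eq_mk] with x hx; rw [hx]
  rw [← lintegral_congr_ae hae, ← lint_Ge_He T hT hgm]
  congr 1; ext x
  unfold conv He
  rw [Real.enorm_of_nonneg (integral_nonneg fun y => mul_nonneg (hk_nonneg T hT.le _) (h0 y)), ofReal_integral_eq_lintegral_ofReal]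
  · refine lintegral_congr_ae ?_
    filter_upwards [hae] with y hy
    rw [hy, ofReal_mul (hk_nonneg T hT.le _), Real.enorm_of_nonneg (h0 y), Ge]
  · refine hi.bdd_mul (c := (4 * π * T) ^ (-(d:ℝ)/2)) (by have := hk_cont (d := d) T; fun_prop) (ae_of_all _ fun y => ?_)
    rw [Real.norm_of_nonneg (hk_nonneg T hT.le _)]
    exact hk_le T hT _
  · exact ae_of_all _ fun y => mul_nonneg (hk_nonneg T hT.le _) (h0 y)

lemma interp {f : Euc d → ℝ} (hf : AEStronglyMeasurable f volume) {a b : ℝ} (ha : 0 < a) (hb : 0 < b) (h1 : ∫⁻ x, ‖f x‖ₑ ≤ ofReal a)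
    (h2 : ∀ᵐ x, ‖f x‖ₑ ≤ ofReal (a * b)) {q : ℝ≥0∞} (hq : 1 ≤ q) : MemLp f q volume ∧ eLpNorm f q volume ≤ ofReal (a * b ^ (1 - q⁻¹.toReal)) := by
  suffices h : eLpNorm f q volume ≤ ofReal (a * b ^ (1 - q⁻¹.toReal)) from ⟨⟨hf, h.trans_lt ofReal_lt_top⟩, h⟩
  by_cases hqt : q = ⊤
  · subst hqt
    rw [eLpNorm_exponent_top]
    have h3 : eLpNormEssSup f volume ≤ ofReal (a * b) := essSup_le_of_ae_le _ h2
    simpa using h3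
  have hq1 : 1 ≤ q.toReal := by simpa using (ENNReal.toReal_le_toReal (by simp) hqt).2 hq
  have hq0 : q ≠ 0 := by rintro rfl; simp at hq
  have hp : 0 < q.toReal := by linarith
  rw [eLpNorm_eq_lintegral_rpow_enorm_toReal hq0 hqt, ENNReal.toReal_inv]
  set p := q.toReal
  have h3 : ∫⁻ x, ‖f x‖ₑ ^ p ≤ ofReal ((a * b ^ (1 - p⁻¹)) ^ p) := by
    calc _ ≤ ∫⁻ x, ofReal ((a * b) ^ (p - 1)) * ‖f x‖ₑ := by
          refine lintegral_mono_ae ?_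
          filter_upwards [h2] with x hx
          rw [← ofReal_rpow_of_pos (by positivity)]
          calc _ = ‖f x‖ₑ ^ (p - 1) * ‖f x‖ₑ := by
                nth_rw 3 [← ENNReal.rpow_one ‖f x‖ₑ]
                rw [← ENNReal.rpow_add_of_nonneg _ _ (by linarith) zero_le_one]; simp
            _ ≤ _ := mul_le_mul' (ENNReal.rpow_le_rpow hx (by linarith)) le_rfl
      _ ≤ ofReal ((a * b) ^ (p - 1)) * ofReal a := by
          rw [lintegral_const_mul' _ _ ofReal_ne_top]; exact mul_le_mul' le_rfl h1
      _ = _ := by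
          rw [← ofReal_mul (by positivity)]
          congr 1
          rw [Real.mul_rpow ha.le hb.le, Real.mul_rpow ha.le (by positivity), ← Real.rpow_mul hb.le, show (1 - p⁻¹) * p = p - 1 by field_simp,
            Real.rpow_sub_one ha.ne']
          field_simp
  calc _ ≤ (ofReal ((a * b ^ (1 - p⁻¹)) ^ p)) ^ (1 / p) := ENNReal.rpow_le_rpow h3 (by positivity)
    _ = _ := by
        rw [ofReal_rpow_of_nonneg (by positivity) (by positivity), ← Real.rpow_mul (by positivity), mul_one_div_cancel hp.ne', Real.rpow_one]
end Part16

section Part17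
variable {d : ℕ}

lemma avg_meas {f : Euc d → ℝ} (hf : AEStronglyMeasurable f volume) (r : ℝ) : Measurable (fun x => ⨍ y in Metric.closedBall x r, f y) := by
  have hg := hf.stronglyMeasurable_mk.measurable
  have e : (fun x => ⨍ y in Metric.closedBall x r, f y) = fun x => (volume (Metric.closedBall (0 : Euc d) r)).toReal⁻¹ • ∫ y, (if dist y x ≤ r then hf.mk f y else 0) := by
    ext x
    rw [setAverage_eq, measureReal_def, Measure.addHaar_closedBall_center, ← integral_indicator Metric.isClosed_closedBall.measurableSet]
    congr 1
    refine integral_congr_ae ?_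
    filter_upwards [hf.ae_eq_mk] with y hy
    simp only [Set.indicator, Metric.mem_closedBall, hy]
  rw [e]
  refine Measurable.const_smul (M := ℝ) (?_ : Measurable (fun x : Euc d => ∫ y, (if dist y x ≤ r then hf.mk f y else 0))) (_ : ℝ)
  refine StronglyMeasurable.measurable (StronglyMeasurable.integral_prod_right (f := fun (x y : Euc d) => if dist y x ≤ r then hf.mk f y else 0) ?_)
  refine Measurable.stronglyMeasurable ?_
  exact Measurable.ite (measurableSet_le (by fun_prop) measurable_const) (hg.comp measurable_snd) measurable_const

lemma limsup_meas_aux {T : ℝ} {A : ℕ → Ioc (0:ℝ) T → Euc d → ℝ} (hAm : ∀ n, Measurable (uncurry (A n))) {c : ℝ → Ioc (0:ℝ) T} (hcm : Measurable c)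
    {f : Euc d → ℝ} (hf : Measurable f) {D : ∀ t : ℝ, Decidable (t ∈ Ioc (0:ℝ) T)} :
    Measurable (uncurry fun (t : ℝ) (x : Euc d) => if t ∈ Ioc (0:ℝ) T then limsup (fun n => A n (c t) x) atTop else f x) := by
  have hg : ∀ n, Measurable (fun p : ℝ × Euc d => A n (c p.1) p.2) := fun n =>
    (hAm n).comp ((hcm.comp measurable_fst).prodMk measurable_snd)
  have hs : MeasurableSet {p : ℝ × Euc d | p.1 ∈ Ioc (0:ℝ) T} := measurable_fst measurableSet_Ioc
  have hL : Measurable (fun p : ℝ × Euc d => limsup (fun n => A n (c p.1) p.2) atTop) := Measurable.limsup hg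
  exact Measurable.ite (p := fun p : ℝ × Euc d => p.1 ∈ Ioc (0:ℝ) T) hs hL (hf.comp measurable_snd)

lemma exists_mod {T : ℝ} (hT : 0 < T) {ρ : ℝ → Euc d → ℝ} (h1 : ∀ t ∈ Ioc (0:ℝ) T, MemLp (ρ t) 1 volume)
    (h2 : ∀ t ∈ Ioc (0:ℝ) T, Tendsto (fun s => eLpNorm (fun x => ρ s x - ρ t x) 1 volume) (𝓝[Ioc (0:ℝ) T] t) (𝓝 0)) {f : Euc d → ℝ} (hf : Measurable f) :
    ∃ R : ℝ → Euc d → ℝ, Measurable (uncurry R) ∧ R 0 = f ∧ ∀ t ∈ Ioc (0:ℝ) T, R t =ᵐ[volume] ρ t := by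
  classical
  set δ : ℕ → ℝ := fun n => 1 / ((n:ℝ) + 1) with hδ
  set A : ℕ → Ioc (0:ℝ) T → Euc d → ℝ := fun n i x => ⨍ y in Metric.closedBall x (δ n), ρ i y with hA
  have hAm : ∀ n, Measurable (uncurry (A n)) := fun n => by
    refine measurable_uncurry_of_continuous_of_measurable (fun x => ?_) (fun i => avg_meas (h1 i i.2).1 _)
    rw [continuous_iff_continuousAt]
    intro i
    rw [hA]
    simp only [setAverage_eq, ContinuousAt]
    refine Tendsto.const_smul ?_ _
    refine tendsto_setIntegral_of_L1' (F := fun j : Ioc (0:ℝ) T => ρ j) (ρ i) (h1 i i.2).1 (Eventually.of_forall fun j => memLp_one_iff_integrable.1 (h1 j j.2)) ?_ _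
    exact (h2 i i.2).comp (tendsto_nhdsWithin_iff.2 ⟨continuous_subtype_val.tendsto _, Eventually.of_forall fun j => j.2⟩)
  set c : ℝ → Ioc (0:ℝ) T := fun t => ⟨if t ∈ Ioc (0:ℝ) T then t else T, by split_ifs with h; exacts [h, ⟨hT, le_rfl⟩]⟩ with hc
  have hcm : Measurable c := Measurable.subtype_mk (Measurable.ite measurableSet_Ioc measurable_id measurable_const)
  set R : ℝ → Euc d → ℝ := fun t x => if t ∈ Ioc (0:ℝ) T then limsup (fun n => A n (c t) x) atTop else f x with hR
  refine ⟨R, ?_, ?_, fun t ht => ?_⟩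
  · exact limsup_meas_aux hAm hcm hf
  · ext x; simp [hR]
  · have hi := memLp_one_iff_integrable.1 (h1 t ht)
    have hct : (c t : ℝ) = t := by rw [hc]; simp only; rw [if_pos ht]
    filter_upwards [IsUnifLocDoublingMeasure.ae_tendsto_average (μ := volume) hi.locallyIntegrable 1] with x hx
    have hδ0 : Tendsto δ atTop (𝓝[>] 0) :=
      tendsto_nhdsWithin_iff.2 ⟨tendsto_one_div_add_atTop_nhds_zero_nat, Eventually.of_forall fun n => by rw [hδ]; simp only [Set.mem_Ioi]; positivity⟩
    have := hx (fun _ => x) δ hδ0 (Eventually.of_forall fun n => by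
      rw [one_mul]; exact Metric.mem_closedBall_self (by rw [hδ]; positivity))
    rw [hR]; simp only; rw [if_pos ht]
    refine Tendsto.limsup_eq ?_
    rw [hA]; simp only; rw [hct]; exact this

lemma gradc_congr {f g : Euc d → ℝ} (h : f =ᵐ[volume] g) : gradc d f = gradc d g := by
  ext1 x
  unfold gradc
  congr 1
  refine integral_congr_ae ?_
  filter_upwards [h] with y hy
  rw [hy]

lemma gradc_meas {R : ℝ → Euc d → ℝ} (hR : Measurable (uncurry R)) : Measurable (uncurry fun t => gradc d (R t)) := by
  unfold gradc
  refine Measurable.const_smul (M := ℝ) (?_ : Measurable (fun p : ℝ × Euc d => ∫ y, (R p.1 y / ‖p.2 - y‖ ^ 2) • (p.2 - y))) (_ : ℝ)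
  refine StronglyMeasurable.measurable (StronglyMeasurable.integral_prod_right (f := fun (p : ℝ × Euc d) (y : Euc d) => (R p.1 y / ‖p.2 - y‖ ^ 2) • (p.2 - y)) ?_)
  refine Measurable.stronglyMeasurable ?_
  have : Measurable (fun q : (ℝ × Euc d) × Euc d => R q.1.1 q.2) := hR.comp ((measurable_fst.comp measurable_fst).prodMk measurable_snd)
  exact (this.div (by fun_prop)).smul (by fun_prop)

lemma gradc_one {f : Euc 1 → ℝ} (hf : Integrable f) : ∀ᵐ x, f x • gradc 1 f x = 0 := by
  set δ : ℕ → ℝ := fun n => 1 / ((n:ℝ) + 1) with hδ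
  have hδp : ∀ n, 0 < δ n := fun n => by rw [hδ]; positivity
  have hδ0 : Tendsto δ atTop (𝓝[>] 0) := tendsto_nhdsWithin_iff.2 ⟨tendsto_one_div_add_atTop_nhds_zero_nat, Eventually.of_forall hδp⟩
  filter_upwards [IsUnifLocDoublingMeasure.ae_tendsto_average (μ := volume) hf.norm.locallyIntegrable 1] with x hx
  have ha := hx (fun _ => x) δ hδ0 (Eventually.of_forall fun n => by
      rw [one_mul]; exact Metric.mem_closedBall_self (hδp n).le)
  by_cases hi : Integrable (fun y => (f y / ‖x - y‖ ^ 2) • (x - y))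
  swap
  · unfold gradc; rw [integral_undef hi]; simp
  have h0 : ‖f x‖ = 0 := by
    set b := (volume (Metric.ball (0 : Euc 1) 1)).toReal with hb
    have hb0 : 0 < b := ENNReal.toReal_pos (Metric.measure_ball_pos _ _ one_pos).ne' measure_ball_lt_top.ne
    have hvol : ∀ n, volume.real (Metric.closedBall x (δ n)) = δ n * b := fun n => by
      rw [measureReal_def, Measure.addHaar_closedBall _ _ (hδp n).le, ENNReal.toReal_mul, ENNReal.toReal_ofReal (by have := hδp n; positivity)]
      simp [hb]
    have hlim : Tendsto (fun n => ∫ y in Metric.closedBall x (δ n), ‖(f y / ‖x - y‖ ^ 2) • (x - y)‖) atTop (𝓝 0) := by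
      refine hi.norm.hasFiniteIntegral.tendsto_setIntegral_nhds_zero ?_
      have e : (volume ∘ fun n => Metric.closedBall x (δ n)) = fun n => ofReal (δ n * b) := by
        ext n
        rw [← hvol n, measureReal_def, ofReal_toReal measure_closedBall_lt_top.ne]; rfl
      rw [e]
      have h1 : Tendsto (fun n => δ n * b) atTop (𝓝 (0 * b)) := (tendsto_nhds_of_tendsto_nhdsWithin hδ0).mul_const b
      have := (ENNReal.continuous_ofReal.tendsto _).comp h1
      rw [zero_mul, ofReal_zero] at this
      exact this
    have hle : ∀ n, (⨍ y in Metric.closedBall x (δ n), ‖f y‖) ≤ b⁻¹ * ∫ y in Metric.closedBall x (δ n), ‖(f y / ‖x - y‖ ^ 2) • (x - y)‖ := fun n => by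
      have hp := hδp n
      rw [setAverage_eq, hvol, smul_eq_mul, mul_inv, mul_comm (δ n)⁻¹, mul_assoc]
      refine mul_le_mul_of_nonneg_left ?_ (by positivity)
      rw [← integral_const_mul]
      refine setIntegral_mono_on_ae (hf.norm.const_mul _).integrableOn hi.norm.integrableOn Metric.isClosed_closedBall.measurableSet ?_
      have hne : ∀ᵐ y : Euc 1, y ≠ x := compl_mem_ae_iff.2 (measure_singleton x)
      filter_upwards [hne] with y hy hyb
      have h3 : 0 < ‖x - y‖ := norm_pos_iff.2 (sub_ne_zero.2 (Ne.symm hy))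
      have h4 : ‖x - y‖ ≤ δ n := by rw [← dist_eq_norm, dist_comm]; exact hyb
      rw [norm_smul, norm_div, norm_pow, norm_norm]
      have e : ‖f y‖ / ‖x - y‖ ^ 2 * ‖x - y‖ = ‖x - y‖⁻¹ * ‖f y‖ := by field_simp
      rw [e]
      gcongr
    have := le_of_tendsto_of_tendsto' ha (hlim.const_mul b⁻¹) hle
    rw [mul_zero] at this
    exact le_antisymm this (norm_nonneg _)
  rw [norm_eq_zero.1 h0, zero_smul]
end Part17

lemma main_one : ∃ A : ℝ, 0 < A ∧ ∃ θ₀ : ℝ, 0 < θ₀ ∧ ∀ θ : ℝ, 0 < θ → θ ≤ θ₀ →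
    ∀ (ρ₀ : Euc 1 → ℝ) (T : ℝ) (ρ : ℝ → Euc 1 → ℝ), MemLp ρ₀ 1 volume → (∀ x, 0 ≤ ρ₀ x) → 0 < T →
    AssumptionA 1 ρ₀ T θ → IsMildSolution 1 ρ₀ T ρ → MemXT 1 T ρ → ∀ q : ℝ≥0∞, 1 ≤ q → ∀ t ∈ Ioc (0:ℝ) T,
    MemLp (ρ t) q volume ∧ eLpNorm (ρ t) q volume ≤ ofReal (A * θ * t ^ (-((((1:ℕ) : ℝ) / 2) * (1 - q⁻¹.toReal)))) := by
  refine ⟨1, one_pos, 1, one_pos, fun θ hθ _ ρ₀ T ρ hm h0 hT hA hM hX q hq t ht => ?_⟩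
  have e : ρ t = conv (heatKernel 1 t) ρ₀ := by
    ext x
    rw [hM t ht x]
    unfold mildRHS
    rw [sub_eq_self]
    refine setIntegral_eq_zero_of_forall_eq_zero fun s hs => ?_
    have := gradc_one (memLp_one_iff_integrable.1 (hX.1 s ⟨hs.1, hs.2.trans ht.2⟩))
    refine integral_eq_zero_of_ae ?_
    filter_upwards [this] with y hy
    rw [hy, inner_zero_right]; rfl
  have hb := hA q hq t ht
  rw [← e] at hb
  have key : eLpNorm (ρ t) q volume ≤ ofReal (1 * θ * t ^ (-((((1:ℕ) : ℝ) / 2) * (1 - q⁻¹.toReal)))) := by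
    rw [one_mul, Real.rpow_neg ht.1.le, ← div_eq_mul_inv, ofReal_div_of_pos (Real.rpow_pos_of_pos ht.1 _)]
    rw [ENNReal.le_div_iff_mul_le (Or.inl (by simpa using Real.rpow_pos_of_pos ht.1 _)) (Or.inl ofReal_ne_top), mul_comm]
    exact hb
  exact ⟨⟨(hX.1 t ht).1, key.trans_lt ofReal_lt_top⟩, key⟩

lemma main_two (d : ℕ) (hd : 2 ≤ d) : ∃ A : ℝ, 0 < A ∧ ∃ θ₀ : ℝ, 0 < θ₀ ∧ ∀ θ : ℝ, 0 < θ → θ ≤ θ₀ →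
    ∀ (ρ₀ : Euc d → ℝ) (T : ℝ) (ρ : ℝ → Euc d → ℝ), MemLp ρ₀ 1 volume → (∀ x, 0 ≤ ρ₀ x) → 0 < T →
    AssumptionA d ρ₀ T θ → IsMildSolution d ρ₀ T ρ → MemXT d T ρ → ∀ q : ℝ≥0∞, 1 ≤ q → ∀ t ∈ Ioc (0:ℝ) T,
    MemLp (ρ t) q volume ∧ eLpNorm (ρ t) q volume ≤ ofReal (A * θ * t ^ (-(((d : ℝ) / 2) * (1 - q⁻¹.toReal)))) := by
  have hCd := one_le_Cd (d := d)
  have hGi : 1 ≤ Gi d := by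
    unfold Gi
    have h1 : 1 ≤ (32 * Cd d ^ 2) ^ ((d:ℝ) / 2) := Real.one_le_rpow (by nlinarith) (by positivity)
    nlinarith
  have hGa : 0 < Ga d := by
    unfold Ga
    have := Ck_pos (d := d) 1
    have := Cd_pos (d := d)
    positivity
  refine ⟨2 * Gi d, by linarith, 1 / (4 * Ga d), by positivity, fun θ hθ hθ0 ρ₀ T ρ hm h0 hT hA hM hX q hq t ht => ?_⟩
  have hmass0 := massA hm h0 hT hA
  obtain ⟨hX1, hX2, ⟨C1, hC1, hX3⟩, ⟨C, hC, hX4⟩⟩ := hX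
  obtain ⟨R, hRm, hR0, hRe⟩ := exists_mod hT hX1 hX2 hm.1.stronglyMeasurable_mk.measurable
  set F : ℝ → Euc d → Euc d := fun τ y => R τ y • gradc d (R τ) y with hF
  have hfP : ∀ τ, 0 < τ → τ ≤ T → ∀ y, ‖F τ y‖ₑ ≤ ‖R τ y‖ₑ * Pt d 1 (fun z => ‖R τ z‖ₑ) y := fun τ _ _ y => by
    rw [hF]; simp only; rw [enorm_smul]
    exact mul_le_mul_right (gradc_le (by omega) _ _) _
  have hR0m : ∫⁻ x, ‖R 0 x‖ₑ ≤ ofReal θ := by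
    refine le_trans (le_of_eq (lintegral_congr_ae ?_)) hmass0
    filter_upwards [hm.1.ae_eq_mk] with x hx
    rw [hR0, hx]
  set N := max C1.toReal θ with hN
  set M := 2 * Ch d * (C.toReal + 1) ^ 2 with hMd
  have hM0 : 0 ≤ M := by have := Ch_pos (d := d) ; positivity
  have hN0 : 0 ≤ N := hθ.le.trans (le_max_right _ _)
  have hFm : Measurable (uncurry F) := hRm.smul (gradc_meas hRm)
  have hmild : Mild T N M R F := by
    refine ⟨hRm, hFm, hN0, hM0, fun s h1 h2 => ?_, fun s h1 h2 => ?_, fun s h1 h2 => ?_⟩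
    · rcases h1.eq_or_lt with h1 | h1
      · rw [← h1]
        exact hR0m.trans (ofReal_le_ofReal (le_max_right _ _))
      · rw [← eLpNorm_one_eq_lintegral_enorm, eLpNorm_congr_ae (hRe s ⟨h1, h2⟩)]
        refine (hX3 s ⟨h1, h2⟩).trans ?_
        rw [← ofReal_toReal hC1]
        exact ofReal_le_ofReal (le_max_left _ _)
    · refine (lintegral_mono (hfP s h1 h2)).trans ?_
      refine hls_flux hd (meas_slice hRm s) hC h1 ?_
      rw [eLpNorm_congr_ae (hRe s ⟨h1, h2⟩)]
      exact hX4 s ⟨h1, h2⟩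
    · filter_upwards [hRe s ⟨h1, h2⟩] with x hx
      rw [hx, hM s ⟨h1, h2⟩ x]
      unfold mildRHS
      congr 1
      · unfold conv Hr
        refine integral_congr_ae ?_
        filter_upwards [hm.1.ae_eq_mk] with y hy
        rw [hR0, hy]
      · rw [integral_Ioc_eq_integral_Ioo]
        refine setIntegral_congr_fun measurableSet_Ioo fun τ hτ => ?_
        have hτ' : τ ∈ Ioc (0:ℝ) T := ⟨hτ.1, hτ.2.le.trans h2⟩
        refine integral_congr_ae ?_
        filter_upwards [hRe τ hτ'] with y hy
        rw [gradHeat_eq, hF]; simp only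
        rw [gradc_congr (hRe τ hτ'), hy]
  have hK := K3_nn (d := d) hN0 hM0
  have hub : ∀ τ ∈ Ioc (0:ℝ) T, ∀ y, ‖gradc d (R τ) y‖ ≤ K3 d N M * τ ^ (-(1/2) : ℝ) := fun τ hτ y => by
    have h1 := (gradc_le (by omega) (R τ) y).trans (hmild.step3 hd hfP hτ.1 hτ.2 y)
    rw [← ofReal_norm] at h1
    exact (ofReal_le_ofReal_iff (mul_nonneg hK (Real.rpow_nonneg hτ.1.le _))).1 h1
  have hmass2 : ∀ s, 0 ≤ s → s ≤ T → ∫⁻ x, ‖R s x‖ₑ ≤ ofReal (2 * θ) := fun s h1 h2 =>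
    massBound hmild hT hK (gradc_meas hRm) hub (fun _ _ _ => rfl) hθ.le hR0m ⟨h1, h2⟩
  have hmild2 : Mild T (2 * θ) M R F := ⟨hRm, hFm, by positivity, hM0, hmass2, hmild.flux, hmild.mild⟩
  have hsm : Ga d * (2 * θ) ≤ 1 / 2 := by
    have := mul_le_mul_of_nonneg_left hθ0 hGa.le
    have e : Ga d * (1 / (4 * Ga d)) = 1 / 4 := by field_simp
    rw [e] at this; linarith
  have hsup := hmild2.sup hd hfP hsm ht.1 ht.2
  have hre := hRe t ht
  have hb : 0 < t ^ (-((d:ℝ) / 2)) := Real.rpow_pos_of_pos ht.1 _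
  have fin := interp (q := q) (a := 2 * Gi d * θ) (b := t ^ (-((d:ℝ) / 2))) (hX1 t ht).1 (by positivity) hb ?_ ?_ hq
  · rw [← Real.rpow_mul ht.1.le, neg_mul] at fin
    exact fin
  · rw [← lintegral_congr_ae (show (fun x => ‖R t x‖ₑ) =ᵐ[volume] fun x => ‖ρ t x‖ₑ by filter_upwards [hre] with x hx; rw [hx])]
    refine (hmass2 t ht.1.le ht.2).trans (ofReal_le_ofReal ?_)
    nlinarith
  · filter_upwards [hsup, hre] with x hx1 hx2
    rw [← hx2]
    refine hx1.trans (le_of_eq ?_)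
    congr 1; ring

end Main

/-- hypercontractivity `L^q` estimate for mild solutions under
Assumption (𝒜), with constant `A` depending only on the dimension. -/
theorem mPKS_Lq_hypercontractivity (d : ℕ) (hd : 1 ≤ d) :
    ∃ A : ℝ, 0 < A ∧
      ∃ θ₀ : ℝ, 0 < θ₀ ∧
        ∀ θ : ℝ, 0 < θ → θ ≤ θ₀ →
          ∀ (ρ₀ : Euc d → ℝ) (T : ℝ) (ρ : ℝ → Euc d → ℝ),
            MemLp ρ₀ 1 volume → (∀ x, 0 ≤ ρ₀ x) → 0 < T →
            AssumptionA d ρ₀ T θ → IsMildSolution d ρ₀ T ρ → MemXT d T ρ →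
            ∀ q : ℝ≥0∞, 1 ≤ q → ∀ t ∈ Set.Ioc (0:ℝ) T,
              MemLp (ρ t) q volume ∧
                eLpNorm (ρ t) q volume ≤
                  ENNReal.ofReal
                    (A * θ * t ^ (-(((d : ℝ) / 2) * (1 - q⁻¹.toReal)))) := by
  rcases hd.eq_or_lt with h | h
  · subst h; exact main_one
  · exact main_two d h

end
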